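/- Let q = 2^r with r ≥ 1 a positive integer. If Π is a finite projective plane of order q that is not isomorphic to the Desarguesian plane ℙ²(F_q), then C_7(Π) > C_7(ℙ²(F_q)); that is, among all projective planes of order q = 2^r, the Desarguesian plane has strictly the fewest 7-arcs. -/

import Mathlib

open scoped Classical

structure ProjPlane (q : ℕ) where
  Point : Type
  fintypePoint : Fintype Point
  L : Set (Set Point)
  unique_line : ∀ p₁ p₂ : Point, p₁ ≠ p₂ → ∃! ℓ, ℓ ∈ L ∧ p₁ ∈ ℓ ∧ p₂ ∈ ℓ
  unique_point : ∀ ℓ₁ ℓ₂, ℓ₁ ∈ L → ℓ₂ ∈ L → ℓ₁ ≠ ℓ₂ → ∃! p, p ∈ ℓ₁ ∧ p ∈ ℓ₂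
  nondegenerate : ∃ a b c d : Point, a ≠ b ∧ a ≠ c ∧ a ≠ d ∧ b ≠ c ∧ b ≠ d ∧ c ≠ d ∧
    ∀ ℓ ∈ L, ¬({a, b, c} ⊆ ℓ) ∧ ¬({a, b, d} ⊆ ℓ) ∧ ¬({a, c, d} ⊆ ℓ) ∧ ¬({b, c, d} ⊆ ℓ)
  line_card : ∀ ℓ ∈ L, ℓ.ncard = q + 1
  point_card : ∀ p : Point, {ℓ ∈ L | p ∈ ℓ}.ncard = q + 1

/-- A set of points is collinear if it is contained in a line. -/
noncomputable def ProjPlane.Collinear {q : ℕ} (Pl : ProjPlane q) (s : Set Pl.Point) : Prop :=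
  ∃ ℓ ∈ Pl.L, s ⊆ ℓ

/-- The number of ordered `n`-arcs of the plane. -/
noncomputable def ProjPlane.nArcs {q : ℕ} (Pl : ProjPlane q) (n : ℕ) : ℕ :=
  Nat.card {p : Fin n → Pl.Point // Function.Injective p ∧
    ∀ i j k : Fin n, i ≠ j → i ≠ k → j ≠ k → ¬ Pl.Collinear {p i, p j, p k}}

/-- Number of ordered strong realizations of the Fano plane. -/
noncomputable def ProjPlane.A7 {q : ℕ} (Pl : ProjPlane q) : ℕ :=
  Nat.card {p : ZMod 7 → Pl.Point // Function.Injective p ∧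
    ∃ σ : Equiv.Perm (ZMod 7), ∀ i j k : ZMod 7, i ≠ j → i ≠ k → j ≠ k →
      (Pl.Collinear {p (σ i), p (σ j), p (σ k)} ↔
        ∃ a : ZMod 7, ({i, j, k} : Set (ZMod 7)) = {a, a + 1, a + 3})}

/-- Number of ordered strong realizations of the Möbius–Kantor configuration. -/
noncomputable def ProjPlane.A8 {q : ℕ} (Pl : ProjPlane q) : ℕ :=
  Nat.card {p : ZMod 8 → Pl.Point // Function.Injective p ∧
    ∃ σ : Equiv.Perm (ZMod 8), ∀ i j k : ZMod 8, i ≠ j → i ≠ k → j ≠ k →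
      (Pl.Collinear {p (σ i), p (σ j), p (σ k)} ↔
        ∃ a : ZMod 8, ({i, j, k} : Set (ZMod 8)) = {a, a + 1, a + 3})}

/-- The lines of the Desarguesian plane `ℙ²(F)`: sets of points (1-dimensional
subspaces of `F³`) contained in a fixed 2-dimensional subspace of `F³`. -/
def P2Lines (F : Type) [Field F] : Set (Set (Projectivization F (Fin 3 → F))) :=
  {ℓ | ∃ W : Submodule F (Fin 3 → F), Module.finrank F W = 2 ∧
    ℓ = {x | x.submodule ≤ W}}

/-- The number of ordered `n`-arcs of the Desarguesian plane `ℙ²(F)`. -/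
noncomputable def P2nArcs (F : Type) [Field F] (n : ℕ) : ℕ :=
  Nat.card {p : Fin n → Projectivization F (Fin 3 → F) // Function.Injective p ∧
    ∀ i j k : Fin n, i ≠ j → i ≠ k → j ≠ k →
      ¬ ∃ ℓ ∈ P2Lines F, {p i, p j, p k} ⊆ ℓ}

namespace PlaneArcs

set_option linter.unusedSectionVars false

open Configuration ProjectivePlane

/-! ## Incidence in projective planes -/

section Incidence

variable {P : Type*} (L : Type*) [Membership P L] [ProjectivePlane P L]

lemma exists_join (a b : P) : ∃ l : L, a ∈ l ∧ b ∈ l := by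
  by_cases h : a = b
  · subst h
    obtain ⟨p, q, r, l, m, n, h⟩ := ProjectivePlane.exists_config (P := P) (L := L)
    have : ∃ c : P, c ≠ a := by
      by_contra! hc
      have h1 := hc p
      have h2 := hc q
      grind
    obtain ⟨c, hc⟩ := this
    exact ⟨HasLines.mkLine hc, (HasLines.mkLine_ax hc).2, (HasLines.mkLine_ax hc).2⟩
  · exact ⟨HasLines.mkLine h, (HasLines.mkLine_ax h)⟩

/-- A line through two points (the line, if they are distinct). -/
noncomputable def jn (a b : P) : L := (exists_join L a b).choose

@[simp] lemma left_mem_jn (a b : P) : a ∈ jn L a b := (exists_join L a b).choose_spec.1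

@[simp] lemma right_mem_jn (a b : P) : b ∈ jn L a b := (exists_join L a b).choose_spec.2

variable {L}

lemma exists_meet (l m : L) : ∃ p : P, p ∈ l ∧ p ∈ m :=
  exists_join (P := Dual L) (Dual P) l m

/-- A common point of two lines (the common point, if they are distinct). -/
noncomputable def mt (l m : L) : P := (exists_meet l m).choose

@[simp] lemma mt_mem_left (l m : L) : mt l m ∈ l := (exists_meet l m).choose_spec.1

@[simp] lemma mt_mem_right (l m : L) : mt l m ∈ m := (exists_meet l m).choose_spec.2

lemma line_ext {a b : P} {l m : L} (hab : a ≠ b) (h1 : a ∈ l) (h2 : b ∈ l) (h3 : a ∈ m)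
    (h4 : b ∈ m) : l = m :=
  (Nondegenerate.eq_or_eq h1 h2 h3 h4).resolve_left hab

lemma pt_ext {a b : P} {l m : L} (hlm : l ≠ m) (h1 : a ∈ l) (h2 : a ∈ m) (h3 : b ∈ l)
    (h4 : b ∈ m) : a = b :=
  (Nondegenerate.eq_or_eq h1 h3 h2 h4).resolve_right hlm

lemma eq_jn {a b : P} {l : L} (hab : a ≠ b) (h1 : a ∈ l) (h2 : b ∈ l) : l = jn L a b :=
  line_ext hab h1 h2 (left_mem_jn L a b) (right_mem_jn L a b)

lemma eq_mt {a : P} {l m : L} (hlm : l ≠ m) (h1 : a ∈ l) (h2 : a ∈ m) : a = mt l m :=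
  pt_ext hlm h1 h2 (mt_mem_left l m) (mt_mem_right l m)

lemma jn_comm (a b : P) : jn L a b = jn L b a := by
  by_cases h : a = b
  · rw [h]
  · exact eq_jn (Ne.symm h) (right_mem_jn L a b) (left_mem_jn L a b)

lemma mem_jn_iff {a b x : P} {l : L} (hab : a ≠ b) (h1 : a ∈ l) (h2 : b ∈ l) :
    x ∈ jn L a b ↔ x ∈ l := by
  rw [eq_jn hab h1 h2]

variable (L)

/-- Three points lie on a common line. -/
def Coll (a b c : P) : Prop := ∃ l : L, a ∈ l ∧ b ∈ l ∧ c ∈ l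

variable {L}

lemma Coll.rot {a b c : P} (h : Coll L a b c) : Coll L b c a := by
  obtain ⟨l, h1, h2, h3⟩ := h; exact ⟨l, h2, h3, h1⟩

lemma Coll.swap {a b c : P} (h : Coll L a b c) : Coll L b a c := by
  obtain ⟨l, h1, h2, h3⟩ := h; exact ⟨l, h2, h1, h3⟩

lemma Coll.swap' {a b c : P} (h : Coll L a b c) : Coll L a c b := by
  obtain ⟨l, h1, h2, h3⟩ := h; exact ⟨l, h1, h3, h2⟩

lemma coll_iff_mem {a b c : P} {l : L} (hab : a ≠ b) (h1 : a ∈ l) (h2 : b ∈ l) :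
    Coll L a b c ↔ c ∈ l :=
  ⟨fun ⟨_, h3, h4, h5⟩ => line_ext hab h3 h4 h1 h2 ▸ h5, fun h => ⟨l, h1, h2, h⟩⟩

lemma coll_iff {a b c : P} (hab : a ≠ b) : Coll L a b c ↔ c ∈ jn L a b :=
  coll_iff_mem hab (left_mem_jn L a b) (right_mem_jn L a b)

lemma coll_left (a b : P) : Coll L a a b := ⟨jn L a b, by simp⟩

lemma coll_right (a b : P) : Coll L a b b := ⟨jn L a b, by simp⟩

lemma coll_outer (a b : P) : Coll L a b a := ⟨jn L a b, by simp⟩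

lemma Coll.exchange {a b c d : P} (hab : a ≠ b) (h1 : Coll L a b c) (h2 : Coll L a b d) :
    Coll L a c d := by
  obtain ⟨l, h3, h4, h5⟩ := h1
  exact ⟨l, h3, h5, (coll_iff_mem hab h3 h4).1 h2⟩

variable (L)

/-- The diagonal points of a quadrangle are collinear. -/
def FanoQuad (a b c d : P) : Prop :=
  ∃ x y z : P, Coll L x a b ∧ Coll L x c d ∧ Coll L y a c ∧ Coll L y b d ∧
    Coll L z a d ∧ Coll L z b c ∧ Coll L x y z

/-- Every quadrangle has collinear diagonal points. -/
def FanoPlane : Prop := ∀ a b c d : P, ¬ Coll L a b c → ¬ Coll L a b d → ¬ Coll L a c d →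
  ¬ Coll L b c d → FanoQuad L a b c d

end Incidence

section Card

variable {P L : Type*} [Membership P L] [ProjectivePlane P L] [Fintype P] [Fintype L]

lemma card_line (l : L) : (Finset.univ.filter (fun x : P => x ∈ l)).card = order P L + 1 := by
  rw [← pointCount_eq P l, pointCount, Nat.card_eq_fintype_card, Fintype.card_subtype]

lemma card_pencil (p : P) : (Finset.univ.filter (fun l : L => p ∈ l)).card = order P L + 1 := by
  rw [← lineCount_eq L p, lineCount, Nat.card_eq_fintype_card, Fintype.card_subtype]

lemma exists_mem_ne_ne (l : L) (a b : P) : ∃ c : P, c ∈ l ∧ c ≠ a ∧ c ≠ b := by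
  have h1 := card_line l
  have h2 := one_lt_order P L
  have h3 : ({a, b} : Finset P).card < (Finset.univ.filter (fun x : P => x ∈ l)).card := by
    have := Finset.card_le_two (a := a) (b := b)
    omega
  obtain ⟨c, hc, hc'⟩ := Finset.exists_mem_notMem_of_card_lt_card h3
  simp at hc hc'
  exact ⟨c, hc, hc'.1, hc'.2⟩

lemma exists_line_ne_ne (p : P) (l m : L) : ∃ n : L, p ∈ n ∧ n ≠ l ∧ n ≠ m := by
  have h1 := card_pencil (L := L) p
  have h2 := one_lt_order P L
  have h3 : ({l, m} : Finset L).card < (Finset.univ.filter (fun n : L => p ∈ n)).card := by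
    have := Finset.card_le_two (a := l) (b := m)
    omega
  obtain ⟨c, hc, hc'⟩ := Finset.exists_mem_notMem_of_card_lt_card h3
  simp at hc hc'
  exact ⟨c, hc, hc'.1, hc'.2⟩

end Card

/-! ## Perspectivities -/

section Perspectivity

variable {P L : Type*} [Membership P L] [ProjectivePlane P L]

/-- The lines through `C` other than `l`. -/
abbrev Pencil (C : P) (l : L) := {k : L // C ∈ k ∧ k ≠ l}

/-- The points of `l` other than `C`. -/
abbrev Dir (C : P) (l : L) := {W : P // W ∈ l ∧ W ≠ C}

/-- The points of `k` off `l`. -/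
abbrev Aff (l k : L) := {x : P // x ∈ k ∧ x ∉ l}

variable {C : P} {l : L}

lemma mt_jn_mem_and_notMem (hC : C ∈ l) (i : Pencil C l) (W : Dir C l) {x : P} (hx : x ∉ l) :
    mt (jn L x W.1) i.1 ∈ i.1 ∧ mt (jn L x W.1) i.1 ∉ l := by
  refine ⟨by simp, fun h => ?_⟩
  have h1 : jn L x W.1 ≠ l := fun h => hx (h ▸ left_mem_jn L x W.1)
  have h2 : mt (jn L x W.1) i.1 = W := pt_ext h1 (by simp) h (by simp) W.2.1
  have h3 : mt (jn L x W.1) i.1 = C := pt_ext i.2.2 (by simp) h i.2.1 hC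
  exact W.2.2 (h2.symm.trans h3)

lemma incid {a b : P} {l m : L} (h1 : a ∈ l) (h2 : b ∈ l) (h3 : a ∈ m) (h4 : b ∈ m) :
    a = b ∨ l = m := Nondegenerate.eq_or_eq h1 h2 h3 h4

lemma eq_of_coll_pencil (hC : C ∈ l) {i : Pencil C l} {W : Dir C l} {x y z : P}
    (hx : x ∉ l) (hy : y ∈ i.1) (hz : z ∈ i.1) (h1 : Coll L x W.1 y) (h2 : Coll L x W.1 z) :
    y = z := by
  have hxW : x ≠ W.1 := fun h => hx (h ▸ W.2.1)
  rw [coll_iff hxW] at h1 h2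
  refine pt_ext (fun h => ?_) h1 hy h2 hz
  have hW : W.1 ∈ i.1 := h ▸ right_mem_jn L x W.1
  exact W.2.2 (pt_ext i.2.2 hW W.2.1 i.2.1 hC)

lemma coll_persp (x W : P) (i : L) : Coll L x W (mt (jn L x W) i) :=
  ⟨jn L x W, by simp⟩

/-- The perspectivity between two lines through `C`, from the point `W` of `l`. -/
noncomputable def pr (hC : C ∈ l) (k i : Pencil C l) (W : Dir C l) : Aff l k.1 ≃ Aff l i.1 where
  toFun x := ⟨mt (jn L x.1 W.1) i.1, mt_jn_mem_and_notMem hC i W x.2.2⟩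
  invFun x := ⟨mt (jn L x.1 W.1) k.1, mt_jn_mem_and_notMem hC k W x.2.2⟩
  left_inv x := Subtype.ext (eq_of_coll_pencil hC (mt_jn_mem_and_notMem hC i W x.2.2).2
    (by simp) x.2.1 (coll_persp _ _ _) (coll_persp _ _ _).rot.rot.swap')
  right_inv x := Subtype.ext (eq_of_coll_pencil hC (mt_jn_mem_and_notMem hC k W x.2.2).2
    (by simp) x.2.1 (coll_persp _ _ _) (coll_persp _ _ _).rot.rot.swap')

lemma coll_pr (hC : C ∈ l) (k i : Pencil C l) (W : Dir C l) (x : Aff l k.1) :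
    Coll L x.1 W.1 (pr hC k i W x).1 := coll_persp _ _ _

lemma pr_eq (hC : C ∈ l) {k i : Pencil C l} {W : Dir C l} {x : Aff l k.1} {y : Aff l i.1}
    (h : Coll L x.1 W.1 y.1) : pr hC k i W x = y :=
  Subtype.ext (eq_of_coll_pencil hC x.2.2 (pr hC k i W x).2.1 y.2.1 (coll_pr hC k i W x) h)

lemma pr_self (hC : C ∈ l) (k : Pencil C l) (W : Dir C l) (x : Aff l k.1) :
    pr hC k k W x = x := pr_eq hC (coll_outer _ _)

lemma pr_pr (hC : C ∈ l) (k i j : Pencil C l) (W : Dir C l) (x : Aff l k.1) :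
    pr hC i j W (pr hC k i W x) = pr hC k j W x := by
  apply pr_eq
  have h1 := coll_pr hC k i W x
  have h2 := coll_pr hC k j W x
  have hxW : W.1 ≠ x.1 := fun h => x.2.2 (h ▸ W.2.1)
  exact (h1.swap.exchange hxW h2.swap).swap

lemma aff_notMem (hC : C ∈ l) {k i : Pencil C l} (hki : k ≠ i) (x : Aff l k.1) :
    x.1 ∉ i.1 := fun h => x.2.2 <| by
  rw [pt_ext (fun h => hki (Subtype.ext h)) x.2.1 h k.2.1 i.2.1]
  exact hC

lemma exists_pr_eq (hC : C ∈ l) {k i : Pencil C l} (hki : k ≠ i) (x : Aff l k.1)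
    (y : Aff l i.1) : ∃ W : Dir C l, pr hC k i W x = y := by
  refine ⟨⟨mt (jn L x.1 y.1) l, by simp, fun h => ?_⟩, pr_eq hC ⟨jn L x.1 y.1, by simp⟩⟩
  have hC' := mt_mem_left (jn L x.1 y.1) l
  rw [h] at hC'
  have h1 := left_mem_jn L x.1 y.1
  have h2 := right_mem_jn L x.1 y.1
  obtain ⟨k, hk, hkl⟩ := k
  obtain ⟨i, hi, hil⟩ := i
  obtain ⟨x, hx, hxl⟩ := x
  obtain ⟨y, hy, hyl⟩ := y
  have : k ≠ i := fun h => hki (Subtype.ext h)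
  dsimp only at *
  generalize jn L x y = n at *
  grind only [incid]

/-- In a Fano plane the composition of two perspectivities between two lines is an involution. -/
lemma pr_invol (hF : FanoPlane (P := P) L) (hC : C ∈ l) {k i : Pencil C l} (hki : k ≠ i)
    (U W : Dir C l) (x : Aff l k.1) :
    pr hC i k W (pr hC k i U (pr hC i k W (pr hC k i U x))) = x := by
  by_cases hUW : U = W
  · subst hUW; simp [pr_pr, pr_self]
  have hUW' : U.1 ≠ W.1 := fun h => hUW (Subtype.ext h)
  set y := pr hC k i U x with hy
  set x' := pr hC i k W y with hx'
  set y' := pr hC k i U x' with hy'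
  obtain ⟨n1, c1⟩ : Coll L x.1 U.1 y.1 := coll_pr hC k i U x
  obtain ⟨n2, c2⟩ : Coll L y.1 W.1 x'.1 := coll_pr hC i k W y
  obtain ⟨n3, c3⟩ : Coll L x'.1 U.1 y'.1 := coll_pr hC k i U x'
  apply pr_eq
  have h3 := aff_notMem hC hki x
  have h3' := aff_notMem hC hki x'
  have h4 := aff_notMem hC hki.symm y
  have h4' := aff_notMem hC hki.symm y'
  have hxx' : x.1 ≠ x'.1 := by
    have := W.2
    have := U.2
    have := x.2
    have := y.2
    grind only [incid]
  have hyy' : y.1 ≠ y'.1 := fun h =>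
    hxx' (congrArg Subtype.val ((pr hC k i U).injective (Subtype.ext h)))
  have hkl : k.1 ≠ i.1 := fun h => hki (Subtype.ext h)
  have q1 := fun z : P => (coll_iff_mem hxx' x.2.1 x'.2.1 (c := z)).not
  have q2 := fun z : P => (coll_iff_mem hyy' y.2.1 y'.2.1 (c := z)).not
  obtain ⟨X, Y, Z, a1, a2, ⟨n4, b1⟩, ⟨n5, b2⟩, ⟨n6, d1⟩, ⟨n7, d2⟩, ⟨n8, e⟩⟩ :=
    hF x.1 x'.1 y.1 y'.1 ((q1 _).2 h4) ((q1 _).2 h4')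
    (fun h => (q2 _).2 h3 h.rot) (fun h => (q2 _).2 h3' h.rot)
  have hX : X = C := pt_ext hkl ((coll_iff_mem hxx' x.2.1 x'.2.1).1 a1.rot)
    ((coll_iff_mem hyy' y.2.1 y'.2.1).1 a2.rot) k.2.1 i.2.1
  subst hX
  have hU := U.2
  have hW := W.2
  have hx := x.2
  have hy := y.2
  have hx' := x'.2
  have hy' := y'.2
  have hxy : x.1 ≠ y.1 := fun h => h3 (h ▸ y.2.1)
  have hxy' : x'.1 ≠ y'.1 := fun h => h3' (h ▸ y'.2.1)
  have hx'y : x'.1 ≠ y.1 := fun h => h3' (h ▸ y.2.1)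
  obtain rfl := line_ext hxy b1.2.1 b1.2.2 c1.1 c1.2.2
  obtain rfl := line_ext hxy' b2.2.1 b2.2.2 c3.1 c3.2.2
  obtain rfl := line_ext hx'y d2.2.1 d2.2.2 c2.2.2 c2.1
  have hn : n4 ≠ n5 := by
    rintro rfl
    exact h4 (line_ext hxx' b1.2.1 b2.2.1 x.2.1 x'.2.1 ▸ b1.2.2)
  obtain rfl := pt_ext hn b1.1 b2.1 c1.2.1 c3.2.1
  obtain rfl := line_ext hU.2 e.2.1 e.1 hU.1 hC
  have hn2 : n7 ≠ n8 := fun h => hx'.2 (h ▸ d2.2.1)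
  have hZW : Z = W.1 := pt_ext hn2 d2.1 e.2.2 c2.2.1 hW.1
  exact ⟨n6, d1.2.2, hZW ▸ d1.1, d1.2.1⟩

end Perspectivity

/-! ## Auxiliary facts on finite groups -/

section Groups

/-- A transitive family of permutations containing `1` whose quotients are involutions
is closed under multiplication. -/
lemma exists_mul_eq_of_sq_eq_one {Ω D : Type*} (y : D → Equiv.Perm Ω) {V : D} (hV : y V = 1)
    (hy : ∀ W U, (y W * (y U)⁻¹) ^ 2 = 1) (ht : ∀ a b, ∃ W, y W a = b) (W U : D) :
    ∃ T, y W * y U = y T := by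
  have h2 : ∀ W, y W * y W = 1 := fun W => by simpa [hV, sq] using hy W V
  have hinv : ∀ W, (y W)⁻¹ = y W := fun W => inv_eq_of_mul_eq_one_right (h2 W)
  have hc : ∀ W U, y W * y U = y U * y W := fun W U => by
    have h := hy W U
    rw [hinv, sq] at h
    rw [eq_inv_of_mul_eq_one_right h, mul_inv_rev, hinv, hinv]
  rcases isEmpty_or_nonempty Ω with h | ⟨⟨o⟩⟩
  · exact ⟨W, Subsingleton.elim _ _⟩
  · obtain ⟨T, hT⟩ := ht o ((y W * y U) o)
    refine ⟨T, Equiv.ext fun a => ?_⟩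
    obtain ⟨S, rfl⟩ := ht o a
    rw [← Equiv.Perm.mul_apply, ← Equiv.Perm.mul_apply (y T), hc T S, Equiv.Perm.mul_apply (y S), hT,
      ← Equiv.Perm.mul_apply, hc W U, mul_assoc, hc W S, ← mul_assoc, hc U S, mul_assoc, hc U W]

variable {G : Type*} [Group G]

lemma isPGroup_sup_of_permute [Finite G] {p : ℕ} [Fact p.Prime] {H K : Subgroup G}
    (hH : IsPGroup p H) (hK : IsPGroup p K)
    (h : ∀ a ∈ K, ∀ b ∈ H, ∃ b' ∈ H, ∃ a' ∈ K, a * b = b' * a') :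
    IsPGroup p (H ⊔ K : Subgroup G) ∧ ∀ x ∈ H ⊔ K, ∃ b ∈ H, ∃ a ∈ K, x = b * a := by
  let J : Subgroup G :=
    { carrier := {x | ∃ b ∈ H, ∃ a ∈ K, x = b * a}
      one_mem' := ⟨1, H.one_mem, 1, K.one_mem, by simp⟩
      mul_mem' := by
        rintro _ _ ⟨b, hb, a, ha, rfl⟩ ⟨d, hd, c, hc, rfl⟩
        obtain ⟨b', hb', a', ha', e⟩ := h a ha d hd
        refine ⟨b * b', H.mul_mem hb hb', a' * c, K.mul_mem ha' hc, ?_⟩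
        rw [mul_assoc, ← mul_assoc a, e]; group
      inv_mem' := by
        rintro _ ⟨b, hb, a, ha, rfl⟩
        obtain ⟨b', hb', a', ha', e⟩ := h a⁻¹ (K.inv_mem ha) b⁻¹ (H.inv_mem hb)
        exact ⟨b', hb', a', ha', by rw [mul_inv_rev, e]⟩ }
  have hJ : H ⊔ K = J := by
    apply le_antisymm
    · refine sup_le (fun b hb => ⟨b, hb, 1, K.one_mem, by simp⟩)
        (fun a ha => ⟨1, H.one_mem, a, ha, by simp⟩)
    · rintro _ ⟨b, hb, a, ha, rfl⟩
      exact Subgroup.mul_mem_sup hb ha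
  refine ⟨?_, fun x hx => by rw [hJ] at hx; exact hx⟩
  open Pointwise in
  have hset : ((H : Set G) * (K : Set G)) = J := by
    ext x
    simp only [Set.mem_mul, SetLike.mem_coe]
    exact ⟨fun ⟨b, hb, a, ha, e⟩ => ⟨b, hb, a, ha, e.symm⟩,
      fun ⟨b, hb, a, ha, e⟩ => ⟨b, hb, a, ha, e.symm⟩⟩
  obtain ⟨m, hm⟩ := IsPGroup.iff_card.1 hH
  obtain ⟨n, hn⟩ := IsPGroup.iff_card.1 hK
  have hdvd : Nat.card J ∣ Nat.card H * Nat.card K := by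
    have h1 := Subgroup.card_mul_eq_card_subgroup_mul_card_quotient K (H : Set G)
    have h2 : ((↑) '' (H : Set G) : Set (G ⧸ K)) = MulAction.orbit H ((1 : G) : G ⧸ K) := by
      ext x
      constructor
      · rintro ⟨b, hb, rfl⟩
        exact ⟨⟨b, hb⟩, congrArg (QuotientGroup.mk (s := K)) (mul_one b)⟩
      · rintro ⟨b, rfl⟩
        exact ⟨b, b.2, (congrArg (QuotientGroup.mk (s := K)) (mul_one b.1)).symm⟩
    have h3 : Nat.card (MulAction.orbit H ((1 : G) : G ⧸ K)) ∣ Nat.card H := by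
      rw [Nat.card_congr (MulAction.orbitEquivQuotientStabilizer H ((1 : G) : G ⧸ K))]
      exact Subgroup.card_quotient_dvd_card _
    rw [hset, h2] at h1
    have h4 : Nat.card J = Nat.card (J : Set G) := rfl
    rw [h4, h1, mul_comm]
    exact Nat.mul_dvd_mul_right h3 _
  rw [hJ, IsPGroup.iff_card]
  rw [hm, hn, ← pow_add] at hdvd
  obtain ⟨k, -, hk⟩ := (Nat.dvd_prime_pow Fact.out).1 hdvd
  exact ⟨k, hk⟩

/-- The subgroup generated by pairwise permuting `p`-subgroups is a `p`-group. -/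
lemma isPGroup_iSup_of_permute [Finite G] {p : ℕ} [Fact p.Prime] {ι : Type*} (R : ι → Subgroup G)
    (hR : ∀ i, IsPGroup p (R i))
    (h : ∀ i k, ∀ a ∈ R i, ∀ b ∈ R k, ∃ b' ∈ R k, ∃ a' ∈ R i, a * b = b' * a') (s : Finset ι) :
    IsPGroup p (⨆ i ∈ s, R i : Subgroup G) ∧
      ∀ k, ∀ a ∈ ⨆ i ∈ s, R i, ∀ b ∈ R k, ∃ b' ∈ R k, ∃ a' ∈ ⨆ i ∈ s, R i, a * b = b' * a' := by
  induction s using Finset.induction_on with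
  | empty =>
    have e : (⨆ i ∈ (∅ : Finset ι), R i) = ⊥ := by simp
    rw [e]
    refine ⟨IsPGroup.of_bot, fun k a ha b hb => ⟨b, hb, 1, one_mem _, ?_⟩⟩
    rw [Subgroup.mem_bot.1 ha, one_mul, mul_one]
  | insert i s hi ih =>
    rw [Finset.iSup_insert]
    obtain ⟨h1, h2⟩ := isPGroup_sup_of_permute (hR i) ih.1 (ih.2 i)
    refine ⟨h1, fun k a ha b hb => ?_⟩
    obtain ⟨c, hc, d, hd, rfl⟩ := h2 a ha
    obtain ⟨b', hb', d', hd', e⟩ := ih.2 k d hd b hb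
    obtain ⟨b'', hb'', c', hc', e'⟩ := h i k c hc b' hb'
    refine ⟨b'', hb'', c' * d', Subgroup.mul_mem_sup hc' hd', ?_⟩
    rw [mul_assoc, e, ← mul_assoc, e', mul_assoc]

/-- Pairwise permuting `2`-subgroups, not all trivial, are centralized by an involution of their
join. -/
lemma exists_central_involution [Finite G] {ι : Type*} [Finite ι] (R : ι → Subgroup G)
    (hR : ∀ i, ∀ x ∈ R i, x ^ 2 = 1)
    (h : ∀ i k, ∀ a ∈ R i, ∀ b ∈ R k, ∃ b' ∈ R k, ∃ a' ∈ R i, a * b = b' * a')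
    (hne : ∃ i, ∃ x ∈ R i, x ≠ 1) :
    ∃ z : G, z ≠ 1 ∧ z ^ 2 = 1 ∧ ∀ i, ∀ x ∈ R i, z * x = x * z := by
  have := Fintype.ofFinite ι
  have hp : ∀ i, IsPGroup 2 (R i) := fun i x => ⟨1, Subtype.ext (by simpa using hR i x x.2)⟩
  obtain ⟨h1, -⟩ := isPGroup_iSup_of_permute R hp h Finset.univ
  set H := (⨆ i ∈ Finset.univ, R i) with hH
  have hle : ∀ i, R i ≤ H := fun i => le_iSup₂_of_le i (Finset.mem_univ i) le_rfl
  obtain ⟨i, x, hx, hx1⟩ := hne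
  have : Nontrivial H := ⟨⟨⟨x, hle i hx⟩, 1, fun h => hx1 (congrArg Subtype.val h)⟩⟩
  have := h1.center_nontrivial
  obtain ⟨n, hn, hn'⟩ := (h1.to_subgroup (Subgroup.center H)).nontrivial_iff_card.1 this
  have hd : 2 ∣ Nat.card (Subgroup.center H) := hn' ▸ dvd_pow_self 2 hn.ne'
  obtain ⟨z, hz⟩ := exists_prime_orderOf_dvd_card' 2 hd
  refine ⟨z.1.1, fun h => ?_, ?_, fun i x hx => ?_⟩
  · have : z = 1 := Subtype.ext (Subtype.ext h)
    simp [this] at hz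
  · have := pow_orderOf_eq_one z
    rw [hz] at this
    simpa using congrArg (fun w => w.1.1) this
  · have := Subgroup.mem_center_iff.1 z.2 ⟨x, hle i hx⟩
    exact (congrArg Subtype.val this).symm

end Groups

/-! ## Elations and the Fano axiom -/

section Elation

variable {P L : Type*} [Membership P L] [ProjectivePlane P L]

variable (P L) in
/-- The group of collineations, as permutations of the points. -/
def Col : Subgroup (Equiv.Perm P) where
  carrier := {σ | ∀ a b c, Coll L (σ a) (σ b) (σ c) ↔ Coll L a b c}
  one_mem' _ _ _ := Iff.rfl
  mul_mem' {σ τ} hσ hτ a b c := (hσ _ _ _).trans (hτ _ _ _)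
  inv_mem' {σ} hσ a b c := by
    have := hσ (σ⁻¹ a) (σ⁻¹ b) (σ⁻¹ c)
    simpa using this.symm

lemma mem_col_of_invol {σ : Equiv.Perm P} (h : ∀ a b c, Coll L a b c → Coll L (σ a) (σ b) (σ c))
    (h2 : ∀ x, σ (σ x) = x) : σ ∈ Col P L := fun a b c =>
  ⟨fun H => by simpa [h2] using h _ _ _ H, h a b c⟩

variable {C : P} {l : L} (hC : C ∈ l) (m : Pencil C l) (V : Dir C l)

/-- The composition of the perspectivities `m → i` from `V` and `i → m` from `W`. -/
noncomputable def xx (i : Pencil C l) (W : Dir C l) : Equiv.Perm (Aff l m.1) :=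
  (pr hC m i V).trans (pr hC i m W)

lemma xx_apply (i : Pencil C l) (W : Dir C l) (x : Aff l m.1) :
    xx hC m V i W x = pr hC i m W (pr hC m i V x) := rfl

lemma xx_self (W : Dir C l) : xx hC m V m W = 1 := Equiv.ext fun x => by
  simp [xx_apply, pr_self]

lemma xx_base (i : Pencil C l) : xx hC m V i V = 1 := Equiv.ext fun x => by
  simp [xx_apply, pr_pr, pr_self]

lemma exists_xx_apply {i : Pencil C l} (hi : i ≠ m) (x y : Aff l m.1) :
    ∃ W, xx hC m V i W x = y := exists_pr_eq hC hi _ _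

lemma xx_inv_mul_apply (i k : Pencil C l) (W : Dir C l) (x : Aff l m.1) :
    ((xx hC m V k W)⁻¹ * xx hC m V i W) x = pr hC k m V (pr hC i k W (pr hC m i V x)) := by
  rw [Equiv.Perm.mul_apply, Equiv.Perm.inv_eq_iff_eq, xx_apply, xx_apply, pr_pr hC k m k,
    pr_self, pr_pr]

lemma xx_quot_sq (hF : FanoPlane (P := P) L) {i k : Pencil C l} (hik : i ≠ k) (W U : Dir C l) :
    (((xx hC m V k W)⁻¹ * xx hC m V i W) * ((xx hC m V k U)⁻¹ * xx hC m V i U)⁻¹) ^ 2 = 1 := by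
  have key : ∀ x, (((xx hC m V k W)⁻¹ * xx hC m V i W) * ((xx hC m V k U)⁻¹ * xx hC m V i U)⁻¹) x
      = pr hC k m V (pr hC i k W (pr hC k i U (pr hC m k V x))) := fun x => by
    rw [Equiv.Perm.mul_apply]
    have : ((xx hC m V k U)⁻¹ * xx hC m V i U)⁻¹ x
        = pr hC i m V (pr hC k i U (pr hC m k V x)) := by
      rw [Equiv.Perm.inv_eq_iff_eq, xx_inv_mul_apply, pr_pr hC i m i, pr_self, pr_pr hC k i k,
        pr_self, pr_pr, pr_self]
    rw [this, xx_inv_mul_apply, pr_pr hC i m i, pr_self]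
  ext x
  rw [sq, Equiv.Perm.mul_apply, key, key, pr_pr hC k m k, pr_self, pr_invol hF hC hik.symm, pr_pr,
    pr_self]
  rfl

lemma xx_quot_mul (hF : FanoPlane (P := P) L) {i k : Pencil C l} (hik : i ≠ k) (W U : Dir C l) :
    ∃ T, ((xx hC m V k W)⁻¹ * xx hC m V i W) * ((xx hC m V k U)⁻¹ * xx hC m V i U) =
      (xx hC m V k T)⁻¹ * xx hC m V i T :=
  exists_mul_eq_of_sq_eq_one (fun W => (xx hC m V k W)⁻¹ * xx hC m V i W) (V := V)
    (by simp [xx_base]) (xx_quot_sq hC m V hF hik)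
    (fun a b => by
      obtain ⟨W, hW⟩ := exists_pr_eq hC hik (pr hC m i V a) (pr hC m k V b)
      exact ⟨W, by rw [xx_inv_mul_apply, hW, pr_pr, pr_self]⟩) W U

lemma xx_sq (hF : FanoPlane (P := P) L) (i : Pencil C l) (W : Dir C l) :
    xx hC m V i W * xx hC m V i W = 1 := by
  by_cases hi : i = m
  · subst hi; simp [xx_self]
  · have := xx_quot_sq hC m V hF hi W V
    simpa [xx_self, xx_base, sq] using this

lemma xx_inv (hF : FanoPlane (P := P) L) (i : Pencil C l) (W : Dir C l) :
    (xx hC m V i W)⁻¹ = xx hC m V i W :=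
  inv_eq_of_mul_eq_one_right (xx_sq hC m V hF i W)

lemma xx_mul (hF : FanoPlane (P := P) L) (i : Pencil C l) (W U : Dir C l) :
    ∃ T, xx hC m V i W * xx hC m V i U = xx hC m V i T := by
  by_cases hi : i = m
  · subst hi; exact ⟨V, by simp only [xx_self, mul_one]⟩
  · have := xx_quot_mul hC m V hF hi W U
    simpa [xx_self] using this

/-- The group formed by the permutations `xx hC m V i W` for a fixed line `i`. -/
noncomputable def xxGroup (hF : FanoPlane (P := P) L) (i : Pencil C l) :
    Subgroup (Equiv.Perm (Aff l m.1)) where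
  carrier := Set.range (xx hC m V i)
  one_mem' := ⟨V, xx_base hC m V i⟩
  mul_mem' := by
    rintro _ _ ⟨W, rfl⟩ ⟨U, rfl⟩
    obtain ⟨T, hT⟩ := xx_mul hC m V hF i W U
    exact ⟨T, hT.symm⟩
  inv_mem' := by
    rintro _ ⟨W, rfl⟩
    exact ⟨W, (xx_inv hC m V hF i W).symm⟩

lemma xxGroup_permute (hF : FanoPlane (P := P) L) (i k : Pencil C l) :
    ∀ a ∈ xxGroup hC m V hF i, ∀ b ∈ xxGroup hC m V hF k,
      ∃ b' ∈ xxGroup hC m V hF k, ∃ a' ∈ xxGroup hC m V hF i, a * b = b' * a' := by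
  by_cases hik : i = k
  · subst hik
    exact fun a ha b hb => ⟨a, ha, b, hb, rfl⟩
  rintro _ ⟨W, rfl⟩ _ ⟨U, rfl⟩
  obtain ⟨T, hT⟩ := xx_quot_mul hC m V hF hik W U
  refine ⟨xx hC m V k W * (xx hC m V k T)⁻¹, mul_mem ⟨W, rfl⟩ (inv_mem ⟨T, rfl⟩),
    xx hC m V i T * (xx hC m V i U)⁻¹, mul_mem ⟨T, rfl⟩ (inv_mem ⟨U, rfl⟩), ?_⟩
  rw [xx_inv hC m V hF k U] at hT
  rw [mul_assoc, ← mul_assoc _⁻¹ (xx hC m V i T), ← hT]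
  group

variable {m V}

/-- The central transformation induced by a permutation of the affine points of `m`. -/
noncomputable def elatFun (m : Pencil C l) (V : Dir C l) (z : Equiv.Perm (Aff l m.1)) (X : P) : P :=
  if h : X ∈ l then X else
    (pr hC m ⟨jn L C X, left_mem_jn L C X, fun e => h (e ▸ right_mem_jn L C X)⟩ V
      (z (pr hC ⟨jn L C X, left_mem_jn L C X, fun e => h (e ▸ right_mem_jn L C X)⟩ m V
        ⟨X, right_mem_jn L C X, h⟩))).1

lemma elatFun_of_mem (z : Equiv.Perm (Aff l m.1)) {X : P} (h : X ∈ l) :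
    elatFun hC m V z X = X := by
  simp [elatFun, h]

lemma elatFun_of_notMem (z : Equiv.Perm (Aff l m.1)) (k : Pencil C l) (X : Aff l k.1) :
    elatFun hC m V z X.1 = (pr hC m k V (z (pr hC k m V X))).1 := by
  obtain ⟨X, hX, hXl⟩ := X
  obtain ⟨k, hk, hkl⟩ := k
  obtain rfl : k = jn L C X := eq_jn (fun e => hXl (e ▸ hC)) hk hX
  simp [elatFun, hXl]

lemma exists_pencil (C : P) {l : L} {X : P} (hX : X ∉ l) :
    ∃ k : Pencil C l, ∃ Y : Aff l k.1, Y.1 = X :=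
  ⟨⟨jn L C X, left_mem_jn L C X, fun e => hX (e ▸ right_mem_jn L C X)⟩,
    ⟨X, right_mem_jn L C X, hX⟩, rfl⟩

/-- Every incident point-line pair of a finite Fano plane is the center and axis of an
elation of order two. -/
theorem exists_elation [Fintype P] [Fintype L] (hF : FanoPlane (P := P) L) (hC : C ∈ l) :
    ∃ σ ∈ Col P L, σ ≠ 1 ∧ σ * σ = 1 ∧ (∀ X ∈ l, σ X = X) ∧ ∀ X, Coll L C X (σ X) := by
  obtain ⟨m, hm, hml, -⟩ := exists_line_ne_ne C l l
  obtain ⟨i, hi, hil, him⟩ := exists_line_ne_ne C l m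
  obtain ⟨V, hV, hVC, -⟩ := exists_mem_ne_ne l C C
  obtain ⟨x, hx, hxC, -⟩ := exists_mem_ne_ne m C C
  obtain ⟨y, hy, hyC, hyx⟩ := exists_mem_ne_ne m C x
  have aff : ∀ w ∈ m, w ≠ C → w ∉ l := fun w h1 h2 h3 => h2 (pt_ext hml h1 h3 hm hC)
  let m' : Pencil C l := ⟨m, hm, hml⟩
  let V' : Dir C l := ⟨V, hV, hVC⟩
  obtain ⟨z, hz1, hz2, hz⟩ := exists_central_involution (xxGroup hC m' V' hF)
    (by
      rintro i _ ⟨W, rfl⟩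
      rw [sq, xx_sq hC m' V' hF])
    (xxGroup_permute hC m' V' hF)
    (by
      obtain ⟨W, hW⟩ := exists_xx_apply hC m' V' (i := ⟨i, hi, hil⟩)
        (fun h => him (congrArg Subtype.val h)) ⟨x, hx, aff x hx hxC⟩ ⟨y, hy, aff y hy hyC⟩
      refine ⟨⟨i, hi, hil⟩, _, ⟨W, rfl⟩, fun h => hyx ?_⟩
      rw [h] at hW
      exact (congrArg Subtype.val hW).symm)
  have hzx : ∀ i W a, z (xx hC m' V' i W a) = xx hC m' V' i W (z a) := fun i W a =>
    congrArg (fun f : Equiv.Perm _ => f a) (hz i _ ⟨W, rfl⟩)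
  have hzz : ∀ a, z (z a) = a := fun a => by
    rw [← Equiv.Perm.mul_apply, ← sq, hz2]; rfl
  have hinv : Function.Involutive (elatFun hC m' V' z) := by
    intro X
    by_cases hX : X ∈ l
    · rw [elatFun_of_mem hC z hX, elatFun_of_mem hC z hX]
    · obtain ⟨k, Y, rfl⟩ := exists_pencil C hX
      rw [elatFun_of_notMem, elatFun_of_notMem, pr_pr hC m' k m', pr_self, hzz, pr_pr, pr_self]
  have hpr : ∀ (k : Pencil C l) (X : Aff l k.1) (W : Dir C l),
      pr hC k m' W (pr hC m' k V' (z (pr hC k m' V' X))) = z (pr hC k m' W X) := by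
    intro k X W
    rw [← xx_apply, ← hzx, xx_apply, pr_pr hC k m' k, pr_self]
  have hcoll : ∀ t : L, ∃ t' : L, ∀ X ∈ t, elatFun hC m' V' z X ∈ t' := by
    intro t
    by_cases htl : t = l
    · subst htl
      exact ⟨t, fun X hX => by rwa [elatFun_of_mem hC z hX]⟩
    by_cases hCt : C ∈ t
    · refine ⟨t, fun X hX => ?_⟩
      by_cases hXl : X ∈ l
      · rwa [elatFun_of_mem hC z hXl]
      · rw [elatFun_of_notMem hC z ⟨t, hCt, htl⟩ ⟨X, hX, hXl⟩]
        exact (pr hC m' ⟨t, hCt, htl⟩ V' _).2.1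
    · have hW : mt t l ≠ C := fun h => hCt (h ▸ mt_mem_left t l)
      have hWl := mt_mem_right t l
      have hWt := mt_mem_left t l
      set W : Dir C l := ⟨mt t l, hWl, hW⟩
      have htm : t ≠ m := fun h => hCt (h ▸ hm)
      have hb : mt t m ∉ l := fun h => hCt <| by
        rw [← pt_ext hml (mt_mem_right t m) h hm hC]; simp
      set b : Aff l m'.1 := ⟨mt t m, mt_mem_right t m, hb⟩
      refine ⟨jn L W.1 (z b).1, fun X hX => ?_⟩
      by_cases hXl : X ∈ l
      · rw [elatFun_of_mem hC z hXl, pt_ext htl hX hXl hWt hWl]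
        exact left_mem_jn L _ _
      · obtain ⟨k, Y, rfl⟩ := exists_pencil C hXl
        rw [elatFun_of_notMem hC z]
        have h1 : pr hC k m' W Y = b := pr_eq hC ⟨t, hX, hWt, mt_mem_left t m⟩
        have h2 := coll_pr hC k m' W (pr hC m' k V' (z (pr hC k m' V' Y)))
        rw [hpr, h1] at h2
        have hWz : W.1 ≠ (z b).1 := fun e => (z b).2.2 (e ▸ W.2.1)
        exact (coll_iff hWz).1 h2.rot
  refine ⟨hinv.toPerm, mem_col_of_invol ?_ hinv, fun h => hz1 ?_, Equiv.ext hinv,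
    fun X hX => elatFun_of_mem hC z hX, fun X => ?_⟩
  · rintro a b c ⟨t, ha, hb, hc⟩
    obtain ⟨t', ht'⟩ := hcoll t
    exact ⟨t', ht' a ha, ht' b hb, ht' c hc⟩
  · ext a
    have h1 : elatFun hC m' V' z a.1 = a.1 := congrArg (fun f : Equiv.Perm P => f a.1) h
    rw [elatFun_of_notMem hC z m' a, pr_self, pr_self] at h1
    exact h1
  · change Coll L C X (elatFun hC m' V' z X)
    by_cases hXl : X ∈ l
    · rw [elatFun_of_mem hC z hXl]; exact coll_right _ _
    · obtain ⟨k, Y, rfl⟩ := exists_pencil C hXl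
      rw [elatFun_of_notMem hC z]
      exact ⟨k.1, k.2.1, Y.2.1, (pr hC m' k V' _).2.1⟩

end Elation

/-! ## Translations -/

section Translation

variable {P L : Type*} [Membership P L] [ProjectivePlane P L]

lemma col_mem {σ : Equiv.Perm P} (hσ : σ ∈ Col P L) {a b x : P} {t t' : L} (hab : a ≠ b)
    (ha : a ∈ t) (hb : b ∈ t) (ha' : σ a ∈ t') (hb' : σ b ∈ t') (hx : x ∈ t) : σ x ∈ t' :=
  (coll_iff_mem (σ.injective.ne hab) ha' hb').1 ((hσ a b x).2 ⟨t, ha, hb, hx⟩)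

/-- `σ` is an elation with center `C` and axis `l`. -/
structure IsElat (C : P) (l : L) (σ : Equiv.Perm P) : Prop where
  mem : C ∈ l
  col : σ ∈ Col P L
  fix : ∀ X ∈ l, σ X = X
  coll : ∀ X, Coll L C X (σ X)

lemma off_axis {l : L} {σ : Equiv.Perm P} (h : ∀ X ∈ l, σ X = X) {X : P} (hX : X ∉ l) :
    σ X ∉ l := fun h' => hX (by
  have := σ.injective (h _ h')
  rwa [this] at h')

variable {C D : P} {l : L} {σ τ ρ : Equiv.Perm P}

lemma isElat_one (hC : C ∈ l) : IsElat C l 1 :=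
  ⟨hC, one_mem _, fun _ _ => rfl, fun _ => coll_right _ _⟩

lemma IsElat.mem_line (h : IsElat C l σ) {k : L} (hk : C ∈ k) {X : P} (hX : X ∈ k) :
    σ X ∈ k := by
  by_cases hXC : C = X
  · subst hXC; rwa [h.fix _ h.mem]
  · exact (coll_iff_mem hXC hk hX).1 (h.coll X)

lemma isElat_of_mem_line (hC : C ∈ l) (hσ : σ ∈ Col P L) (hf : ∀ X ∈ l, σ X = X)
    (h : ∀ k : L, C ∈ k → ∀ X ∈ k, σ X ∈ k) : IsElat C l σ :=
  ⟨hC, hσ, hf, fun X => ⟨jn L C X, by simp, by simp, h _ (by simp) _ (by simp)⟩⟩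

lemma IsElat.mul (h : IsElat C l σ) (h' : IsElat C l τ) : IsElat C l (σ * τ) :=
  isElat_of_mem_line h.mem (mul_mem h.col h'.col)
    (fun X hX => by rw [Equiv.Perm.mul_apply, h'.fix X hX, h.fix X hX])
    (fun _ hk _ hX => h.mem_line hk (h'.mem_line hk hX))

lemma IsElat.inv (h : IsElat C l σ) : IsElat C l σ⁻¹ := by
  have hf : ∀ X ∈ l, σ⁻¹ X = X := fun X hX => by
    rw [Equiv.Perm.inv_eq_iff_eq, h.fix X hX]
  refine ⟨h.mem, inv_mem h.col, hf, fun X => ?_⟩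
  have := h.coll (σ⁻¹ X)
  rw [show σ (σ⁻¹ X) = X from σ.apply_symm_apply X] at this
  exact this.swap'

/-- The elations with center `C` and axis `l`. -/
def El (hC : C ∈ l) : Subgroup (Equiv.Perm P) where
  carrier := {σ | IsElat C l σ}
  one_mem' := isElat_one hC
  mul_mem' h h' := h.mul h'
  inv_mem' h := h.inv

lemma IsElat.eq_self_of_notMem (h : IsElat C l σ) {X Y : P} (hX : X ∉ l) (hX' : σ X = X)
    (hY : Y ∉ l) (hXY : Y ∉ jn L C X) : σ Y = Y := by
  have hXY' : X ≠ Y := fun e => hXY (e ▸ right_mem_jn L C X)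
  have hCX : C ≠ X := fun e => hX (e ▸ h.mem)
  have hCY : C ≠ Y := fun e => hY (e ▸ h.mem)
  have hW := mt_mem_right (jn L X Y) l
  have hXW : X ≠ mt (jn L X Y) l := fun e => hX (e ▸ hW)
  have h1 : σ Y ∈ jn L X Y := col_mem h.col hXW (by simp) (by simp)
    (by rw [hX']; simp) (by rw [h.fix _ hW]; simp) (right_mem_jn L X Y)
  refine pt_ext (fun e => hXY ?_) h1 (h.mem_line (left_mem_jn L C Y) (right_mem_jn L C Y))
    (right_mem_jn L X Y) (right_mem_jn L C Y)
  have hC : C ∈ jn L X Y := e ▸ left_mem_jn L C Y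
  exact (mem_jn_iff hCX hC (left_mem_jn L X Y)).2 (right_mem_jn L X Y)

variable [Fintype P] [Fintype L]

lemma IsElat.eq_one (h : IsElat C l σ) {X : P} (hX : X ∉ l) (hX' : σ X = X) : σ = 1 := by
  obtain ⟨n, hCn, hnl, hn⟩ := exists_line_ne_ne C l (jn L C X)
  obtain ⟨Z, hZn, hZC, -⟩ := exists_mem_ne_ne n C C
  have hZl : Z ∉ l := fun e => hZC (pt_ext hnl hZn e hCn h.mem)
  have hZX : Z ∉ jn L C X := fun e => hZC (pt_ext hn hZn e hCn (left_mem_jn L C X))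
  have hZ := h.eq_self_of_notMem hX hX' hZl hZX
  ext Y
  by_cases hY : Y ∈ l
  · rw [h.fix Y hY]; rfl
  by_cases hYX : Y ∈ jn L C X
  · refine h.eq_self_of_notMem hZl hZ hY fun e => hZX ?_
    have hCY : C ≠ Y := fun e => hY (e ▸ h.mem)
    rw [line_ext hCY (left_mem_jn L C X) hYX (left_mem_jn L C Z) e]
    exact right_mem_jn L C Z
  · exact h.eq_self_of_notMem hX hX' hY hYX

lemma IsElat.eq_one_of_ne (h : IsElat C l σ) (h' : IsElat D l σ) (hCD : C ≠ D) : σ = 1 := by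
  obtain ⟨n, hCn, hnl, -⟩ := exists_line_ne_ne C l l
  obtain ⟨Z, hZn, hZC, -⟩ := exists_mem_ne_ne n C C
  have hZl : Z ∉ l := fun e => hZC (pt_ext hnl hZn e hCn h.mem)
  refine h.eq_one hZl (pt_ext (fun e => hCD ?_) (h.mem_line hCn hZn)
    (h'.mem_line (left_mem_jn L D Z) (right_mem_jn L D Z)) hZn (right_mem_jn L D Z))
  exact pt_ext hnl hCn h.mem (e ▸ left_mem_jn L D Z) h'.mem

/-- A collineation fixing the points of `l`, and no other points, is an elation. -/
lemma exists_center (hσ : σ ∈ Col P L) (hf : ∀ X ∈ l, σ X = X) (h : ∀ X ∉ l, σ X ≠ X) :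
    ∃ C, IsElat C l σ := by
  have key : ∀ X ∉ l, ∀ Y ∈ jn L X (σ X), σ Y ∈ jn L X (σ X) := fun X hX Y hY => by
    have hW := mt_mem_right (jn L X (σ X)) l
    have hXW : X ≠ mt (jn L X (σ X)) l := fun e => hX (e ▸ hW)
    exact col_mem hσ hXW (by simp) (by simp) (by simp) (by rw [hf _ hW]; simp) hY
  obtain ⟨a, -, -, -⟩ := exists_mem_ne_ne l (mt l l) (mt l l)
  obtain ⟨n, han, hnl, -⟩ := exists_line_ne_ne a l l
  obtain ⟨Z, hZn, hZC, -⟩ := exists_mem_ne_ne n (mt n l) (mt n l)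
  have hZl : Z ∉ l := fun e => hZC (eq_mt hnl hZn e)
  have hC := mt_mem_right (jn L Z (σ Z)) l
  refine ⟨_, hC, hσ, hf, fun X => ?_⟩
  by_cases hX : X ∈ l
  · rw [hf X hX]; exact coll_right _ _
  refine ⟨jn L X (σ X), ?_, by simp, by simp⟩
  by_cases he : jn L X (σ X) = jn L Z (σ Z)
  · rw [he]; simp
  have hY := mt_mem_left (jn L X (σ X)) (jn L Z (σ Z))
  have hY' := mt_mem_right (jn L X (σ X)) (jn L Z (σ Z))
  have h1 := pt_ext he (key X hX _ hY) (key Z hZl _ hY') hY hY'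
  have h2 : mt (jn L X (σ X)) (jn L Z (σ Z)) ∈ l := by_contra fun e => h _ e h1
  have h3 : jn L Z (σ Z) ≠ l := fun e => hZl (e ▸ left_mem_jn L Z (σ Z))
  rw [← eq_mt h3 hY' h2]
  exact hY

lemma IsElat.mul_of_ne (h : IsElat C l σ) (h' : IsElat D l τ) : ∃ A, IsElat A l (σ * τ) := by
  have hf : ∀ X ∈ l, (σ * τ) X = X := fun X hX => by
    rw [Equiv.Perm.mul_apply, h'.fix X hX, h.fix X hX]
  by_cases hX : ∃ X ∉ l, (σ * τ) X = X
  · obtain ⟨X, hX, hX'⟩ := hX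
    by_cases hCD : C = D
    · subst hCD; exact ⟨_, h.mul h'⟩
    have h1 : τ X = σ⁻¹ X := by rw [eq_comm, Equiv.Perm.inv_eq_iff_eq]; exact hX'.symm
    have h2 := h'.mem_line (left_mem_jn L D X) (right_mem_jn L D X)
    have h3 := h.inv.mem_line (left_mem_jn L C X) (right_mem_jn L C X)
    rw [← h1] at h3
    have h4 : τ X = X := pt_ext (fun e => hCD ?_) h2 h3 (right_mem_jn L D X) (right_mem_jn L C X)
    · rw [h'.eq_one hX h4, mul_one]; exact ⟨_, h⟩
    · have : jn L D X ≠ l := fun e => hX (e ▸ right_mem_jn L D X)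
      exact pt_ext this (e ▸ left_mem_jn L C X) h.mem (left_mem_jn L D X) h'.mem
  · push Not at hX
    exact exists_center (mul_mem h.col h'.col) hf hX

variable (l) in
/-- The translations with axis `l`. -/
def Tr : Subgroup (Equiv.Perm P) where
  carrier := {σ | ∃ C, IsElat C l σ}
  one_mem' := ⟨_, isElat_one (mt_mem_left l l)⟩
  mul_mem' := fun ⟨_, h⟩ ⟨_, h'⟩ => h.mul_of_ne h'
  inv_mem' := fun ⟨_, h⟩ => ⟨_, h.inv⟩

lemma Tr.col (h : σ ∈ Tr l) : σ ∈ Col P L := h.choose_spec.col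

lemma Tr.fix (h : σ ∈ Tr l) {X : P} (hX : X ∈ l) : σ X = X := h.choose_spec.fix X hX

lemma Tr.eq_one (h : σ ∈ Tr l) {X : P} (hX : X ∉ l) (hX' : σ X = X) : σ = 1 :=
  h.choose_spec.eq_one hX hX'

lemma Tr.ext (h : σ ∈ Tr l) (h' : τ ∈ Tr l) {X : P} (hX : X ∉ l) (hX' : σ X = τ X) : σ = τ :=
  (inv_mul_eq_one.1 (Tr.eq_one (mul_mem (inv_mem h') h) hX (by
    rw [Equiv.Perm.mul_apply, Equiv.Perm.inv_eq_iff_eq, hX']))).symm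

lemma Tr.isElat (h : σ ∈ Tr l) (hC : C ∈ l) {X : P} (hX : X ∉ l) (hc : Coll L C X (σ X)) :
    IsElat C l σ := by
  obtain ⟨D, hD⟩ := h
  by_cases h1 : σ X = X
  · rw [hD.eq_one hX h1]; exact isElat_one hC
  obtain ⟨k, hDk, hXk, hk⟩ := hD.coll X
  have hkl : k ≠ l := fun e => hX (e ▸ hXk)
  have : C ∈ k := (coll_iff_mem (Ne.symm h1) hXk hk).1 hc.rot
  rwa [pt_ext hkl this hC hDk hD.mem]

lemma IsElat.commute_of_ne (h : IsElat C l σ) (h' : IsElat D l τ) (hCD : C ≠ D) :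
    σ * τ = τ * σ := by
  ext X
  by_cases hX : X ∈ l
  · simp [h.fix X hX, h'.fix X hX]
  have hσ := off_axis h.fix hX
  have hτ := off_axis h'.fix hX
  have hne : jn L C (τ X) ≠ jn L D (σ X) := fun e => hσ <| by
    have h1 : D ∈ jn L C (τ X) := e ▸ left_mem_jn L D (σ X)
    rw [line_ext hCD h.mem h'.mem (left_mem_jn L C (τ X)) h1, e]
    exact right_mem_jn L D (σ X)
  have hCX : C ≠ X := fun e => hX (e ▸ h.mem)
  have hDX : D ≠ X := fun e => hX (e ▸ h'.mem)
  refine pt_ext hne (h.mem_line (left_mem_jn L C _) (right_mem_jn L C (τ X))) ?_ ?_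
    (h'.mem_line (left_mem_jn L D _) (right_mem_jn L D (σ X)))
  · exact col_mem h.col hDX (left_mem_jn L D X) (right_mem_jn L D X)
      (by rw [h.fix D h'.mem]; simp) (by simp)
      (h'.mem_line (left_mem_jn L D X) (right_mem_jn L D X))
  · exact col_mem h'.col hCX (left_mem_jn L C X) (right_mem_jn L C X)
      (by rw [h'.fix C h.mem]; simp) (by simp)
      (h.mem_line (left_mem_jn L C X) (right_mem_jn L C X))

lemma Tr.commute (hF : FanoPlane (P := P) L) (h : σ ∈ Tr l) (h' : τ ∈ Tr l) :
    σ * τ = τ * σ := by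
  obtain ⟨C, hC⟩ := h
  obtain ⟨D, hD⟩ := h'
  by_cases hCD : C = D
  · subst hCD
    obtain ⟨A, hA, hAC, -⟩ := exists_mem_ne_ne l C C
    obtain ⟨ρ, h1, h2, -, h4, h5⟩ := exists_elation hF hA
    have hρ : IsElat A l ρ := ⟨hA, h1, h4, h5⟩
    obtain ⟨B, hB⟩ := hD.mul_of_ne hρ
    have hBC : C ≠ B := by
      rintro rfl
      refine h2 (hρ.eq_one_of_ne ?_ hAC)
      simpa using hD.inv.mul hB
    have e1 := hC.commute_of_ne hB hBC
    have e2 := hC.commute_of_ne hρ hAC.symm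
    rw [mul_assoc τ, ← e2, ← mul_assoc, ← mul_assoc] at e1
    exact mul_right_cancel e1
  · exact hC.commute_of_ne hD hCD

lemma Tr.sq (hF : FanoPlane (P := P) L) (h : σ ∈ Tr l) : σ * σ = 1 := by
  obtain ⟨C, hC⟩ := id h
  by_cases h1 : σ = 1
  · rw [h1, mul_one]
  obtain ⟨A, hA, hAC, -⟩ := exists_mem_ne_ne l C C
  obtain ⟨ρ, c1, c2, c3, c4, c5⟩ := exists_elation hF hA
  have hρ : IsElat A l ρ := ⟨hA, c1, c4, c5⟩
  obtain ⟨B, hB⟩ := hC.mul_of_ne hρ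
  have hBC : C ≠ B := by
    rintro rfl
    refine c2 (hρ.eq_one_of_ne ?_ hAC)
    simpa using hC.inv.mul hB
  refine (hC.mul hC).eq_one_of_ne ?_ hBC
  have := hB.mul hB
  rwa [mul_assoc, ← mul_assoc ρ, ← Tr.commute hF h ⟨_, hρ⟩, mul_assoc, c3, mul_one] at this

end Translation

/-! ## Counting translations -/

section TranslationCount

lemma card_dvd_of_free {P : Type*} [Finite P] (G : Subgroup (Equiv.Perm P)) (S : Set P)
    (hS : ∀ g ∈ G, ∀ x ∈ S, g x ∈ S) (hfree : ∀ g ∈ G, ∀ x ∈ S, g x = x → g = 1) :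
    Nat.card G ∣ Nat.card S := by
  let X : SubMulAction G P := ⟨S, fun g {x} hx => hS g.1 g.2 x hx⟩
  have : Fintype X := Fintype.ofFinite _
  have : Fintype G := Fintype.ofFinite _
  have h1 : Nat.card S = Nat.card X := rfl
  have h2 : ∀ x : X, MulAction.stabilizer G x = ⊥ := fun x => by
    rw [eq_bot_iff]
    intro g hg
    rw [MulAction.mem_stabilizer_iff] at hg
    rw [Subgroup.mem_bot]
    exact Subtype.ext (hfree g.1 g.2 x.1 x.2 (congrArg Subtype.val hg))
  have h3 := Nat.card_congr (MulAction.selfEquivSigmaOrbitsQuotientStabilizer G X)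
  rw [h1, h3, Nat.card_sigma]
  refine Finset.dvd_sum fun i _ => ?_
  rw [h2]
  exact (Nat.card_congr (QuotientGroup.quotientBot (G := G)).toEquiv).symm.dvd

variable {P L : Type*} [Membership P L] [ProjectivePlane P L] [Fintype P] [Fintype L]
variable {C D : P} {l : L} {σ τ ρ : Equiv.Perm P}

lemma exists_invol_on_line (hF : FanoPlane (P := P) L) (hC : C ∈ l) :
    ∃ σ ∈ Col P L, σ * σ = 1 ∧ (∀ X, σ X ∈ l ↔ X ∈ l) ∧ σ C = C ∧ ∀ X ∈ l, σ X = X → X = C := by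
  obtain ⟨m, hCm, hml, -⟩ := exists_line_ne_ne C l l
  obtain ⟨σ, h1, h2, h3, h4, h5⟩ := exists_elation hF hCm
  have h : IsElat C m σ := ⟨hCm, h1, h4, h5⟩
  refine ⟨σ, h1, h3, fun X => ⟨fun hX => ?_, fun hX => h.mem_line hC hX⟩, h4 C hCm,
    fun X hX hX' => ?_⟩
  · have := h.mem_line hC hX
    rwa [← Equiv.Perm.mul_apply, h3] at this
  · by_contra hXC
    exact h2 (h.eq_one (fun e => hXC (pt_ext hml e hX hCm hC)) hX')

/-- The stabilizer of a line is transitive on its points. -/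
lemma exists_col_map (hF : FanoPlane (P := P) L) (hC : C ∈ l) (hD : D ∈ l) :
    ∃ g ∈ Col P L, (∀ X, g X ∈ l ↔ X ∈ l) ∧ g C = D := by
  by_contra hcon
  let O := {X : P // X ∈ l ∧ ∃ g ∈ Col P L, (∀ X, g X ∈ l ↔ X ∈ l) ∧ g C = X}
  have key : ∀ A ∈ l, ∃ f : Function.End O, f ^ 2 ^ 1 = 1 ∧ ∀ x : O, f x = x ↔ x.1 = A := by
    intro A hA
    obtain ⟨σ, h1, h2, h3, h4, h5⟩ := exists_invol_on_line hF hA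
    have hO : ∀ x : O, ∃ g ∈ Col P L, (∀ X, g X ∈ l ↔ X ∈ l) ∧ g C = σ x.1 := fun x => by
      obtain ⟨g, g1, g2, g3⟩ := x.2.2
      exact ⟨σ * g, mul_mem h1 g1, fun X => (h3 _).trans (g2 _), congrArg σ g3⟩
    let f : Function.End O := fun x => ⟨σ x.1, (h3 _).2 x.2.1, hO x⟩
    refine ⟨f, ?_, fun x => ⟨fun h => ?_, fun h => ?_⟩⟩
    · rw [pow_one, pow_two f]
      funext x
      exact Subtype.ext (congrArg (fun f : Equiv.Perm P => f x.1) h2)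
    · exact h5 _ x.2.1 (congrArg Subtype.val h)
    · exact Subtype.ext (by
        change σ x.1 = x.1
        rw [h, h4])
  have : Fact (Nat.Prime 2) := ⟨Nat.prime_two⟩
  obtain ⟨f, hf, hf'⟩ := key C hC
  obtain ⟨f', hf1, hf1'⟩ := key D hD
  have e1 := Equiv.Perm.card_fixedPoints_modEq hf
  have e2 := Equiv.Perm.card_fixedPoints_modEq hf1
  simp only [Fintype.card_eq_nat_card] at e1 e2
  have c1 : Nat.card f.fixedPoints = 1 := by
    rw [Nat.card_eq_fintype_card, Fintype.card_eq_one_iff]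
    refine ⟨⟨⟨C, hC, 1, one_mem _, fun _ => Iff.rfl, rfl⟩, (hf' _).2 rfl⟩, fun y => ?_⟩
    exact Subtype.ext (Subtype.ext ((hf' _).1 y.2))
  have c2 : Nat.card f'.fixedPoints = 0 := by
    rw [Nat.card_eq_fintype_card, Fintype.card_eq_zero_iff]
    refine ⟨fun y => hcon ?_⟩
    have := (hf1' _).1 y.2
    rw [← this]
    exact y.1.2.2
  rw [c1] at e1
  rw [c2] at e2
  exact absurd (e1.symm.trans e2) (by decide)

lemma IsElat.conj (h : IsElat C l σ) {g : Equiv.Perm P} (hg : g ∈ Col P L)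
    (hgl : ∀ X, g X ∈ l ↔ X ∈ l) : IsElat (g C) l (g * σ * g⁻¹) := by
  refine ⟨(hgl _).2 h.mem, mul_mem (mul_mem hg h.col) (inv_mem hg), fun X hX => ?_, fun X => ?_⟩
  · have e : g (g⁻¹ X) = X := g.apply_symm_apply X
    rw [Equiv.Perm.mul_apply, Equiv.Perm.mul_apply, h.fix _ ((hgl _).1 (by rwa [e])), e]
  · have := (hg _ _ _).2 (h.coll (g⁻¹ X))
    rwa [show g (g⁻¹ X) = X from g.apply_symm_apply X] at this

lemma card_El_le (hF : FanoPlane (P := P) L) (hC : C ∈ l) (hD : D ∈ l) :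
    Nat.card (El hC) ≤ Nat.card (El hD) := by
  obtain ⟨g, hg, hgl, rfl⟩ := exists_col_map hF hC hD
  refine Nat.card_le_card_of_injective
    (fun σ : El hC => (⟨g * σ.1 * g⁻¹, IsElat.conj σ.2 hg hgl⟩ : El hD)) fun σ τ h => ?_
  have := congrArg Subtype.val h
  exact Subtype.ext (by simpa using this)

lemma card_El_eq (hF : FanoPlane (P := P) L) (hC : C ∈ l) (hD : D ∈ l) :
    Nat.card (El hC) = Nat.card (El hD) :=
  (card_El_le hF hC hD).antisymm (card_El_le hF hD hC)

lemma two_le_card_El (hF : FanoPlane (P := P) L) (hC : C ∈ l) : 2 ≤ Nat.card (El hC) := by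
  obtain ⟨σ, h1, h2, -, h4, h5⟩ := exists_elation hF hC
  have : Nontrivial (El hC) :=
    ⟨⟨⟨σ, ⟨hC, h1, h4, h5⟩⟩, 1, fun h => h2 (congrArg Subtype.val h)⟩⟩
  exact Finite.one_lt_card

lemma card_El_dvd (hC : C ∈ l) : Nat.card (El hC) ∣ ProjectivePlane.order P L := by
  obtain ⟨m, hCm, hml, -⟩ := exists_line_ne_ne C l l
  have : Nat.card ({X | X ∈ m ∧ X ≠ C} : Set P) = ProjectivePlane.order P L := by
    have h := card_line (P := P) m
    rw [Nat.card_eq_fintype_card, Fintype.card_subtype]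
    have : (Finset.univ.filter fun x : P => x ∈ {X | X ∈ m ∧ X ≠ C})
        = (Finset.univ.filter (fun x : P => x ∈ m)).erase C := by
      ext x; simp [and_comm]
    rw [this, Finset.card_erase_of_mem (by simpa using hCm), h]
    rfl
  rw [← this]
  have hm : ∀ x, x ∈ m → x ≠ C → x ∉ l := fun x h1 h2 h3 => h2 (pt_ext hml h1 h3 hCm hC)
  refine card_dvd_of_free _ _ (fun g hg x hx => ⟨IsElat.mem_line hg hCm hx.1, fun e => ?_⟩)
    (fun g hg x hx h => IsElat.eq_one hg (hm x hx.1 hx.2) h)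
  exact off_axis (IsElat.fix hg) (hm x hx.1 hx.2) (e ▸ hC)

variable (l) in
lemma card_affine : Nat.card ({X | X ∉ l} : Set P) = ProjectivePlane.order P L ^ 2 := by
  have h := card_line (P := P) l
  have h2 := ProjectivePlane.card_points P L
  have h3 := Finset.card_filter_add_card_filter_not (s := Finset.univ) (fun x : P => x ∈ l)
  rw [Finset.card_univ] at h3
  rw [Nat.card_eq_fintype_card, Fintype.card_subtype]
  simp only [Set.mem_ofPred_eq]
  omega

variable (l) in
lemma card_Tr_dvd : Nat.card (Tr (P := P) l) ∣ ProjectivePlane.order P L ^ 2 := by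
  rw [← card_affine (P := P) l]
  exact card_dvd_of_free _ _ (fun g hg x hx => off_axis (fun X hX => Tr.fix hg hX) hx)
    (fun g hg x hx h => Tr.eq_one hg hx h)

lemma card_Tr (hF : FanoPlane (P := P) L) (hC : C ∈ l) :
    Nat.card (Tr (P := P) l) =
      (ProjectivePlane.order P L + 1) * (Nat.card (El hC) - 1) + 1 := by
  have hsplit : Finset.univ.filter (fun σ : Equiv.Perm P => σ ∈ Tr l) =
      insert 1 ((Finset.univ.filter (fun X : P => X ∈ l)).biUnion fun X =>
        Finset.univ.filter fun σ : Equiv.Perm P => IsElat X l σ ∧ σ ≠ 1) := by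
    ext σ
    simp only [Finset.mem_filter, Finset.mem_univ, true_and, Finset.mem_insert,
      Finset.mem_biUnion]
    constructor
    · rintro ⟨X, hX⟩
      by_cases h1 : σ = 1
      · exact Or.inl h1
      · exact Or.inr ⟨X, hX.mem, hX, h1⟩
    · rintro (rfl | ⟨X, -, hX, -⟩)
      · exact one_mem _
      · exact ⟨X, hX⟩
  rw [Nat.card_eq_fintype_card, Fintype.card_subtype, hsplit, Finset.card_insert_of_notMem
    (by simp), Finset.card_biUnion]
  · congr 1
    rw [← card_line (P := P) l, ← smul_eq_mul, ← Finset.sum_const]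
    refine Finset.sum_congr rfl fun X hX => ?_
    have hX : X ∈ l := by simpa using hX
    rw [card_El_eq hF hC hX, Nat.card_eq_fintype_card, Fintype.card_subtype]
    have : (Finset.univ.filter fun σ : Equiv.Perm P => IsElat X l σ ∧ σ ≠ 1) =
        (Finset.univ.filter fun σ => σ ∈ El hX).erase 1 := by
      ext σ
      simp only [Finset.mem_filter, Finset.mem_univ, true_and, Finset.mem_erase]
      exact and_comm
    rw [this, Finset.card_erase_of_mem (by simp)]
  · intro X _ Y _ hXY
    rw [Function.onFun, Finset.disjoint_left]
    intro σ h1 h2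
    simp only [Finset.mem_filter, Finset.mem_univ, true_and] at h1 h2
    exact h1.2 (h1.1.eq_one_of_ne h2.1 hXY)

lemma eq_of_dvd_pow_two {q h r : ℕ} (hq : q = 2 ^ r) (h2 : 2 ≤ h) (hh : h ∣ q)
    (hT : (q + 1) * (h - 1) + 1 ∣ q ^ 2) : h = q := by
  subst hq
  obtain ⟨s, hs, rfl⟩ := (Nat.dvd_prime_pow Nat.prime_two).1 hh
  rw [← pow_mul] at hT
  obtain ⟨k, -, hk⟩ := (Nat.dvd_prime_pow Nat.prime_two).1 hT
  by_contra hne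
  have hsr : s < r := lt_of_le_of_ne hs fun e => hne (by rw [e])
  obtain ⟨d, rfl⟩ := Nat.exists_eq_add_of_lt hsr
  have e1 : 2 ^ s * (2 ^ (s + d + 1) + 1 - 2 ^ (d + 1)) = 2 ^ k := by
    rw [← hk]
    have a1 : 2 ^ (d + 1) ≤ 2 ^ (s + d + 1) := Nat.pow_le_pow_right (by norm_num) (by omega)
    have a2 : 2 ^ (s + d + 1) = 2 ^ s * 2 ^ (d + 1) := by rw [← pow_add, add_assoc]
    rw [a2] at a1 ⊢
    zify [h2, (by omega : 1 ≤ 2 ^ s), (by omega : 2 ^ (d + 1) ≤ 2 ^ s * 2 ^ (d + 1) + 1)]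
    ring
  have e2 : (2 ^ (s + d + 1) + 1 - 2 ^ (d + 1)) ∣ 2 ^ k := ⟨2 ^ s, by rw [← e1, mul_comm]⟩
  obtain ⟨j, -, hj⟩ := (Nat.dvd_prime_pow Nat.prime_two).1 e2
  have a3 : 2 * 2 ^ (d + 1) ≤ 2 ^ (s + d + 1) := by
    rw [← pow_succ']
    apply Nat.pow_le_pow_right (by norm_num)
    have : s ≠ 0 := by rintro rfl; simp at h2
    omega
  have a4 : 1 ≤ 2 ^ d := Nat.one_le_two_pow
  rcases j with _ | j
  · rw [pow_succ 2 d] at *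
    omega
  · rw [pow_succ] at *
    rw [pow_succ] at *
    omega

/-- In a Fano plane of order `2 ^ r` the translations are transitive on the affine points. -/
theorem exists_translation (hF : FanoPlane (P := P) L) {r : ℕ}
    (hr : ProjectivePlane.order P L = 2 ^ r) {X Y : P} (hX : X ∉ l) (hY : Y ∉ l) :
    ∃ σ ∈ Tr l, σ X = Y := by
  have hC := mt_mem_left (P := P) l l
  have h1 := card_Tr_dvd (P := P) l
  rw [card_Tr hF hC] at h1
  have h2 := eq_of_dvd_pow_two hr (two_le_card_El hF hC) (card_El_dvd hC) h1
  have h3 := card_Tr hF hC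
  rw [h2] at h3
  have h4 : Nat.card (Tr (P := P) l) = Nat.card ({X | X ∉ l} : Set P) := by
    rw [card_affine, h3]
    have := ProjectivePlane.one_lt_order P L
    zify [this.le]
    ring
  have hf : Function.Bijective (fun σ : Tr (P := P) l =>
      (⟨σ.1 X, off_axis (fun _ h => Tr.fix σ.2 h) hX⟩ : ({X | X ∉ l} : Set P))) :=
    (Function.Injective.bijective_of_nat_card_le (fun σ τ h =>
      Subtype.ext (Tr.ext σ.2 τ.2 hX (congrArg Subtype.val h))) h4.ge)
  obtain ⟨σ, hσ⟩ := hf.2 ⟨Y, hY⟩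
  exact ⟨σ.1, σ.2, congrArg Subtype.val hσ⟩

end TranslationCount

/-! ## Alternative rings of characteristic two -/

section Inverses

/-- An additive subgroup of a finite ring of characteristic two in which every nonzero element is
regular and which satisfies `A' (1 + A) = A` is closed under squaring. -/
lemma sq_mem_of_div_mem {E : Type*} [Ring E] [Finite E] (h2 : ∀ x : E, x + x = 0)
    (S : AddSubgroup E) (h1 : (1 : E) ∈ S)
    (hS : ∀ A ∈ S, A ≠ 1 → ∃ B ∈ S, B * (1 + A) = A) {A : E} (hA : A ∈ S) : A * A ∈ S := by
  have inv : ∀ B ∈ S, B ≠ 0 → ∃ N ∈ S, N * B = 1 ∧ B * N = 1 := by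
    intro B hB hB0
    obtain ⟨K, hK, e⟩ := hS (1 + B) (add_mem h1 hB) (by simpa using hB0)
    have hN : (K + 1) * B = 1 := by
      rw [← add_assoc, h2, zero_add] at e
      rw [add_mul, e, one_mul, add_assoc, h2, add_zero]
    exact ⟨K + 1, add_mem hK h1, hN, mul_eq_one_comm.1 hN⟩
  by_cases hA0 : A = 0
  · rw [hA0, mul_zero]; exact zero_mem S
  by_cases hA1 : A = 1
  · rw [hA1, mul_one]; exact h1
  have hne : 1 + A ≠ 0 := fun h => hA1 <| by
    have := congrArg (1 + ·) h
    simpa [← add_assoc, h2] using this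
  obtain ⟨N, hN, n1, n2⟩ := inv A hA hA0
  obtain ⟨K, hK, k1, k2⟩ := inv (1 + A) (add_mem h1 hA) hne
  have e : N + K = N * K := by
    calc N + K = N * ((1 + A) * K) + (N * A) * K := by rw [k2, n1, mul_one, one_mul]
      _ = N * (1 + (A + A)) * K := by noncomm_ring
      _ = N * K := by rw [h2, add_zero, mul_one]
  have h0 : N + K ≠ 0 := fun h => hA0 <| by
    have : N = 0 := by
      rw [e] at h
      calc N = N * K * (1 + A) := by rw [mul_assoc, k1, mul_one]
        _ = 0 := by rw [h, zero_mul]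
    calc A = (N * A) * A := by rw [n1, one_mul]
      _ = 0 := by rw [this, zero_mul, zero_mul]
  obtain ⟨Q, hQ, q1, -⟩ := inv _ (add_mem hN hK) h0
  rw [e] at q1
  have hQA : Q = A + A * A := by
    calc Q = Q * (N * (K * (1 + A)) * A) := by rw [k1, mul_one, n1, mul_one]
      _ = (Q * (N * K)) * ((1 + A) * A) := by noncomm_ring
      _ = A + A * A := by rw [q1]; noncomm_ring
  have : A * A = Q + A := by
    rw [hQA, add_comm A, add_assoc, h2, add_zero]
  rw [this]
  exact add_mem hQ hA

end Inverses

section Alternative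

variable {D : Type*} [NonAssocRing D]

lemma neg_eq_self_of_char_two (h2 : ∀ x : D, x + x = 0) (x : D) : -x = x :=
  neg_eq_of_add_eq_zero_left (h2 x)

lemma left_alternative [Finite D] (h2 : ∀ x : D, x + x = 0)
    (h : ∀ a : D, a ≠ 1 → ∃ b, ∀ u, b * (u + a * u) = a * u) (x y : D) :
    x * (x * y) = (x * x) * y := by
  have : Finite (AddMonoid.End D) := DFunLike.finite _
  obtain ⟨b, hb⟩ := sq_mem_of_div_mem (E := AddMonoid.End D)
    (fun f => AddMonoidHom.ext fun x => h2 (f x))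
    (AddMonoidHom.mul (R := D)).range
    ⟨1, AddMonoidHom.ext fun x => one_mul x⟩
    (by
      rintro _ ⟨a, rfl⟩ ha
      obtain ⟨b, hb⟩ := h a (by rintro rfl; exact ha (AddMonoidHom.ext fun x => one_mul x))
      exact ⟨_, ⟨b, rfl⟩, AddMonoidHom.ext hb⟩) (A := AddMonoidHom.mul x) ⟨x, rfl⟩
  have e : ∀ u, b * u = x * (x * u) := fun u => congrArg (fun f : D →+ D => f u) hb
  have e1 := e 1
  rw [mul_one, mul_one] at e1
  rw [← e, e1]

lemma right_alternative [Finite D] (h2 : ∀ x : D, x + x = 0)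
    (h : ∀ a : D, a ≠ 1 → ∃ b, ∀ u, (u + u * a) * b = u * a) (x y : D) :
    (y * x) * x = y * (x * x) := by
  have : Finite (AddMonoid.End D) := DFunLike.finite _
  obtain ⟨b, hb⟩ := sq_mem_of_div_mem (E := AddMonoid.End D)
    (fun f => AddMonoidHom.ext fun x => h2 (f x))
    (AddMonoidHom.mul (R := D)).flip.range
    ⟨1, AddMonoidHom.ext fun x => mul_one x⟩
    (by
      rintro _ ⟨a, rfl⟩ ha
      obtain ⟨b, hb⟩ := h a (by rintro rfl; exact ha (AddMonoidHom.ext fun x => mul_one x))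
      exact ⟨_, ⟨b, rfl⟩, AddMonoidHom.ext hb⟩) (A := AddMonoidHom.mul.flip x) ⟨x, rfl⟩
  have e : ∀ u, u * b = u * x * x := fun u => congrArg (fun f : D →+ D => f u) hb
  have e1 := e 1
  rw [one_mul, one_mul] at e1
  rw [← e, e1]

variable (h2 : ∀ x : D, x + x = 0) (hl : ∀ x y : D, x * (x * y) = (x * x) * y)
  (hr : ∀ x y : D, (y * x) * x = y * (x * x))

include hl in
lemma associator_self_left (x y : D) : associator x x y = 0 := by
  rw [associator_apply, hl, sub_self]

include hr in
lemma associator_self_right (x y : D) : associator y x x = 0 := by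
  rw [associator_apply, hr, sub_self]

lemma associator_add_left (x x' y z : D) :
    associator (x + x') y z = associator x y z + associator x' y z :=
  congrArg (fun f : D →+ D →+ D => f y z) (map_add (AddMonoidHom.associator (R := D)) x x')

lemma associator_add_mid (x y y' z : D) :
    associator x (y + y') z = associator x y z + associator x y' z :=
  congrArg (fun f : D →+ D => f z) (map_add (AddMonoidHom.associator x) y y')

lemma associator_add_right (x y z z' : D) :
    associator x y (z + z') = associator x y z + associator x y z' :=
  map_add (AddMonoidHom.associator x y) z z'

include h2 hl in
lemma associator_swap_left (x y z : D) : associator x y z = associator y x z := by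
  have h := associator_self_left hl (x + y) z
  rw [associator_add_left, associator_add_mid, associator_add_mid, associator_self_left hl,
    associator_self_left hl, zero_add, add_zero] at h
  rw [eq_neg_of_add_eq_zero_left h, neg_eq_self_of_char_two h2]

include h2 hr in
lemma associator_swap_right (x y z : D) : associator x y z = associator x z y := by
  have h := associator_self_right hr (y + z) x
  rw [associator_add_right, associator_add_mid, associator_add_mid, associator_self_right hr,
    associator_self_right hr, zero_add, add_zero] at h
  rw [eq_neg_of_add_eq_zero_right h, neg_eq_self_of_char_two h2]

include h2 hl hr in
lemma associator_mul_right (x y z : D) : associator x y (x * z) = associator x y z * x := by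
  have a := associator_cocycle z y x x
  have b := associator_cocycle y x x z
  have s1 := associator_swap_left h2 hl
  have s2 := associator_swap_right h2 hr
  have n := neg_eq_self_of_char_two h2
  rw [associator_self_right hr, associator_self_right hr] at a
  rw [associator_self_right hr, associator_self_left hl] at b
  simp only [mul_zero, zero_mul, sub_eq_add_neg, n, zero_add, add_zero] at a b
  rw [s1 z, s2 (y * x), s1 (y * x), s1 z y (x * x), s1 z y x, s2 y z x, s1 y x z] at a
  rw [s1 (y * x), s2 y (x * x)] at b
  rw [s1]
  exact add_left_cancel (b.trans a.symm)

/-- Right-normed products of two generators. -/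
def wordEval (g : Bool → D) (w : List Bool) : D := w.foldr (fun b x => g b * x) 1

include h2 hl hr in
lemma associator_word (g : Bool → D) : ∀ n : ℕ, ∀ u v : List Bool, u.length + v.length = n →
    ∀ b, associator (g b) (wordEval g u) (wordEval g v) = 0 := by
  intro n
  induction n with
  | zero =>
    intro u v h b
    rw [List.length_eq_zero_iff.1 (by omega : u.length = 0)]
    simp [wordEval, associator_apply]
  | succ n ih =>
    have s2 := associator_swap_right h2 hr
    have step : ∀ u v : List Bool, u.length + v.length = n → ∀ b,
        associator (g b) (wordEval g u) (g b * wordEval g v) = 0 := fun u v h b => by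
      rw [associator_mul_right h2 hl hr, ih u v h, zero_mul]
    rintro (_ | ⟨s, u⟩) v h b
    · simp [wordEval, associator_apply]
    rcases v with _ | ⟨t, v⟩
    · simp [wordEval, associator_apply]
    simp only [List.length_cons] at h
    change associator (g b) (g s * wordEval g u) (g t * wordEval g v) = 0
    by_cases hs : s = b
    · subst hs
      rw [s2]
      exact step (t :: v) u (by simp only [List.length_cons]; omega) s
    by_cases ht : t = b
    · subst ht
      exact step (s :: u) v (by simp only [List.length_cons]; omega) t
    obtain rfl : s = t := by revert hs ht; cases s <;> cases t <;> cases b <;> simp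
    have lin := associator_mul_right h2 hl hr (g b + g s) (g s * wordEval g u) (wordEval g v)
    have e1 : associator (g b) (g s * wordEval g u) (wordEval g v) = 0 :=
      ih (s :: u) v (by simp only [List.length_cons]; omega) b
    have e2 : associator (g s) (g s * wordEval g u) (wordEval g v) = 0 :=
      ih (s :: u) v (by simp only [List.length_cons]; omega) s
    have e3 : associator (g b) (g s * wordEval g u) (g b * wordEval g v) = 0 :=
      step (s :: u) v (by simp only [List.length_cons]; omega) b
    have e4 : associator (g s) (g s * wordEval g u) (g s * wordEval g v) = 0 :=
      step (s :: u) v (by simp only [List.length_cons]; omega) s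
    have e5 : associator (g s) (g s * wordEval g u) (g b * wordEval g v) = 0 := by
      rw [s2]
      exact step (b :: v) u (by simp only [List.length_cons]; omega) s
    rw [add_mul, associator_add_right, associator_add_left, associator_add_left, e3, e4, e5,
      associator_add_left, e1, e2] at lin
    simpa using lin

include h2 hl hr in
lemma wordEval_mul (g : Bool → D) (u v : List Bool) :
    wordEval g u * wordEval g v = wordEval g (u ++ v) := by
  induction u with
  | nil => exact one_mul _
  | cons b u ih =>
    have h := associator_word h2 hl hr g _ u v rfl b
    rw [associator_apply, sub_eq_zero] at h
    change (g b * wordEval g u) * wordEval g v = g b * wordEval g (u ++ v)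
    rw [h, ih]

include h2 hl hr in
/-- A finite alternative division ring of characteristic two is commutative. -/
lemma mul_comm_of_alternative [Finite D] [NoZeroDivisors D] [Nontrivial D] (a b : D) :
    a * b = b * a := by
  let g : Bool → D := fun i => cond i a b
  let A := AddSubgroup.closure (Set.range (wordEval g))
  have hword : ∀ u, wordEval g u ∈ A := fun u => AddSubgroup.subset_closure ⟨u, rfl⟩
  have hmul : ∀ x ∈ A, ∀ y ∈ A, x * y ∈ A := by
    intro x hx y hy
    induction hx using AddSubgroup.closure_induction with
    | mem x hx =>
      obtain ⟨u, rfl⟩ := hx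
      induction hy using AddSubgroup.closure_induction with
      | mem y hy =>
        obtain ⟨v, rfl⟩ := hy
        rw [wordEval_mul h2 hl hr]
        exact hword _
      | zero => rw [mul_zero]; exact zero_mem A
      | add y z _ _ h h' => rw [mul_add]; exact add_mem h h'
      | neg y _ h => rw [mul_neg]; exact neg_mem h
    | zero => rw [zero_mul]; exact zero_mem A
    | add y z _ _ h h' => rw [add_mul]; exact add_mem h h'
    | neg y _ h => rw [neg_mul]; exact neg_mem h
  have hassoc : ∀ x ∈ A, ∀ y ∈ A, ∀ z ∈ A, associator x y z = 0 := by
    intro x hx y hy z hz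
    induction hx using AddSubgroup.closure_induction with
    | mem x hx =>
      obtain ⟨u, rfl⟩ := hx
      induction hy using AddSubgroup.closure_induction with
      | mem y hy =>
        obtain ⟨v, rfl⟩ := hy
        induction hz using AddSubgroup.closure_induction with
        | mem z hz =>
          obtain ⟨w, rfl⟩ := hz
          rw [associator_apply]
          simp only [wordEval_mul h2 hl hr, List.append_assoc, sub_self]
        | zero => simp [associator_apply]
        | add y z _ _ h h' => rw [associator_add_right, h, h', add_zero]
        | neg y _ h => rwa [neg_eq_self_of_char_two h2]
      | zero => simp [associator_apply]
      | add y z _ _ h h' => rw [associator_add_mid, h, h', add_zero]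
      | neg y _ h => rwa [neg_eq_self_of_char_two h2]
    | zero => simp [associator_apply]
    | add y z _ _ h h' => rw [associator_add_left, h, h', add_zero]
    | neg y _ h => rwa [neg_eq_self_of_char_two h2]
  let B : Subring D :=
    { A with
      mul_mem' := fun hx hy => hmul _ hx _ hy
      one_mem' := hword [] }
  let : Ring B :=
    { (inferInstance : NonAssocRing B) with
      mul_assoc := fun x y z =>
        Subtype.ext (sub_eq_zero.1 (hassoc x.1 x.2 y.1 y.2 z.1 z.2)) }
  have : IsDomain B := NoZeroDivisors.to_isDomain B
  have hF := Finite.isDomain_to_isField B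
  have ha : a ∈ B := show a ∈ A by simpa [wordEval, g] using hword [true]
  have hb : b ∈ B := show b ∈ A by simpa [wordEval, g] using hword [false]
  exact congrArg Subtype.val (hF.mul_comm ⟨a, ha⟩ ⟨b, hb⟩)

include h2 hl hr in
lemma mul_assoc_of_alternative [Finite D] [NoZeroDivisors D] [Nontrivial D] (x y z : D) :
    (x * y) * z = x * (y * z) := by
  have hc := mul_comm_of_alternative h2 hl hr
  have s1 := associator_swap_left h2 hl
  have s2 := associator_swap_right h2 hr
  have e : associator x y z + (associator y z x + associator z x y) = 0 := by
    simp only [associator_apply]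
    rw [hc x (y * z), hc y (z * x), hc z (x * y)]
    abel
  rw [s2 y, s1 y, s1 z, s2 x z, h2, add_zero, associator_apply, sub_eq_zero] at e
  exact e

end Alternative

/-! ## Coordinates from a translation group -/

section Spread

variable {V ι : Type*} [AddCommGroup V] (E : ι → AddSubgroup V)
  (hd : ∀ i j, i ≠ j → ∀ v ∈ E i, v ∈ E j → v = 0)
  (hs : ∀ i j, i ≠ j → ∀ v, ∃ a ∈ E i, ∃ b ∈ E j, a + b = v)

include hd hs in
lemma exists_spread_hom {i i1 i2 : ι} (hi : i ≠ i2) :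
    ∃ f : E i1 →+ E i2, ∀ (x : E i1) (y : E i2), (x : V) + y ∈ E i ↔ y = f x := by
  have ex : ∀ x : E i1, ∃ y : E i2, (x : V) + y ∈ E i := fun x => by
    obtain ⟨a, ha, b, hb, e⟩ := hs i i2 hi x
    exact ⟨⟨-b, neg_mem hb⟩, by simpa [← e] using ha⟩
  have un : ∀ (x : E i1) (y y' : E i2), (x : V) + y ∈ E i → (x : V) + y' ∈ E i → y = y' := by
    intro x y y' h h'
    have h3 := sub_mem h h'
    rw [add_sub_add_left_eq_sub] at h3
    exact Subtype.ext (sub_eq_zero.1 (hd i i2 hi _ h3 (sub_mem y.2 y'.2)))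
  choose f hf using ex
  refine ⟨AddMonoidHom.mk' f fun x y => un (x + y) _ _ (hf _) ?_, fun x y =>
    ⟨fun h => un x _ _ h (hf x), fun h => h ▸ hf x⟩⟩
  have := add_mem (hf x) (hf y)
  convert this using 1
  push_cast
  abel

include hd hs in
lemma exists_spread_coord {i0 i1 i2 : ι} (h01 : i0 ≠ i1) (h02 : i0 ≠ i2) (h12 : i1 ≠ i2) :
    ∃ (p : E i1 × E i1 ≃+ V) (M : ι → (E i1 →+ E i1)),
      (∀ v, p v ∈ E i2 ↔ v.1 = 0) ∧ (∀ i ≠ i2, ∀ v, p v ∈ E i ↔ v.2 = M i v.1) ∧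
      M i0 = AddMonoidHom.id _ ∧ M i1 = 0 := by
  have hψ : ∀ i : ι, ∃ f : E i1 →+ E i2, i ≠ i2 →
      ∀ (x : E i1) (y : E i2), (x : V) + y ∈ E i ↔ y = f x := fun i => by
    by_cases hi : i = i2
    · exact ⟨0, fun h => absurd hi h⟩
    · obtain ⟨f, hf⟩ := exists_spread_hom E hd hs (i1 := i1) hi
      exact ⟨f, fun _ => hf⟩
  choose ψ hψ using hψ
  have bij : Function.Bijective (ψ i0) := by
    constructor
    · rw [injective_iff_map_eq_zero]
      intro x hx
      have := (hψ i0 h02 x 0).2 hx.symm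
      rw [AddSubgroup.coe_zero, add_zero] at this
      exact Subtype.ext (hd i0 i1 h01 _ this x.2)
    · intro y
      obtain ⟨a, ha, b, hb, e⟩ := hs i0 i1 h01 (y : V)
      refine ⟨⟨-b, neg_mem hb⟩, ((hψ i0 h02 _ y).1 ?_).symm⟩
      simpa [← e] using ha
  let φ : E i1 ≃+ E i2 := AddEquiv.ofBijective (ψ i0) bij
  let p0 : E i1 × E i1 →+ V :=
    (AddSubgroup.subtype _).coprod ((AddSubgroup.subtype (E i2)).comp φ.toAddMonoidHom)
  have hp0 : ∀ v, p0 v = (v.1 : V) + (φ v.2 : V) := fun v => rfl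
  have bijp : Function.Bijective p0 := by
    constructor
    · rw [injective_iff_map_eq_zero]
      intro v hv
      rw [hp0] at hv
      have h1 : (v.1 : V) = 0 := hd i1 i2 h12 _ v.1.2 (by
        rw [eq_neg_of_add_eq_zero_left hv]; exact neg_mem (φ v.2).2)
      rw [h1, zero_add] at hv
      exact Prod.ext (Subtype.ext h1) (φ.injective ((Subtype.ext hv).trans (map_zero φ).symm))
    · intro v
      obtain ⟨a, ha, b, hb, e⟩ := hs i1 i2 h12 v
      refine ⟨(⟨a, ha⟩, φ.symm ⟨b, hb⟩), ?_⟩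
      rw [hp0, φ.apply_symm_apply, e]
  refine ⟨AddEquiv.ofBijective p0 bijp, fun i => φ.symm.toAddMonoidHom.comp (ψ i), fun v => ?_,
    fun i hi v => ?_, ?_, ?_⟩
  · change (v.1 : V) + (φ v.2 : V) ∈ E i2 ↔ _
    rw [AddSubgroup.add_mem_cancel_right _ (φ v.2).2]
    exact ⟨fun h => Subtype.ext (hd i1 i2 h12 _ v.1.2 h), fun h => h ▸ zero_mem _⟩
  · change (v.1 : V) + (φ v.2 : V) ∈ E i ↔ v.2 = φ.symm (ψ i v.1)
    rw [hψ i hi]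
    exact φ.eq_symm_apply.symm
  · ext1 x
    exact φ.symm_apply_apply x
  · ext1 x
    have : ψ i1 x = 0 := ((hψ i1 h12 x 0).1 (by simp)).symm
    change φ.symm (ψ i1 x) = 0
    rw [this, map_zero]

end Spread

section Coord

universe u

variable {P : Type u} {L : Type*} [Membership P L] [ProjectivePlane P L] [Fintype P] [Fintype L]

/-- Coordinates for the affine plane obtained by deleting the line `l`, adapted to three points
of `l`; the line at infinity is parametrized by additive maps. -/
structure Coord (l : L) (P0 P1 P2 : P) (D : Type*) [AddCommGroup D] where
  pt : D × D → P
  M : P → D →+ D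
  inj : Function.Injective pt
  off : ∀ v, pt v ∉ l
  surj : ∀ X ∉ l, ∃ v, pt v = X
  coll : ∀ C ∈ l, C ≠ P2 → ∀ v w, Coll L C (pt v) (pt w) ↔ w.2 - v.2 = M C (w.1 - v.1)
  coll_vert : ∀ v w, Coll L P2 (pt v) (pt w) ↔ v.1 = w.1
  M_id : M P0 = AddMonoidHom.id D
  M_zero : M P1 = 0
  trans : ∀ w, ∃ τ ∈ Tr l, ∀ v, τ (pt v) = pt (v + w)

lemma exists_decomp (hF : FanoPlane (P := P) L) {r : ℕ}
    (hr : ProjectivePlane.order P L = 2 ^ r) {l : L} {C D : P} (hC : C ∈ l) (hD : D ∈ l)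
    (hCD : C ≠ D) {σ : Equiv.Perm P} (hσ : σ ∈ Tr l) :
    ∃ α, IsElat C l α ∧ ∃ β, IsElat D l β ∧ α * β = σ := by
  obtain ⟨n, hCn, hnl, -⟩ := exists_line_ne_ne C l l
  obtain ⟨O, hOn, hOC, -⟩ := exists_mem_ne_ne n C C
  have hO : O ∉ l := fun e => hOC (pt_ext hnl hOn e hCn hC)
  have hσO : σ O ∉ l := off_axis (fun X hX => Tr.fix hσ hX) hO
  have hne : jn L D O ≠ jn L C (σ O) := fun e => hO <| by
    have h1 : C ∈ jn L D O := e ▸ left_mem_jn L C (σ O)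
    rw [line_ext hCD hC hD h1 (left_mem_jn L D O)]
    exact right_mem_jn L D O
  have hZ1 := mt_mem_left (jn L D O) (jn L C (σ O))
  have hZ2 := mt_mem_right (jn L D O) (jn L C (σ O))
  have hZ : mt (jn L D O) (jn L C (σ O)) ∉ l := fun e => hCD <| by
    have a1 : jn L D O ≠ l := fun h => hO (h ▸ right_mem_jn L D O)
    have a2 : jn L C (σ O) ≠ l := fun h => hσO (h ▸ right_mem_jn L C (σ O))
    exact (pt_ext a2 (left_mem_jn L C (σ O)) hC hZ2 e).trans
      (pt_ext a1 (left_mem_jn L D O) hD hZ1 e).symm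
  obtain ⟨β, hβ, hβO⟩ := exists_translation hF hr hO hZ
  obtain ⟨α, hα, hαO⟩ := exists_translation hF hr hZ hσO
  refine ⟨α, Tr.isElat hα hC hZ ?_, β, Tr.isElat hβ hD hO ?_, Tr.ext (mul_mem hα hβ) hσ hO ?_⟩
  · rw [hαO]; exact ⟨_, left_mem_jn L C (σ O), hZ2, right_mem_jn L C (σ O)⟩
  · rw [hβO]; exact ⟨_, left_mem_jn L D O, right_mem_jn L D O, hZ1⟩
  · rw [Equiv.Perm.mul_apply, hβO, hαO]

/-- A finite Fano plane of order `2 ^ r` has coordinates over an abelian group of exponent two. -/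
theorem exists_coord (hF : FanoPlane (P := P) L) {r : ℕ}
    (hr : ProjectivePlane.order P L = 2 ^ r) {l : L} {P0 P1 P2 O : P} (h0 : P0 ∈ l) (h1 : P1 ∈ l)
    (h2 : P2 ∈ l) (h01 : P0 ≠ P1) (h02 : P0 ≠ P2) (h12 : P1 ≠ P2) (hO : O ∉ l) :
    ∃ (D : Type u) (_ : AddCommGroup D) (_ : Finite D) (K : Coord l P0 P1 P2 D),
      K.pt 0 = O ∧ ∀ x : D, x + x = 0 := by
  let _ : CommGroup (Tr (P := P) l) :=
    { (inferInstance : Group (Tr (P := P) l)) with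
      mul_comm := fun a b => Subtype.ext (Tr.commute hF a.2 b.2) }
  let V := Additive (Tr (P := P) l)
  let E : {C : P // C ∈ l} → AddSubgroup V := fun C =>
    Subgroup.toAddSubgroup ((El C.2).subgroupOf (Tr l))
  have mE : ∀ C (v : V), v ∈ E C ↔ IsElat C.1 l v.toMul.1 := fun C v => Iff.rfl
  obtain ⟨p, M, hp2, hp, hM0, hM1⟩ := exists_spread_coord E
    (fun i j hij v hi hj => congrArg Additive.ofMul (Subtype.ext
      (IsElat.eq_one_of_ne ((mE _ _).1 hi) ((mE _ _).1 hj) fun e => hij (Subtype.ext e))))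
    (fun i j hij v => by
      obtain ⟨α, hα, β, hβ, e⟩ := exists_decomp hF hr i.2 j.2 (fun e => hij (Subtype.ext e))
        v.toMul.2
      exact ⟨Additive.ofMul ⟨α, ⟨_, hα⟩⟩, hα, Additive.ofMul ⟨β, ⟨_, hβ⟩⟩, hβ,
        congrArg Additive.ofMul (Subtype.ext e)⟩)
    (i0 := ⟨P0, h0⟩) (i1 := ⟨P1, h1⟩) (i2 := ⟨P2, h2⟩)
    (fun e => h01 (congrArg Subtype.val e)) (fun e => h02 (congrArg Subtype.val e))
    (fun e => h12 (congrArg Subtype.val e))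
  have hfin : Finite V := inferInstanceAs (Finite (Tr (P := P) l))
  let f : V → P := fun v => v.toMul.1 O
  have foff : ∀ v, f v ∉ l := fun v => off_axis (fun X hX => Tr.fix v.toMul.2 hX) hO
  have fadd : ∀ v w : V, w.toMul.1 (f v) = f (v + w) := fun v w => by
    rw [add_comm]; rfl
  have finj : Function.Injective f := fun v w h =>
    congrArg Additive.ofMul (Subtype.ext (Tr.ext v.toMul.2 w.toMul.2 hO h))
  have fcoll : ∀ C : {C : P // C ∈ l}, ∀ v w : V, Coll L C.1 (f v) (f w) ↔ w - v ∈ E C := by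
    intro C v w
    have e : (w - v).toMul.1 (f v) = f w := by rw [fadd, add_sub_cancel]
    rw [mE, ← e]
    exact ⟨fun h => Tr.isElat (w - v).toMul.2 C.2 (foff v) h, fun h => h.coll _⟩
  refine ⟨E ⟨P1, h1⟩, inferInstance, inferInstance,
    { pt := fun v => f (p v)
      M := fun C => if h : C ∈ l then M ⟨C, h⟩ else 0
      inj := finj.comp p.injective
      off := fun v => foff _
      surj := fun X hX => ?_
      coll := fun C hC hC2 v w => ?_
      coll_vert := fun v w => ?_
      M_id := by simpa [h0] using hM0
      M_zero := by simpa [h1] using hM1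
      trans := fun w => ⟨(p w).toMul.1, (p w).toMul.2, fun v => ?_⟩ }, ?_, fun x => ?_⟩
  · obtain ⟨σ, hσ, e⟩ := exists_translation hF hr hO hX
    refine ⟨p.symm (Additive.ofMul ⟨σ, hσ⟩), ?_⟩
    rw [p.apply_symm_apply]
    exact e
  · rw [fcoll ⟨C, hC⟩, ← map_sub, hp _ (fun e => hC2 (congrArg Subtype.val e)), dif_pos hC]
    rfl
  · rw [fcoll ⟨P2, h2⟩, ← map_sub, hp2, eq_comm (a := v.1)]
    exact sub_eq_zero
  · rw [fadd, map_add]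
  · change f (p 0) = O
    rw [map_zero]; rfl
  · exact Subtype.ext (congrArg Additive.ofMul (Subtype.ext (Tr.sq hF x.1.toMul.2)))

end Coord

/-! ## Slopes -/

section Slopes

universe u

variable {P : Type u} {L : Type*} [Membership P L] [ProjectivePlane P L] [Fintype P] [Fintype L]
  {D : Type*} [AddCommGroup D] {l : L} {P0 P1 P2 : P}

namespace Coord

variable (K : Coord l P0 P1 P2 D)

lemma ne_pt {C : P} (hC : C ∈ l) (v : D × D) : C ≠ K.pt v := fun e => K.off v (e ▸ hC)

lemma jn_left_ne (C : P) (v : D × D) : jn L C (K.pt v) ≠ l := fun e =>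
  K.off v ((congrArg (K.pt v ∈ ·) e).mp (right_mem_jn _ _ _))

lemma jn_right_ne (C : P) (v : D × D) : jn L (K.pt v) C ≠ l := fun e =>
  K.off v ((congrArg (K.pt v ∈ ·) e).mp (left_mem_jn _ _ _))

lemma coll_zero {C : P} (hC : C ∈ l) (hC2 : C ≠ P2) (v : D × D) :
    Coll L C (K.pt 0) (K.pt v) ↔ K.M C v.1 = v.2 := by
  rw [K.coll C hC hC2, Prod.fst_zero, Prod.snd_zero, sub_zero, sub_zero, eq_comm]

lemma coll_horizontal (h1 : P1 ∈ l) (h12 : P1 ≠ P2) (v w : D × D) :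
    Coll L P1 (K.pt v) (K.pt w) ↔ v.2 = w.2 := by
  rw [K.coll P1 h1 h12, K.M_zero, AddMonoidHom.zero_apply, sub_eq_zero, eq_comm]

lemma exists_additive {g : Equiv.Perm P} (hg : g ∈ Col P L) (hgl : ∀ X, g X ∈ l ↔ X ∈ l)
    (hO : g (K.pt 0) = K.pt 0) :
    ∃ A : D × D →+ D × D, ∀ v, g (K.pt v) = K.pt (A v) := by
  have ex : ∀ v, ∃ w, K.pt w = g (K.pt v) := fun v => K.surj _ fun h => K.off v ((hgl _).1 h)
  choose A hA using ex
  refine ⟨AddMonoidHom.mk' A fun v w => K.inj ?_, fun v => (hA v).symm⟩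
  obtain ⟨τ, hτ, hτ'⟩ := K.trans w
  obtain ⟨ρ, hρ, hρ'⟩ := K.trans (A w)
  have hc : g * τ * g⁻¹ ∈ Tr l := ⟨_, hτ.choose_spec.conj hg hgl⟩
  have e1 : ∀ X, (g * τ * g⁻¹) (g X) = g (τ X) := fun X =>
    congrArg (fun Y => g (τ Y)) (g.symm_apply_apply X)
  have e : g * τ * g⁻¹ = ρ := Tr.ext hc hρ (K.off 0) <| by
    rw [hρ', zero_add, hA]
    nth_rewrite 1 [← hO]
    rw [e1, hτ', zero_add]
  rw [hA, ← hτ', ← e1, e, ← hA v, hρ']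

lemma exists_slope {x : D} (hx : x ≠ 0) (y : D) : ∃ C ∈ l, C ≠ P2 ∧ K.M C x = y := by
  have h : Coll L (mt (jn L (K.pt 0) (K.pt (x, y))) l) (K.pt 0) (K.pt (x, y)) :=
    ⟨jn L (K.pt 0) (K.pt (x, y)), mt_mem_left _ _, by simp, by simp⟩
  have hne : mt (jn L (K.pt 0) (K.pt (x, y))) l ≠ P2 := fun e => hx <| by
    rw [e, K.coll_vert] at h
    exact h.symm
  exact ⟨_, mt_mem_right _ _, hne, (K.coll_zero (mt_mem_right _ _) hne (x, y)).1 h⟩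

lemma slope_unique {x : D} (hx : x ≠ 0) {C C' : P} (hC : C ∈ l) (hC' : C' ∈ l) (hC2 : C ≠ P2)
    (hC2' : C' ≠ P2) (h : K.M C x = K.M C' x) : C = C' := by
  have h1 := (K.coll_zero hC hC2 (x, K.M C x)).2 rfl
  have h2 := (K.coll_zero hC' hC2' (x, K.M C x)).2 h.symm
  have hne : K.pt 0 ≠ K.pt (x, K.M C x) := fun e => hx (congrArg Prod.fst (K.inj e)).symm
  have hm := K.jn_left_ne (K.pt 0) (x, K.M C x)
  exact pt_ext hm ((coll_iff hne).1 h1.rot) hC ((coll_iff hne).1 h2.rot) hC'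

lemma slope_map {g : Equiv.Perm P} (hg : g ∈ Col P L) (hgl : ∀ X, g X ∈ l ↔ X ∈ l)
    {A : D × D →+ D × D} (hA : ∀ v, g (K.pt v) = K.pt (A v)) {C : P} (hC : C ∈ l) (hC2 : C ≠ P2)
    (hg2 : g C ≠ P2) (v : D × D) : K.M (g C) (A v).1 = (A v).2 ↔ K.M C v.1 = v.2 := by
  rw [← K.coll_zero hC hC2, ← hg, hA, hA, map_zero, K.coll_zero ((hgl C).2 hC) hg2]

lemma _root_.PlaneArcs.IsElat.mem_iff_of_mem {C : P} {k : L} {σ : Equiv.Perm P}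
    (h : IsElat C k σ) {m : L} (hm : C ∈ m) (X : P) : σ X ∈ m ↔ X ∈ m :=
  ⟨fun hX => by simpa using h.inv.mem_line hm hX, fun hX => h.mem_line hm hX⟩

lemma exists_M_add (hF : FanoPlane (P := P) L) {r : ℕ}
    (hr : ProjectivePlane.order P L = 2 ^ r) (h1 : P1 ∈ l) (h2 : P2 ∈ l) (h12 : P1 ≠ P2)
    {C C' : P} (hC : C ∈ l) (hC2 : C ≠ P2) (hC' : C' ∈ l) (hC2' : C' ≠ P2) :
    ∃ B ∈ l, B ≠ P2 ∧ ∀ x, K.M B x = K.M C x + K.M C' x := by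
  have hk2 := left_mem_jn L P2 (K.pt 0)
  have hkO := right_mem_jn L P2 (K.pt 0)
  have hk := K.jn_left_ne P2 0
  have off : ∀ X ∈ l, X ≠ P2 → X ∉ jn L P2 (K.pt 0) := fun X hX hX2 h =>
    hX2 (pt_ext hk h hX hk2 h2)
  obtain ⟨g, hg, hgC⟩ := exists_translation hF hr (off P1 h1 h12) (off C hC hC2)
  have hge : IsElat P2 (jn L P2 (K.pt 0)) g := Tr.isElat hg hk2 (off P1 h1 h12)
    ⟨l, h2, h1, hgC ▸ hC⟩
  have hgl := hge.mem_iff_of_mem h2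
  obtain ⟨A, hA⟩ := K.exists_additive hge.col hgl (hge.fix _ hkO)
  have hgP2 : g P2 = P2 := hge.fix _ hk2
  have A0 : ∀ y, A (0, y) = (0, y) := fun y => K.inj <| by
    rw [← hA]
    refine hge.fix _ ((coll_iff_mem (K.ne_pt h2 0) hk2 hkO).1 ?_)
    rw [K.coll_vert, Prod.fst_zero]
  have A1 : ∀ v, (A v).1 = v.1 := fun v => by
    have := hge.coll (K.pt v)
    rw [hA, K.coll_vert] at this
    exact this.symm
  have A2 : ∀ x, (A (x, 0)).2 = K.M C x := fun x => by
    have := (K.slope_map hge.col hgl hA h1 h12 (hgC ▸ hC2) (x, 0)).2 (by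
      rw [K.M_zero]; rfl)
    rw [hgC, A1] at this
    exact this.symm
  refine ⟨g C', (hgl _).2 hC', fun e => hC2' (g.injective (e.trans hgP2.symm)), fun x => ?_⟩
  have := (K.slope_map hge.col hgl hA hC' hC2' (fun e => hC2' (g.injective (e.trans hgP2.symm)))
    (x, K.M C' x)).2 rfl
  rw [A1] at this
  rw [this, show (x, K.M C' x) = (x, 0) + (0, K.M C' x) by simp, map_add, A0, Prod.snd_add, A2]

lemma exists_M_left (hF : FanoPlane (P := P) L) {r : ℕ}
    (hr : ProjectivePlane.order P L = 2 ^ r) (h0 : P0 ∈ l) (h1 : P1 ∈ l) (h2 : P2 ∈ l)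
    (h01 : P0 ≠ P1) (h02 : P0 ≠ P2) (h12 : P1 ≠ P2)
    {C : P} (hC : C ∈ l) (hC2 : C ≠ P2) (hC0 : C ≠ P0) :
    ∃ B ∈ l, B ≠ P2 ∧ ∀ x, K.M B (x + K.M C x) = K.M C x := by
  have hk1 := left_mem_jn L P1 (K.pt 0)
  have hkO := right_mem_jn L P1 (K.pt 0)
  have hk := K.jn_left_ne P1 0
  have off : ∀ X ∈ l, X ≠ P1 → X ∉ jn L P1 (K.pt 0) := fun X hX hX2 h =>
    hX2 (pt_ext hk h hX hk1 h1)
  obtain ⟨g, hg, hgP⟩ := exists_translation hF hr (off P2 h2 h12.symm) (off P0 h0 h01)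
  have hge : IsElat P1 (jn L P1 (K.pt 0)) g := Tr.isElat hg hk1 (off P2 h2 h12.symm)
    ⟨l, h1, h2, hgP ▸ h0⟩
  have hgl := hge.mem_iff_of_mem h1
  obtain ⟨A, hA⟩ := K.exists_additive hge.col hgl (hge.fix _ hkO)
  have A0 : ∀ x, A (x, 0) = (x, 0) := fun x => K.inj <| by
    rw [← hA]
    refine hge.fix _ ((coll_iff_mem (K.ne_pt h1 0) hk1 hkO).1 ?_)
    rw [K.coll_horizontal h1 h12, Prod.snd_zero]
  have A2 : ∀ v, (A v).2 = v.2 := fun v => by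
    have := hge.coll (K.pt v)
    rw [hA, K.coll_horizontal h1 h12] at this
    exact this.symm
  have A1 : ∀ y, (A (0, y)).1 = y := fun y => by
    have := (K.coll_vert 0 (0, y)).2 rfl
    rw [← hge.col, hgP, hA, hA, map_zero, K.coll_zero h0 h02, K.M_id, A2] at this
    exact this
  have hgC : g C ≠ P2 := fun e => hC0 <| by
    have := congrArg (fun σ : Equiv.Perm P => σ C) (Tr.sq hF hg)
    simp only [Equiv.Perm.mul_apply, e, hgP, Equiv.Perm.one_apply] at this
    exact this.symm
  refine ⟨g C, (hgl _).2 hC, hgC, fun x => ?_⟩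
  have := (K.slope_map hge.col hgl hA hC hC2 hgC (x, K.M C x)).2 rfl
  rw [A2, show (x, K.M C x) = (x, 0) + (0, K.M C x) by simp, map_add, A0, Prod.fst_add, A1] at this
  simpa using this

lemma exists_M_right (hF : FanoPlane (P := P) L) {r : ℕ}
    (hr : ProjectivePlane.order P L = 2 ^ r) (h1 : P1 ∈ l) (h2 : P2 ∈ l) (h12 : P1 ≠ P2)
    {e x : D} (he : e ≠ 0) (hxe : x ≠ e) :
    ∃ x', ∀ C ∈ l, C ≠ P2 → ∀ B ∈ l, B ≠ P2 → K.M B e = - K.M C x →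
      K.M C x' - K.M C x = K.M B x' := by
  have hk2 := left_mem_jn L P2 (K.pt 0)
  have hkO := right_mem_jn L P2 (K.pt 0)
  have hk := K.jn_left_ne P2 0
  have hkv : ∀ v, K.pt v ∈ jn L P2 (K.pt 0) ↔ v.1 = 0 := fun v => by
    rw [← coll_iff_mem (K.ne_pt h2 0) hk2 hkO, K.coll_vert, Prod.fst_zero, eq_comm]
  have off : P1 ∉ jn L P2 (K.pt 0) := fun h => h12 (pt_ext hk h h1 hk2 h2)
  obtain ⟨g, hg, hgP⟩ := exists_translation hF hr off (fun h => he ((hkv (e, 0)).1 h))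
  have hge : IsElat (K.pt 0) (jn L P2 (K.pt 0)) g := Tr.isElat hg hkO off (by
    rw [hgP]; exact ((K.coll_horizontal h1 h12 0 (e, 0)).2 rfl).swap)
  have hgP2 : g P2 = P2 := hge.fix _ hk2
  have hgg : ∀ X, g (g X) = X := fun X =>
    congrArg (fun σ : Equiv.Perm P => σ X) (Tr.sq hF hg)
  by_cases hx : x = 0
  · subst hx
    exact ⟨0, fun C _ _ B _ _ _ => by simp⟩
  have hX0 : g (K.pt (x, 0)) ∈ jn L (K.pt 0) P1 :=
    hge.mem_line (left_mem_jn _ _ _) <| (coll_iff_mem (K.ne_pt h1 0) (right_mem_jn _ _ _)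
      (left_mem_jn _ _ _)).1 ((K.coll_horizontal h1 h12 0 (x, 0)).2 rfl)
  have hX0' : g (K.pt (x, 0)) ∉ l := fun h => hxe <| by
    have h3 := pt_ext (K.jn_right_ne P1 0) hX0 h (right_mem_jn _ _ _) h1
    have h4 := hgg (K.pt (x, 0))
    rw [h3, hgP] at h4
    exact (congrArg Prod.fst (K.inj h4)).symm
  obtain ⟨v, hv⟩ := K.surj _ hX0'
  refine ⟨v.1, fun C hC hC2 B hB hB2 hBC => ?_⟩
  set w := K.M C x with hw
  have h3 : Coll L P2 (g (K.pt (x, 0))) (g (K.pt (x, w))) := by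
    have := (hge.col _ _ _).2 ((K.coll_vert (x, 0) (x, w)).2 rfl)
    rwa [hgP2] at this
  have hY : g (K.pt (x, w)) ∉ l := fun h => by
    rw [← hv, coll_iff_mem (K.ne_pt h2 v) (left_mem_jn _ _ _) (right_mem_jn _ _ _)] at h3
    have h4 := pt_ext (K.jn_left_ne P2 v) h3 h (left_mem_jn _ _ _) h2
    exact K.ne_pt h2 (x, w) (g.injective (hgP2.trans h4.symm))
  obtain ⟨y, hy⟩ := K.surj _ hY
  rw [← hv, ← hy, K.coll_vert] at h3
  have h4 : Coll L C (K.pt 0) (K.pt (x, w)) := (K.coll_zero hC hC2 _).2 rfl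
  rw [coll_iff_mem (K.ne_pt hC 0) (left_mem_jn _ _ _) (right_mem_jn _ _ _)] at h4
  have h5 := hge.mem_line (right_mem_jn _ _ _) h4
  rw [← hy, ← coll_iff_mem (K.ne_pt hC 0) (left_mem_jn _ _ _) (right_mem_jn _ _ _),
    K.coll_zero hC hC2, ← h3] at h5
  have h6 := (K.coll_horizontal h1 h12 (x, w) (0, w)).2 rfl
  rw [← hge.col, hgP, ← hy, hge.fix _ ((hkv (0, w)).2 rfl)] at h6
  have h7 : Coll L B (K.pt (0, w)) (K.pt (e, 0)) := by
    rw [K.coll B hB hB2, sub_zero, zero_sub, hBC]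
  have h8 : K.pt (0, w) ≠ K.pt (e, 0) := fun h => he (congrArg Prod.fst (K.inj h)).symm
  obtain ⟨m, m1, m2, m3⟩ := h7
  have h9 := (coll_iff_mem h8 m2 m3).1 h6.rot.rot
  have h10 := (K.coll B hB hB2 (0, w) y).1 ⟨m, m1, m2, h9⟩
  rw [h5, h3]
  simpa using h10

end Coord

end Slopes

/-! ## The coordinate field -/

section FieldCoord

universe u

variable {P : Type u} {L : Type*} [Membership P L] [ProjectivePlane P L] [Fintype P] [Fintype L]

/-- Field coordinates for the affine plane obtained by deleting the line `l`. -/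
structure FieldCoord (l : L) (P2 : P) (D : Type*) [Field D] where
  pt : D × D → P
  slope : D → P
  inj : Function.Injective pt
  off : ∀ v, pt v ∉ l
  surj : ∀ X ∉ l, ∃ v, pt v = X
  slope_mem : ∀ a, slope a ∈ l
  slope_ne : ∀ a, slope a ≠ P2
  slope_surj : ∀ C ∈ l, C ≠ P2 → ∃ a, slope a = C
  coll : ∀ a v w, Coll L (slope a) (pt v) (pt w) ↔ w.2 - v.2 = a * (w.1 - v.1)
  coll_vert : ∀ v w, Coll L P2 (pt v) (pt w) ↔ v.1 = w.1

theorem exists_fieldCoord (hF : FanoPlane (P := P) L) {r : ℕ}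
    (hr : ProjectivePlane.order P L = 2 ^ r) {l : L} {P2 : P} (h2 : P2 ∈ l) :
    ∃ (D : Type u) (_ : Field D), Nonempty (FieldCoord l P2 D) := by
  obtain ⟨P0, h0, h02, -⟩ := exists_mem_ne_ne l P2 P2
  obtain ⟨P1, h1, h12, h10⟩ := exists_mem_ne_ne l P2 P0
  obtain ⟨n, hPn, hnl, -⟩ := exists_line_ne_ne P2 l l
  obtain ⟨O, hOn, hOP, -⟩ := exists_mem_ne_ne n P2 P2
  have hO : O ∉ l := fun e => hOP (pt_ext hnl hOn e hPn h2)
  obtain ⟨D, iD, iF, K, -, hD⟩ := exists_coord hF hr h0 h1 h2 h10.symm h02 h12 hO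
  have neg : ∀ x : D, -x = x := fun x => neg_eq_of_add_eq_zero_left (hD x)
  have hnt : ∃ e : D, e ≠ 0 := by
    by_contra! h
    have hA : ∀ X, X ∉ l → X = K.pt 0 := fun X hX => by
      obtain ⟨v, rfl⟩ := K.surj X hX
      exact congrArg K.pt (Prod.ext (h v.1) (h v.2))
    obtain ⟨Y, hYn, hYP, hYO⟩ := exists_mem_ne_ne n P2 O
    exact hYO ((hA Y fun e => hYP (pt_ext hnl hYn e hPn h2)).trans (hA O hO).symm)
  obtain ⟨e, he⟩ := hnt
  have hs := fun a => K.exists_slope he a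
  choose s sl s2 se using hs
  have suniq : ∀ {C}, C ∈ l → C ≠ P2 → s (K.M C e) = C := fun hC hC2 =>
    K.slope_unique he (sl _) hC (s2 _) hC2 (se _)
  have sadd : ∀ a b x, K.M (s (a + b)) x = K.M (s a) x + K.M (s b) x := fun a b x => by
    obtain ⟨B, hB, hB2, h⟩ := K.exists_M_add hF hr h1 h2 h12 (sl a) (s2 a) (sl b) (s2 b)
    have := h e
    rw [se, se] at this
    rw [← this, suniq hB hB2, h]
  have s0 : s 0 = P1 := by
    rw [← suniq h1 h12, K.M_zero]; rfl
  have s1 : s e = P0 := by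
    have := suniq h0 h02
    rwa [K.M_id] at this
  let R : NonAssocRing D :=
    { iD with
      mul := fun a b => K.M (s a) b
      one := e
      left_distrib := fun a b c => map_add (K.M (s a)) b c
      right_distrib := fun a b c => sadd a b c
      zero_mul := fun a => by change K.M (s 0) a = 0; rw [s0, K.M_zero]; rfl
      mul_zero := fun a => map_zero (K.M (s a))
      one_mul := fun a => by change K.M (s e) a = a; rw [s1, K.M_id]; rfl
      mul_one := fun a => se a }
  have nz : NoZeroDivisors D := ⟨fun {a b} h => by
    by_contra! hab
    refine hab.1 ?_
    have h' : K.M (s a) b = K.M P1 b := by rw [K.M_zero]; exact h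
    have := K.slope_unique hab.2 (sl a) h1 (s2 a) h12 h'
    rw [← se a, this, K.M_zero]; rfl⟩
  have nt : Nontrivial D := ⟨e, 0, he⟩
  have hl := left_alternative (D := D) hD fun a ha => by
    obtain ⟨B, hB, hB2, h⟩ := K.exists_M_left hF hr h0 h1 h2 h10.symm h02 h12 (sl a) (s2 a)
      (fun e' => ha (by rw [← se a, e', K.M_id]; rfl))
    refine ⟨K.M B e, fun u => ?_⟩
    change K.M (s (K.M B e)) (u + K.M (s a) u) = K.M (s a) u
    rw [suniq hB hB2, h]
  have hr' := right_alternative (D := D) hD fun a ha => by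
    obtain ⟨x', h⟩ := K.exists_M_right hF hr h1 h2 h12 he ha
    refine ⟨x', fun u => ?_⟩
    have := h (s u) (sl u) (s2 u) (s (K.M (s u) a)) (sl _) (s2 _) (by rw [se, neg])
    change K.M (s (u + K.M (s u) a)) x' = K.M (s u) a
    rw [sadd, ← this, ← add_sub_assoc, hD, zero_sub, neg]
  let C : CommRing D :=
    { R with
      mul_assoc := mul_assoc_of_alternative hD hl hr'
      mul_comm := mul_comm_of_alternative hD hl hr' }
  have : IsDomain D := NoZeroDivisors.to_isDomain D
  have : IsField D := Finite.isDomain_to_isField D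
  let Fi : Field D := this.toField
  refine ⟨D, Fi, ⟨⟨K.pt, s, K.inj, K.off, K.surj, sl, s2, fun C hC hC2 => ⟨_, suniq hC hC2⟩,
    fun a v w => K.coll _ (sl a) (s2 a) v w, K.coll_vert⟩⟩⟩

end FieldCoord

/-! ## The coordinate isomorphism -/

section Iso

universe u

variable {P : Type u} {L : Type*} [Membership P L] [ProjectivePlane P L] [Fintype P] [Fintype L]

section LineMap

variable {P' L' : Type*} [Membership P' L'] [ProjectivePlane P' L'] [Fintype P'] [Fintype L']

/-- A bijection between planes of the same order mapping lines into lines maps lines onto lines. -/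
lemma image_line_iff (ho : ProjectivePlane.order P L = ProjectivePlane.order P' L') (e : P ≃ P')
    (he : ∀ l : L, ∃ m : L', ∀ x ∈ l, e x ∈ m) (S : Set P) :
    (∃ l : L, S = {x | x ∈ l}) ↔ ∃ m : L', e '' S = {x | x ∈ m} := by
  have key : ∀ (l : L) (m : L'), (∀ x ∈ l, e x ∈ m) → e '' {x | x ∈ l} = {x | x ∈ m} := by
    intro l m h
    refine Set.eq_of_subset_of_ncard_le (by rintro _ ⟨x, hx, rfl⟩; exact h x hx) ?_
    have h1 := card_line (P := P) l
    have h2 := card_line (P := P') m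
    rw [Set.ncard_image_of_injective _ e.injective, Set.ncard_eq_toFinset_card',
      Set.ncard_eq_toFinset_card', Set.toFinset_ofPred, Set.toFinset_ofPred, h1, h2, ho]
  constructor
  · rintro ⟨l, rfl⟩
    obtain ⟨m, hm⟩ := he l
    exact ⟨m, key l m hm⟩
  · rintro ⟨m, hm⟩
    obtain ⟨a, ha, -, -⟩ := exists_mem_ne_ne m (mt m m) (mt m m)
    obtain ⟨b, hb, hba, -⟩ := exists_mem_ne_ne m a a
    obtain ⟨m', hm'⟩ := he (jn L (e.symm a) (e.symm b))
    have ha' : a ∈ m' := by simpa using hm' _ (left_mem_jn _ _ _)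
    have hb' : b ∈ m' := by simpa using hm' _ (right_mem_jn _ _ _)
    have hmm : m' = m := line_ext hba hb' ha' hb ha
    exact ⟨jn L (e.symm a) (e.symm b),
      e.injective.image_injective (hm.trans (key _ _ (hmm ▸ hm')).symm)⟩

end LineMap

namespace FieldCoord

variable {D : Type*} [Field D] {l : L} {P2 : P}

/-- Transport of field coordinates along a ring isomorphism. -/
def map (K : FieldCoord l P2 D) {F : Type*} [Field F] (φ : F ≃+* D) : FieldCoord l P2 F where
  pt v := K.pt (φ v.1, φ v.2)
  slope a := K.slope (φ a)
  inj v w h := by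
    have := K.inj h
    exact Prod.ext (φ.injective (congrArg Prod.fst this)) (φ.injective (congrArg Prod.snd this))
  off v := K.off _
  surj X hX := by
    obtain ⟨v, rfl⟩ := K.surj X hX
    exact ⟨(φ.symm v.1, φ.symm v.2), by simp⟩
  slope_mem a := K.slope_mem _
  slope_ne a := K.slope_ne _
  slope_surj C hC hC2 := by
    obtain ⟨a, rfl⟩ := K.slope_surj C hC hC2
    exact ⟨φ.symm a, by simp⟩
  coll a v w := by
    rw [K.coll, ← map_sub, ← map_sub, ← map_mul, φ.injective.eq_iff]
  coll_vert v w := by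
    rw [K.coll_vert, φ.injective.eq_iff]

variable (K : FieldCoord l P2 D)

include K in
lemma card_eq : Nat.card D = ProjectivePlane.order P L := by
  have h := card_affine (P := P) l
  have e : D × D ≃ ({X | X ∉ l} : Set P) := Equiv.ofBijective (fun v => ⟨K.pt v, K.off v⟩)
    ⟨fun v w h => K.inj (congrArg Subtype.val h), fun X => by
      obtain ⟨v, hv⟩ := K.surj X.1 X.2
      exact ⟨v, Subtype.ext hv⟩⟩
  rw [← Nat.card_congr e, Nat.card_prod, ← sq] at h
  exact Nat.pow_left_injective (n := 2) (by norm_num) h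

lemma slope_inj : Function.Injective K.slope := fun a b h => by
  have h1 := (K.coll a 0 (1, a)).2 (by simp)
  rw [h, K.coll] at h1
  simpa using h1

/-- Points as affine points, slopes and the vertical direction. -/
noncomputable def ptEquiv (h2 : P2 ∈ l) : (D × D) ⊕ D ⊕ Unit ≃ P :=
  Equiv.ofBijective (Sum.elim K.pt (Sum.elim K.slope fun _ => P2)) <| by
    constructor
    · have h3 : ∀ v a, K.pt v ≠ K.slope a := fun v a h =>
      K.off v ((congrArg (· ∈ l) h).mpr (K.slope_mem a))
      have h4 : ∀ v, K.pt v ≠ P2 := fun v h => K.off v ((congrArg (· ∈ l) h).mpr h2)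
      rintro (v | a | ⟨⟩) (w | b | ⟨⟩) h
      · rw [K.inj h]
      · exact (h3 _ _ h).elim
      · exact (h4 _ h).elim
      · exact (h3 _ _ h.symm).elim
      · rw [K.slope_inj h]
      · exact (K.slope_ne _ h).elim
      · exact (h4 _ h.symm).elim
      · exact (K.slope_ne _ h.symm).elim
      · rfl
    · intro X
      by_cases hX : X ∈ l
      · by_cases hX2 : X = P2
        · exact ⟨.inr (.inr ()), hX2.symm⟩
        · obtain ⟨a, rfl⟩ := K.slope_surj X hX hX2
          exact ⟨.inr (.inl a), rfl⟩
      · obtain ⟨v, rfl⟩ := K.surj X hX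
        exact ⟨.inl v, rfl⟩

/-- Homogeneous coordinates. -/
def vec : (D × D) ⊕ D ⊕ Unit → Fin 3 → D
  | .inl v => ![1, v.1, v.2]
  | .inr (.inl a) => ![0, 1, a]
  | .inr (.inr _) => ![0, 0, 1]

lemma vec_ne_zero (t : (D × D) ⊕ D ⊕ Unit) : vec t ≠ 0 := by
  rcases t with v | a | ⟨⟩
  · exact fun h => one_ne_zero (congrFun h 0)
  · exact fun h => one_ne_zero (congrFun h 1)
  · exact fun h => one_ne_zero (congrFun h 2)

lemma mk_vec_injective :
    Function.Injective fun t : (D × D) ⊕ D ⊕ Unit => Projectivization.mk D (vec t) (vec_ne_zero t) := by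
  intro s t h
  rw [Projectivization.mk_eq_mk_iff'] at h
  obtain ⟨c, h⟩ := h
  have e0 := congrFun h 0
  have e1 := congrFun h 1
  have e2 := congrFun h 2
  rcases s with ⟨x, y⟩ | a | ⟨⟩ <;> rcases t with ⟨x', y'⟩ | a' | ⟨⟩ <;> 
    simp_all [vec]

lemma exists_line_eq (h2 : P2 ∈ l) (m : L) : ∃ w : Fin 3 → D, w ≠ 0 ∧
    ∀ t, K.ptEquiv h2 t ∈ m → w ⬝ᵥ vec t = 0 := by
  have hp : ∀ v, K.ptEquiv h2 (.inl v) = K.pt v := fun v => rfl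
  have hs : ∀ a, K.ptEquiv h2 (.inr (.inl a)) = K.slope a := fun a => rfl
  have hv : K.ptEquiv h2 (.inr (.inr ())) = P2 := rfl
  by_cases hml : m = l
  · subst hml
    refine ⟨![1, 0, 0], fun h => one_ne_zero (congrFun h 0), ?_⟩
    rintro (v | a | ⟨⟩) h
    · exact (K.off v h).elim
    · simp [vec]
    · simp [vec]
  have hmt := mt_mem_right (P := P) m l
  have hmt' := mt_mem_left (P := P) m l
  obtain ⟨Y, hY, hYm, -⟩ := exists_mem_ne_ne (P := P) m (mt m l) (mt m l)
  obtain ⟨u, rfl⟩ := K.surj Y fun h => hYm (pt_ext hml hY h hmt' hmt)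
  by_cases hm2 : P2 ∈ m
  · refine ⟨![u.1, -1, 0], fun h => one_ne_zero (neg_eq_zero.1 (congrFun h 1)), ?_⟩
    rintro (v | a | ⟨⟩) h
    · have := (K.coll_vert u v).1 ⟨m, hm2, hY, h⟩
      simp [vec, this]
    · exact (K.slope_ne a (pt_ext hml h (K.slope_mem a) hm2 h2)).elim
    · simp [vec]
  · obtain ⟨a, ha⟩ := K.slope_surj _ hmt fun h => hm2 ((congrArg (· ∈ m) h).mp hmt')
    have ham : K.slope a ∈ m := ha ▸ hmt'
    refine ⟨![u.2 - a * u.1, a, -1], fun h => one_ne_zero (neg_eq_zero.1 (congrFun h 2)), ?_⟩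
    rintro (v | b | ⟨⟩) h
    · have := (K.coll a u v).1 ⟨m, ham, hY, h⟩
      simp [vec]
      linear_combination - this
    · have := K.slope_inj (pt_ext hml h (K.slope_mem b) ham (K.slope_mem a))
      simp [vec, this]
    · exact (hm2 h).elim

end FieldCoord

open scoped LinearAlgebra.Projectivization

lemma order_proj (F : Type*) [Field F] [Fintype F] [Fintype (ℙ F (Fin 3 → F))] :
    ProjectivePlane.order (ℙ F (Fin 3 → F)) (ℙ F (Fin 3 → F)) = Fintype.card F := by
  have h1 := ProjectivePlane.card_points (ℙ F (Fin 3 → F)) (ℙ F (Fin 3 → F))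
  have h2 := Projectivization.card_of_finrank F (Fin 3 → F) (n := 3) (by simp)
  rw [Nat.card_eq_fintype_card, h1, Nat.card_eq_fintype_card] at h2
  simp [Finset.sum_range_succ] at h2
  nlinarith

theorem exists_equiv_proj (hF : FanoPlane (P := P) L) {r : ℕ}
    (hr : ProjectivePlane.order P L = 2 ^ r) (F : Type*) [Field F] [Fintype F]
    (hFc : Fintype.card F = ProjectivePlane.order P L) :
    ∃ e : P ≃ ℙ F (Fin 3 → F), ∀ S : Set P, (∃ l : L, S = {x | x ∈ l}) ↔
      ∃ m : ℙ F (Fin 3 → F), e '' S = {x | x ∈ m} := by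
  have : Fintype (ℙ F (Fin 3 → F)) := Fintype.ofFinite _
  obtain ⟨p, -, -, l, -⟩ := ProjectivePlane.exists_config (P := P) (L := L)
  have h2 := mt_mem_left (P := P) l l
  obtain ⟨D, iD, ⟨K⟩⟩ := exists_fieldCoord hF hr h2
  have hc := K.card_eq
  have : Finite D := Nat.finite_of_card_ne_zero (by rw [hc, hr]; positivity)
  have : Fintype D := Fintype.ofFinite _
  let K' := K.map (FiniteField.ringEquivOfCardEq (K := F) (K' := D) (by
    rw [hFc, ← hc, Nat.card_eq_fintype_card]))
  have ho : ProjectivePlane.order P L =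
    ProjectivePlane.order (ℙ F (Fin 3 → F)) (ℙ F (Fin 3 → F)) := by rw [order_proj, hFc]
  let f := fun x : P => Projectivization.mk F (FieldCoord.vec ((K'.ptEquiv h2).symm x))
    (FieldCoord.vec_ne_zero _)
  have hf : Function.Bijective f := by
    rw [Fintype.bijective_iff_injective_and_card]
    refine ⟨FieldCoord.mk_vec_injective.comp (K'.ptEquiv h2).symm.injective, ?_⟩
    rw [ProjectivePlane.card_points P L,
      ProjectivePlane.card_points (ℙ F (Fin 3 → F)) (ℙ F (Fin 3 → F)), ho]
  refine ⟨Equiv.ofBijective f hf, image_line_iff ho _ fun m => ?_⟩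
  obtain ⟨w, hw, h⟩ := K'.exists_line_eq h2 m
  refine ⟨Projectivization.mk F w hw, fun x hx => ?_⟩
  have := h ((K'.ptEquiv h2).symm x) (by simpa using hx)
  rw [dotProduct_comm] at this
  exact (Projectivization.orthogonal_mk _ hw).2 this

end Iso

/-! ## The two kinds of planes in the statement -/

open scoped LinearAlgebra.Projectivization

section Proj

variable {F : Type*} [Field F]

lemma exists_orthogonal_of_finrank {W : Submodule F (Fin 3 → F)} (hW : Module.finrank F W = 2) :
    ∃ w : ℙ F (Fin 3 → F), ∀ x : ℙ F (Fin 3 → F), x.submodule ≤ W ↔ x ∈ w := by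
  have hlt : W < ⊤ := lt_top_iff_ne_top.2 fun h => by
    rw [h, finrank_top] at hW
    simp at hW
  obtain ⟨f, hf, hWf⟩ := Submodule.exists_le_ker_of_lt_top W hlt
  have hker : W = LinearMap.ker f := by
    refine Submodule.eq_of_le_of_finrank_eq hWf ?_
    have := Module.Dual.finrank_ker_add_one_of_ne_zero (K := F) (f := f) hf
    rw [Module.finrank_fin_fun] at this
    omega
  let w : Fin 3 → F := fun i => f (Pi.single i 1)
  have hfw : ∀ v, f v = v ⬝ᵥ w := fun v => by
    rw [dotProduct, LinearMap.pi_apply_eq_sum_univ f v]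
    simp only [smul_eq_mul, w]
    refine Finset.sum_congr rfl fun i _ => ?_
    congr 2
    ext j
    simp [Pi.single_apply, eq_comm]
  have hw : w ≠ 0 := fun h => hf <| LinearMap.ext fun v => by rw [hfw, h, dotProduct_zero]; rfl
  refine ⟨Projectivization.mk F w hw, fun x => ?_⟩
  induction x using Projectivization.ind with
  | h v hv =>
    rw [ofField.mem_iff, Projectivization.orthogonal_mk, Projectivization.submodule_mk,
      Submodule.span_singleton_le_iff_mem, hker, LinearMap.mem_ker, hfw]

lemma exists_submodule_of_orthogonal (w : ℙ F (Fin 3 → F)) :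
    ∃ W : Submodule F (Fin 3 → F), Module.finrank F W = 2 ∧
      ∀ x : ℙ F (Fin 3 → F), x.submodule ≤ W ↔ x ∈ w := by
  induction w using Projectivization.ind with
  | h w hw =>
    let f : Module.Dual F (Fin 3 → F) := dotProductBilin F F w
    have hfw : ∀ v, f v = w ⬝ᵥ v := fun v => rfl
    have hf : f ≠ 0 := fun h => hw <| by
      ext i
      have := LinearMap.congr_fun h (Pi.single i 1)
      rw [hfw, dotProduct_single_one] at this
      exact this
    refine ⟨LinearMap.ker f, ?_, fun x => ?_⟩
    · have := Module.Dual.finrank_ker_add_one_of_ne_zero (K := F) (f := f) hf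
      rw [Module.finrank_fin_fun] at this
      omega
    · induction x using Projectivization.ind with
      | h v hv =>
        rw [ofField.mem_iff, Projectivization.orthogonal_mk, Projectivization.submodule_mk,
          Submodule.span_singleton_le_iff_mem, LinearMap.mem_ker, hfw, dotProduct_comm]

lemma mem_P2Lines {F : Type} [Field F] (S : Set (ℙ F (Fin 3 → F))) :
    S ∈ P2Lines F ↔ ∃ w : ℙ F (Fin 3 → F), S = {x | x ∈ w} := by
  constructor
  · rintro ⟨W, hW, rfl⟩
    obtain ⟨w, hw⟩ := exists_orthogonal_of_finrank hW
    exact ⟨w, Set.ext hw⟩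
  · rintro ⟨w, rfl⟩
    obtain ⟨W, hW, hw⟩ := exists_submodule_of_orthogonal w
    exact ⟨W, hW, (Set.ext hw).symm⟩

lemma coll_mk {a b c : Fin 3 → F} (ha : a ≠ 0) (hb : b ≠ 0) (hc : c ≠ 0) {α β γ : F}
    (h : α • a + β • b = γ • c) (hγ : γ ≠ 0) :
    Coll (ℙ F (Fin 3 → F)) (Projectivization.mk F a ha) (Projectivization.mk F b hb)
      (Projectivization.mk F c hc) := by
  refine ⟨jn _ _ _, left_mem_jn _ _ _, right_mem_jn _ _ _, ?_⟩
  have h1 := left_mem_jn (ℙ F (Fin 3 → F)) (Projectivization.mk F a ha) (Projectivization.mk F b hb)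
  have h2 := right_mem_jn (ℙ F (Fin 3 → F)) (Projectivization.mk F a ha)
    (Projectivization.mk F b hb)
  generalize jn (ℙ F (Fin 3 → F)) (Projectivization.mk F a ha) (Projectivization.mk F b hb) = w
    at h1 h2
  induction w using Projectivization.ind with
  | h w hw =>
    rw [ofField.mem_iff, Projectivization.orthogonal_mk] at h1 h2 ⊢
    have h3 := congrArg (· ⬝ᵥ w) h
    simp only [add_dotProduct, smul_dotProduct, h1, h2, smul_eq_mul, mul_zero, add_zero] at h3
    exact (mul_eq_zero.1 h3.symm).resolve_left hγ

/-- The projective plane over a field of characteristic two is a Fano plane. -/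
lemma fanoPlane_proj (h2 : (2 : F) = 0) :
    FanoPlane (P := ℙ F (Fin 3 → F)) (ℙ F (Fin 3 → F)) := by
  intro a b c d habc habd hacd hbcd
  induction a using Projectivization.ind with | h a ha =>
  induction b using Projectivization.ind with | h b hb =>
  induction c using Projectivization.ind with | h c hc =>
  induction d using Projectivization.ind with | h d hd =>
  have hli : LinearIndependent F ![a, b, c] := by
    rw [Fintype.linearIndependent_iff]
    intro g hg
    rw [Fin.sum_univ_three] at hg
    simp only [Matrix.cons_val] at hg
    have e0 : g 2 = 0 := by
      by_contra h
      exact habc (coll_mk ha hb hc (α := g 0) (β := g 1) (γ := - g 2)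
        (by rw [neg_smul]; exact eq_neg_of_add_eq_zero_left hg) (neg_ne_zero.2 h))
    have e1 : g 1 = 0 := by
      by_contra h
      exact habc (coll_mk ha hc hb (α := g 0) (β := g 2) (γ := - g 1)
        (by rw [neg_smul]; refine eq_neg_of_add_eq_zero_left ?_; rw [← hg]; abel)
        (neg_ne_zero.2 h)).swap'
    rw [e0, e1, zero_smul, zero_smul, add_zero, add_zero] at hg
    have e2 : g 0 = 0 := (smul_eq_zero.1 hg).resolve_right ha
    intro i
    fin_cases i <;> assumption
  have hsp := hli.span_eq_top_of_card_eq_finrank' (by simp)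
  have hd' : d ∈ Submodule.span F (Set.range ![a, b, c]) := hsp ▸ Submodule.mem_top
  obtain ⟨g, hg⟩ := (Submodule.mem_span_range_iff_exists_fun F).1 hd'
  rw [Fin.sum_univ_three] at hg
  simp only [Matrix.cons_val] at hg
  generalize g 0 = α, g 1 = β, g 2 = γ at hg
  have hα : α ≠ 0 := by
    rintro rfl
    exact hbcd (coll_mk hb hc hd (α := β) (β := γ) (γ := 1) (by rw [← hg]; simp) one_ne_zero)
  have hβ : β ≠ 0 := by
    rintro rfl
    exact hacd (coll_mk ha hc hd (α := α) (β := γ) (γ := 1) (by rw [← hg]; simp) one_ne_zero)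
  have hγ : γ ≠ 0 := by
    rintro rfl
    exact habd (coll_mk ha hb hd (α := α) (β := β) (γ := 1) (by rw [← hg]; simp) one_ne_zero)
  rw [Fintype.linearIndependent_iff] at hli
  have ne : ∀ s t u : F, s ≠ 0 ∨ t ≠ 0 ∨ u ≠ 0 → s • a + t • b + u • c ≠ 0 := by
    intro s t u h h'
    have := hli ![s, t, u] (by simpa [Fin.sum_univ_three] using h')
    have e0 : s = 0 := this 0
    have e1 : t = 0 := this 1
    have e2 : u = 0 := this 2
    tauto
  have hx : α • a + β • b ≠ 0 := by simpa using ne α β 0 (.inl hα)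
  have hy : α • a + γ • c ≠ 0 := by simpa using ne α 0 γ (.inl hα)
  have hz : β • b + γ • c ≠ 0 := by simpa using ne 0 β γ (.inr (.inl hβ))
  have two : ∀ v : Fin 3 → F, v + v = 0 := fun v => by rw [← two_smul F, h2, zero_smul]
  refine ⟨Projectivization.mk F _ hx, Projectivization.mk F _ hy, Projectivization.mk F _ hz,
    (coll_mk ha hb hx (α := α) (β := β) (γ := 1) (by simp) one_ne_zero).rot.rot,
    (coll_mk hc hd hx (α := γ) (β := 1) (γ := 1) ?_ one_ne_zero).rot.rot,
    (coll_mk ha hc hy (α := α) (β := γ) (γ := 1) (by simp) one_ne_zero).rot.rot,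
    (coll_mk hb hd hy (α := β) (β := 1) (γ := 1) ?_ one_ne_zero).rot.rot,
    (coll_mk ha hd hz (α := α) (β := 1) (γ := 1) ?_ one_ne_zero).rot.rot,
    (coll_mk hb hc hz (α := β) (β := γ) (γ := 1) (by simp) one_ne_zero).rot.rot,
    coll_mk hx hy hz (α := 1) (β := 1) (γ := 1) ?_ one_ne_zero⟩
  · rw [← hg, one_smul, one_smul, add_comm, add_assoc, two, add_zero]
  · have := two (β • b)
    rw [← hg, one_smul, one_smul]
    linear_combination (exp := 1) this
  · have := two (α • a)
    rw [← hg, one_smul, one_smul]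
    linear_combination (exp := 1) this
  · have := two (α • a)
    simp only [one_smul]
    linear_combination (exp := 1) this

end Proj

section ProjPlane

variable {q : ℕ} (Pl : ProjPlane q)

instance : Fintype Pl.Point := Pl.fintypePoint

/-- The lines of a plane as a type. -/
def Line : Type := {ℓ : Set Pl.Point // ℓ ∈ Pl.L}

noncomputable instance : Fintype (Line Pl) := inferInstanceAs (Fintype {ℓ : Set Pl.Point // ℓ ∈ Pl.L})

instance : Membership Pl.Point (Line Pl) := ⟨fun ℓ x => x ∈ ℓ.1⟩

lemma mem_line_def (x : Pl.Point) (ℓ : Line Pl) : x ∈ ℓ ↔ x ∈ ℓ.1 := Iff.rfl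

lemma exists_line_through {a b : Pl.Point} (h : a ≠ b) : ∃ ℓ : Line Pl, a ∈ ℓ ∧ b ∈ ℓ := by
  obtain ⟨ℓ, ⟨h1, h2⟩, -⟩ := Pl.unique_line a b h
  exact ⟨⟨ℓ, h1⟩, h2⟩

lemma eq_or_eq_of_mem {p₁ p₂ : Pl.Point} {ℓ₁ ℓ₂ : Line Pl} (h11 : p₁ ∈ ℓ₁) (h21 : p₂ ∈ ℓ₁)
    (h12 : p₁ ∈ ℓ₂) (h22 : p₂ ∈ ℓ₂) : p₁ = p₂ ∨ ℓ₁ = ℓ₂ := by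
  by_contra! h
  exact h.2 (Subtype.ext ((Pl.unique_line p₁ p₂ h.1).unique ⟨ℓ₁.2, h11, h21⟩ ⟨ℓ₂.2, h12, h22⟩))

lemma exists_quad : ∃ a b c d : Pl.Point, a ≠ b ∧ a ≠ c ∧ a ≠ d ∧ b ≠ c ∧ b ≠ d ∧ c ≠ d ∧
    ∀ ℓ : Line Pl, ¬ (a ∈ ℓ ∧ b ∈ ℓ ∧ c ∈ ℓ) ∧ ¬ (a ∈ ℓ ∧ b ∈ ℓ ∧ d ∈ ℓ) ∧
      ¬ (a ∈ ℓ ∧ c ∈ ℓ ∧ d ∈ ℓ) ∧ ¬ (b ∈ ℓ ∧ c ∈ ℓ ∧ d ∈ ℓ) := by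
  obtain ⟨a, b, c, d, h1, h2, h3, h4, h5, h6, h⟩ := Pl.nondegenerate
  refine ⟨a, b, c, d, h1, h2, h3, h4, h5, h6, fun ℓ => ?_⟩
  have := h ℓ.1 ℓ.2
  simp only [Set.insert_subset_iff, Set.singleton_subset_iff] at this
  exact this

noncomputable instance : ProjectivePlane Pl.Point (Line Pl) where
  exists_point ℓ := by
    obtain ⟨a, b, c, d, -, -, -, -, -, -, h⟩ := exists_quad Pl
    by_contra! h'
    exact (h ℓ).1 ⟨h' a, h' b, h' c⟩
  exists_line p := by
    obtain ⟨a, b, c, d, h1, h2, -, h4, -, -, h⟩ := exists_quad Pl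
    by_contra! h'
    obtain ⟨m, ma, mb⟩ := exists_line_through Pl h1
    obtain ⟨n, na, nc⟩ := exists_line_through Pl h2
    obtain ⟨k, kb, kc⟩ := exists_line_through Pl h4
    rcases eq_or_eq_of_mem Pl ma (h' m) na (h' n) with e | e
    · exact (h k).1 ⟨e ▸ h' k, kb, kc⟩
    · exact (h m).1 ⟨ma, mb, e ▸ nc⟩
  eq_or_eq := eq_or_eq_of_mem Pl
  mkPoint {ℓ₁ ℓ₂} h :=
    (Pl.unique_point ℓ₁.1 ℓ₂.1 ℓ₁.2 ℓ₂.2 fun e => h (Subtype.ext e)).exists.choose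
  mkPoint_ax {ℓ₁ ℓ₂} h :=
    (Pl.unique_point ℓ₁.1 ℓ₂.1 ℓ₁.2 ℓ₂.2 fun e => h (Subtype.ext e)).exists.choose_spec
  mkLine h := (exists_line_through Pl h).choose
  mkLine_ax h := (exists_line_through Pl h).choose_spec
  exists_config := by
    obtain ⟨a, b, c, d, h1, h2, h3, h4, h5, h6, h⟩ := exists_quad Pl
    obtain ⟨l1, a1, d1⟩ := exists_line_through Pl h3
    obtain ⟨l2, b2, c2⟩ := exists_line_through Pl h4
    obtain ⟨l3, b3, d3⟩ := exists_line_through Pl h5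
    exact ⟨a, b, c, l1, l2, l3, fun e => (h l2).1 ⟨e, b2, c2⟩, fun e => (h l3).2.1 ⟨e, b3, d3⟩,
      fun e => (h l1).2.1 ⟨a1, e, d1⟩, b2, b3, fun e => (h l1).2.2.1 ⟨a1, e, d1⟩, c2,
      fun e => (h l3).2.2.2 ⟨b3, e, d3⟩⟩

lemma order_projPlane : ProjectivePlane.order Pl.Point (Line Pl) = q := by
  obtain ⟨p, -, -, l, -⟩ := ProjectivePlane.exists_config (P := Pl.Point) (L := Line Pl)
  have h1 := card_line (P := Pl.Point) l
  have h2 := Pl.line_card l.1 l.2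
  rw [Set.ncard_eq_toFinset_card'] at h2
  have : l.1.toFinset = Finset.univ.filter (· ∈ l) := by ext; simp [mem_line_def]
  rw [this, h1] at h2
  omega

end ProjPlane

/-! ## Arcs -/

section Arcs

variable {P : Type*} (L : Type*) [Membership P L] [ProjectivePlane P L]

/-- An ordered arc: distinct points, no three on a line. -/
def IsArc {n : ℕ} (p : Fin n → P) : Prop :=
  Function.Injective p ∧ ∀ i j k, i ≠ j → i ≠ k → j ≠ k → ¬ Coll L (p i) (p j) (p k)

variable {L}

lemma IsArc.notMem {n : ℕ} {p : Fin n → P} (h : IsArc L p) {i j k : Fin n} (hij : i ≠ j)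
    (hik : i ≠ k) (hjk : j ≠ k) : p k ∉ jn L (p i) (p j) := fun e =>
  h.2 i j k hij hik hjk ((coll_iff (h.1.ne hij)).2 e)

lemma IsArc.comp {n m : ℕ} {p : Fin n → P} (h : IsArc L p) {σ : Fin m → Fin n}
    (hσ : Function.Injective σ) : IsArc L (p ∘ σ) :=
  ⟨h.1.comp hσ, fun _ _ _ hij hik hjk => h.2 _ _ _ (hσ.ne hij) (hσ.ne hik) (hσ.ne hjk)⟩

lemma isArc_cons {n : ℕ} {p : Fin n → P} {x : P} :
    IsArc L (Fin.cons x p : Fin (n + 1) → P) ↔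
      IsArc L p ∧ (∀ i, x ≠ p i) ∧ ∀ i j, i ≠ j → x ∉ jn L (p i) (p j) := by
  constructor
  · intro h
    have ha : IsArc L p := by
      have := h.comp (Fin.succ_injective n)
      rwa [show (Fin.cons x p : Fin (n + 1) → P) ∘ Fin.succ = p from rfl] at this
    refine ⟨ha, fun i e => Fin.succ_ne_zero i (h.1 ?_), fun i j hij e => ?_⟩
    · rw [Fin.cons_succ, Fin.cons_zero, e]
    · refine h.2 0 i.succ j.succ (Fin.succ_ne_zero _).symm (Fin.succ_ne_zero _).symm
        ((Fin.succ_injective n).ne hij) ?_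
      rw [Fin.cons_succ, Fin.cons_succ, Fin.cons_zero]
      exact ((coll_iff (ha.1.ne hij)).2 e).rot.rot
  · rintro ⟨ha, h1, h2⟩
    have h3 : ∀ i j, i ≠ j → ¬ Coll L x (p i) (p j) := fun i j hij h =>
      h2 i j hij ((coll_iff (ha.1.ne hij)).1 h.rot)
    refine ⟨Fin.cons_injective_iff.2 ⟨by rintro ⟨i, hi⟩; exact h1 i hi.symm, ha.1⟩, ?_⟩
    intro i j k
    cases i using Fin.cases <;> cases j using Fin.cases <;> cases k using Fin.cases <;>
      simp only [Fin.cons_zero, Fin.cons_succ, ne_eq, not_true, Fin.succ_inj, IsEmpty.forall_iff,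
        implies_true]
    · exact fun _ _ h => h3 _ _ h
    · exact fun _ h _ h' => h3 _ _ h h'.swap
    · exact fun h _ _ h' => h3 _ _ h h'.rot.rot
    · exact ha.2 _ _ _

lemma card_filter_cons [Fintype P] {n : ℕ} (A : (Fin (n + 1) → P) → Prop)
    [DecidablePred A] :
    (Finset.univ.filter A).card =
      ∑ p : Fin n → P, (Finset.univ.filter fun x : P => A (Fin.cons x p)).card := by
  simp only [Finset.card_filter]
  rw [← Fintype.sum_equiv (Fin.consEquiv fun _ => P) (fun v => if A (Fin.cons v.1 v.2) then 1 else 0)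
    _ fun v => rfl, Fintype.sum_prod_type_right]

end Arcs

/-! ## Extending an arc by a point -/

section Edges

/-- The edges of the complete graph on `n` vertices. -/
def edges (n : ℕ) : Finset (Fin n × Fin n) := Finset.univ.filter fun e => e.1 < e.2

/-- Two edges without a common vertex. -/
def DisjEdge {n : ℕ} (e f : Fin n × Fin n) : Prop :=
  e.1 ≠ f.1 ∧ e.1 ≠ f.2 ∧ e.2 ≠ f.1 ∧ e.2 ≠ f.2

lemma mem_edges {n : ℕ} {e : Fin n × Fin n} : e ∈ edges n ↔ e.1 < e.2 := by simp [edges]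

lemma not_disjEdge_self {n : ℕ} (e : Fin n × Fin n) : ¬ DisjEdge e e := fun h => h.1 rfl

/-- The number of points off an arc on the secants `e` and `f`. -/
noncomputable def secPair {n : ℕ} (q : ℤ) (e f : Fin n × Fin n) : ℤ :=
  if e = f then q - 1 else if DisjEdge e f then 1 else 0

/-- The number of points off an arc on three secants that do not form a matching. -/
noncomputable def secTriple {n : ℕ} (q : ℤ) (e f g : Fin n × Fin n) : ℤ :=
  if e = f then secPair q f g else if f = g ∨ e = g then secPair q e f else 0

/-- Ordered matchings of three edges. -/
noncomputable def matchings (n : ℕ) : Finset ((Fin n × Fin n) × (Fin n × Fin n) × (Fin n × Fin n)) :=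
  (edges n ×ˢ edges n ×ˢ edges n).filter fun t =>
    DisjEdge t.1 t.2.1 ∧ DisjEdge t.2.1 t.2.2 ∧ DisjEdge t.1 t.2.2

/-- The part of the number of extensions of an arc that depends only on `n` and `q`. -/
noncomputable def extConst (n : ℕ) (q : ℤ) : ℤ :=
  6 * (q ^ 2 + q + 1 - n) - 11 * ∑ _e ∈ edges n, (q - 1) +
    6 * ∑ e ∈ edges n, ∑ f ∈ edges n, secPair q e f -
    ∑ e ∈ edges n, ∑ f ∈ edges n, ∑ g ∈ edges n, secTriple q e f g

end Edges

section Ext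

variable {P : Type*} {L : Type*} [Membership P L] [ProjectivePlane P L] {n : ℕ}

/-- The secant of `p` along an edge. -/
noncomputable def sec (L : Type*) [Membership P L] [ProjectivePlane P L] (p : Fin n → P)
    (e : Fin n × Fin n) : L := jn L (p e.1) (p e.2)

/-- The three secants along a matching are concurrent. -/
def Conc (L : Type*) [Membership P L] [ProjectivePlane P L] (p : Fin n → P)
    (t : (Fin n × Fin n) × (Fin n × Fin n) × (Fin n × Fin n)) : Prop :=
  ∃ x : P, x ∈ sec L p t.1 ∧ x ∈ sec L p t.2.1 ∧ x ∈ sec L p t.2.2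

variable {p : Fin n → P} (hp : IsArc L p) {e f g : Fin n × Fin n}

include hp

lemma IsArc.mem_sec (he : e ∈ edges n) (k : Fin n) : p k ∈ sec L p e ↔ k = e.1 ∨ k = e.2 := by
  have he' := (mem_edges.1 he).ne
  constructor
  · intro h
    by_contra! hk
    exact hp.notMem he' hk.1.symm hk.2.symm h
  · rintro (rfl | rfl) <;> simp [sec]

lemma IsArc.sec_ne (he : e ∈ edges n) (hf : f ∈ edges n) (hef : e ≠ f) :
    sec L p e ≠ sec L p f := by
  intro h
  have h1 := hp.mem_sec he f.1
  have h2 := hp.mem_sec he f.2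
  rw [h, hp.mem_sec hf] at h1 h2
  have he' := mem_edges.1 he
  have hf' := mem_edges.1 hf
  apply hef
  ext <;> grind

lemma IsArc.exists_eq (he : e ∈ edges n) (hf : f ∈ edges n) (hef : e ≠ f) (hd : ¬ DisjEdge e f)
    {x : P} (hx : x ∈ sec L p e) (hx' : x ∈ sec L p f) : ∃ i, x = p i := by
  have : ∃ i, p i ∈ sec L p e ∧ p i ∈ sec L p f := by
    simp only [hp.mem_sec he, hp.mem_sec hf]
    by_contra! h
    exact hd ⟨(h _ (.inl rfl)).1, (h _ (.inl rfl)).2, (h _ (.inr rfl)).1, (h _ (.inr rfl)).2⟩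
  obtain ⟨i, h1, h2⟩ := this
  exact ⟨i, pt_ext (hp.sec_ne he hf hef) hx hx' h1 h2⟩

lemma IsArc.ne_of_disjEdge (he : e ∈ edges n) (hf : f ∈ edges n) (hd : DisjEdge e f)
    {x : P} (hx : x ∈ sec L p e) (hx' : x ∈ sec L p f) (i : Fin n) : x ≠ p i := by
  rintro rfl
  rw [hp.mem_sec he] at hx
  rw [hp.mem_sec hf] at hx'
  unfold DisjEdge at hd
  grind

variable [Fintype P] [Fintype L]

/-- The points off the arc. -/
noncomputable def offPts (p : Fin n → P) : Finset P := Finset.univ.filter fun x => ∀ i, x ≠ p i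

omit hp in
lemma mem_offPts {x : P} : x ∈ offPts p ↔ ∀ i, x ≠ p i := by simp [offPts]

/-- Indicator of a point lying on a secant. -/
noncomputable def ind (L : Type*) [Membership P L] [ProjectivePlane P L] (p : Fin n → P)
    (x : P) (e : Fin n × Fin n) : ℤ := if x ∈ sec L p e then 1 else 0

lemma IsArc.card_offPts :
    ((offPts p).card : ℤ) = (order P L : ℤ) ^ 2 + order P L + 1 - n := by
  have h1 : offPts p = (Finset.univ.image p)ᶜ := by
    ext x; simp [mem_offPts, eq_comm]
  have h2 := card_points P L
  rw [h1, Finset.card_compl, Finset.card_image_of_injective _ hp.1, Finset.card_univ,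
    Fintype.card_fin, Nat.cast_sub, h2]
  · push_cast; ring
  · simpa using Fintype.card_le_of_injective p hp.1

lemma IsArc.sum_ind (he : e ∈ edges n) : ∑ x ∈ offPts p, ind L p x e = (order P L : ℤ) - 1 := by
  have he' := mem_edges.1 he
  simp only [ind, Finset.sum_boole]
  have h1 : (offPts p).filter (fun x => x ∈ sec L p e) =
      (Finset.univ.filter fun x => x ∈ sec L p e) \ {p e.1, p e.2} := by
    ext x
    simp only [Finset.mem_filter, mem_offPts, Finset.mem_univ, true_and, Finset.mem_sdiff,
      Finset.mem_insert, Finset.mem_singleton, not_or]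
    constructor
    · exact fun ⟨h, h'⟩ => ⟨h', h _, h _⟩
    · rintro ⟨h, h'⟩
      refine ⟨fun i => ?_, h⟩
      rintro rfl
      rcases (hp.mem_sec he i).1 h with rfl | rfl
      · exact h'.1 rfl
      · exact h'.2 rfl
  rw [h1, Finset.card_sdiff_of_subset, card_line, Finset.card_pair (hp.1.ne he'.ne)]
  · have := one_lt_order P L
    omega
  · intro x hx
    simp only [Finset.mem_insert, Finset.mem_singleton] at hx
    rw [Finset.mem_filter]
    rcases hx with rfl | rfl <;> simp [sec]

omit hp in
lemma ind_mul_self (x : P) : ind L p x e * ind L p x e = ind L p x e := by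
  unfold ind; split_ifs <;> rfl

lemma IsArc.ind_mul_eq_zero (he : e ∈ edges n) (hf : f ∈ edges n) (hef : e ≠ f)
    (hd : ¬ DisjEdge e f) {x : P} (hx : x ∈ offPts p) : ind L p x e * ind L p x f = 0 := by
  unfold ind
  split_ifs with h1 h2 <;> try rfl
  obtain ⟨i, hi⟩ := hp.exists_eq he hf hef hd h1 h2
  exact (mem_offPts.1 hx i hi).elim

lemma IsArc.sum_ind_mul (he : e ∈ edges n) (hf : f ∈ edges n) :
    ∑ x ∈ offPts p, ind L p x e * ind L p x f = secPair (order P L) e f := by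
  unfold secPair
  split_ifs with hef hd
  · subst hef
    simp only [ind_mul_self, hp.sum_ind he]
  · rw [Finset.sum_eq_single (mt (sec L p e) (sec L p f))]
    · simp [ind]
    · intro x _ hx
      unfold ind
      split_ifs with h1 h2 <;> try rfl
      exact (hx (eq_mt (hp.sec_ne he hf hef) h1 h2)).elim
    · intro h
      exact (h (mem_offPts.2 (hp.ne_of_disjEdge he hf hd (mt_mem_left _ _)
        (mt_mem_right _ _)))).elim
  · exact Finset.sum_eq_zero fun x hx => hp.ind_mul_eq_zero he hf hef hd hx

lemma IsArc.sum_ind_mul_mul (he : e ∈ edges n) (hf : f ∈ edges n) (hg : g ∈ edges n) :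
    ∑ x ∈ offPts p, ind L p x e * ind L p x f * ind L p x g = secTriple (order P L) e f g +
      if DisjEdge e f ∧ DisjEdge f g ∧ DisjEdge e g then
        if Conc L p (e, f, g) then 1 else 0 else 0 := by
  unfold secTriple
  by_cases hef : e = f
  · subst hef
    simp only [ind_mul_self, not_disjEdge_self, false_and, if_false, if_true, add_zero,
      hp.sum_ind_mul he hg]
  rw [if_neg hef]
  by_cases hg' : f = g ∨ e = g
  · rw [if_pos hg', ← hp.sum_ind_mul he hf, if_neg, add_zero]
    · refine Finset.sum_congr rfl fun x _ => ?_
      rcases hg' with rfl | rfl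
      · rw [mul_assoc, ind_mul_self]
      · rw [mul_right_comm, ind_mul_self]
    · rintro ⟨-, h1, h2⟩
      rcases hg' with rfl | rfl
      · exact not_disjEdge_self _ h1
      · exact not_disjEdge_self _ h2
  rw [if_neg hg', zero_add]
  rw [not_or] at hg'
  split_ifs with hd hc
  · obtain ⟨x, h1, h2, h3⟩ := hc
    rw [Finset.sum_eq_single x]
    · simp [ind, h1, h2, h3]
    · intro y _ hy
      unfold ind
      split_ifs with h4 h5 <;> try rfl
      exact (hy (pt_ext (hp.sec_ne he hf hef) h4 h5 h1 h2)).elim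
    · intro h
      exact (h (mem_offPts.2 (hp.ne_of_disjEdge he hf hd.1 h1 h2))).elim
  · refine Finset.sum_eq_zero fun x _ => ?_
    unfold ind
    split_ifs with h1 h2 h3 <;> try rfl
    exact (hc ⟨x, h1, h2, h3⟩).elim
  · refine Finset.sum_eq_zero fun x hx => ?_
    by_cases h1 : DisjEdge e f
    · by_cases h2 : DisjEdge f g
      · rw [mul_right_comm, hp.ind_mul_eq_zero he hg hg'.2 (fun h => hd ⟨h1, h2, h⟩) hx, zero_mul]
      · rw [mul_assoc, hp.ind_mul_eq_zero hf hg hg'.1 h2 hx, mul_zero]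
    · rw [hp.ind_mul_eq_zero he hf hef h1 hx, zero_mul]

lemma IsArc.card_secants_le (hn : n ≤ 7) {x : P} (hx : x ∈ offPts p) :
    ((edges n).filter fun e => x ∈ sec L p e).card ≤ 3 := by
  set A := (edges n).filter fun e => x ∈ sec L p e with hA
  have hd : ∀ e ∈ A, ∀ f ∈ A, e ≠ f → DisjEdge e f := by
    intro e he f hf hef
    rw [hA, Finset.mem_filter] at he hf
    by_contra h
    obtain ⟨i, hi⟩ := hp.exists_eq he.1 hf.1 hef h he.2 hf.2
    exact mem_offPts.1 hx i hi
  have h := Finset.card_biUnion (s := A) (t := fun e => ({e.1, e.2} : Finset (Fin n)))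
    (fun e he f hf hef => by
      obtain ⟨h1, h2, h3, h4⟩ := hd e he f hf hef
      simp [h1.symm, h2.symm, h3.symm, h4.symm])
  rw [Finset.sum_congr rfl fun e he => Finset.card_pair
    (mem_edges.1 (Finset.mem_filter.1 he).1).ne, Finset.sum_const, smul_eq_mul] at h
  have := Finset.card_le_univ (A.biUnion fun e => ({e.1, e.2} : Finset (Fin n)))
  rw [h, Fintype.card_fin] at this
  change A.card * 2 ≤ n at this
  omega

lemma IsArc.isArc_cons_iff {x : P} : IsArc L (Fin.cons x p : Fin (n + 1) → P) ↔
    x ∈ offPts p ∧ ((edges n).filter fun e => x ∈ sec L p e).card = 0 := by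
  rw [isArc_cons, mem_offPts, Finset.card_eq_zero, Finset.filter_eq_empty_iff]
  refine ⟨fun h => ⟨h.2.1, fun e he => h.2.2 _ _ (mem_edges.1 he).ne⟩, fun h =>
    ⟨hp, h.1, fun i j hij => ?_⟩⟩
  rcases hij.lt_or_gt with h' | h'
  · exact h.2 (x := (i, j)) (mem_edges.2 h')
  · rw [jn_comm]
    exact h.2 (x := (j, i)) (mem_edges.2 h')

/-- The number of one-point extensions of an arc. -/
theorem IsArc.card_ext (hn : n ≤ 7) :
    6 * ((Finset.univ.filter fun x : P => IsArc L (Fin.cons x p : Fin (n + 1) → P)).card : ℤ) =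
      extConst n (order P L) - ∑ t ∈ matchings n, if Conc L p t then 1 else 0 := by
  have hk : ∀ x, (((edges n).filter fun e => x ∈ sec L p e).card : ℤ) =
      ∑ e ∈ edges n, ind L p x e := fun x => by simp only [ind, Finset.sum_boole]
  have h6 : ∀ x ∈ offPts p, (if IsArc L (Fin.cons x p : Fin (n + 1) → P) then (6 : ℤ) else 0) =
      6 - 11 * ∑ e ∈ edges n, ind L p x e +
        6 * ∑ e ∈ edges n, ∑ f ∈ edges n, ind L p x e * ind L p x f -
        ∑ e ∈ edges n, ∑ f ∈ edges n, ∑ g ∈ edges n, ind L p x e * ind L p x f * ind L p x g := by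
    intro x hx
    have h := hp.card_secants_le hn hx
    simp only [← Finset.mul_sum, ← Finset.sum_mul, ← hk]
    rw [hp.isArc_cons_iff]
    generalize ((edges n).filter fun e => x ∈ sec L p e).card = k at h
    interval_cases k <;> simp [hx]
  have hs : (Finset.univ.filter fun x : P => IsArc L (Fin.cons x p : Fin (n + 1) → P)) =
      (offPts p).filter fun x => IsArc L (Fin.cons x p : Fin (n + 1) → P) := by
    ext x
    simp only [Finset.mem_filter, Finset.mem_univ, true_and]
    exact ⟨fun h => ⟨(hp.isArc_cons_iff.1 h).1, h⟩, fun h => h.2⟩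
  rw [hs, ← Finset.sum_boole, Finset.mul_sum]
  simp only [mul_ite, mul_one, mul_zero]
  rw [Finset.sum_congr rfl h6, Finset.sum_sub_distrib, Finset.sum_add_distrib,
    Finset.sum_sub_distrib, ← Finset.mul_sum, ← Finset.mul_sum, Finset.sum_const, nsmul_eq_mul,
    hp.card_offPts, Finset.sum_comm, Finset.sum_comm (s := offPts p), Finset.sum_comm (s := offPts p),
    Finset.sum_congr rfl fun e he => hp.sum_ind he,
    Finset.sum_congr rfl fun e he => (Finset.sum_comm.trans
      (Finset.sum_congr rfl fun f hf => hp.sum_ind_mul he hf)),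
    Finset.sum_congr rfl fun e he => (Finset.sum_comm.trans
      (Finset.sum_congr rfl fun f hf => (Finset.sum_comm.trans
        (Finset.sum_congr rfl fun g hg => hp.sum_ind_mul_mul he hf hg))))]
  simp only [Finset.sum_add_distrib]
  rw [extConst, matchings, Finset.sum_filter, Finset.sum_product]
  simp only [Finset.sum_product]
  ring

end Ext

/-! ## Counting arcs recursively -/

lemma mem_matchings {n : ℕ} {t : (Fin n × Fin n) × (Fin n × Fin n) × (Fin n × Fin n)} :
    t ∈ matchings n ↔ (t.1.1 < t.1.2 ∧ t.2.1.1 < t.2.1.2 ∧ t.2.2.1 < t.2.2.2) ∧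
      DisjEdge t.1 t.2.1 ∧ DisjEdge t.2.1 t.2.2 ∧ DisjEdge t.1 t.2.2 := by
  rw [matchings, Finset.mem_filter, Finset.mem_product, Finset.mem_product, mem_edges, mem_edges,
    mem_edges]

/-- The six vertices of three edges. -/
def verts {n : ℕ} (t : (Fin n × Fin n) × (Fin n × Fin n) × (Fin n × Fin n)) : Fin 6 → Fin n :=
  ![t.1.1, t.1.2, t.2.1.1, t.2.1.2, t.2.2.1, t.2.2.2]

lemma verts_injective {n : ℕ} {t : (Fin n × Fin n) × (Fin n × Fin n) × (Fin n × Fin n)}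
    (ht : t ∈ matchings n) : Function.Injective (verts t) := by
  obtain ⟨⟨a, b⟩, ⟨c, d⟩, ⟨e, f⟩⟩ := t
  simp only [mem_matchings, DisjEdge] at ht
  obtain ⟨⟨h1, h2, h3⟩, h4, h5, h6⟩ := ht
  have h1 := h1.ne
  have h2 := h2.ne
  have h3 := h3.ne
  intro i j
  fin_cases i <;> fin_cases j <;> simp [verts] <;> grind

lemma matchings_eq_empty {n : ℕ} (hn : n ≤ 5) : matchings n = ∅ := by
  rw [Finset.eq_empty_iff_forall_notMem]
  intro t ht
  have := Fintype.card_le_of_injective _ (verts_injective ht)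
  simp only [Fintype.card_fin] at this
  omega

lemma matchings_six_nonempty : (matchings 6).Nonempty :=
  ⟨((0, 1), (2, 3), (4, 5)), by
    rw [mem_matchings]; unfold DisjEdge; decide⟩

section Count

variable (P L : Type*) [Membership P L] [ProjectivePlane P L] [Fintype P] [Fintype L]

/-- The number of ordered `n`-arcs. -/
noncomputable def numArcs (n : ℕ) : ℕ := (Finset.univ.filter (IsArc L : (Fin n → P) → Prop)).card

/-- The number of ordered `6`-arcs whose three secants `01`, `23`, `45` are concurrent. -/
noncomputable def numConc : ℕ :=
  (Finset.univ.filter fun p : Fin 6 → P => IsArc L p ∧ Conc L p ((0, 1), (2, 3), (4, 5))).card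

lemma numArcs_zero : numArcs P L 0 = 1 := by
  rw [numArcs, Finset.filter_true_of_mem]
  · simp
  · exact fun p _ => ⟨fun i => i.elim0, fun i => i.elim0⟩

lemma six_mul_numArcs_succ {n : ℕ} (hn : n ≤ 7) : 6 * (numArcs P L (n + 1) : ℤ) =
    numArcs P L n * extConst n (order P L) -
      ∑ t ∈ matchings n,
        ((Finset.univ.filter fun p : Fin n → P => IsArc L p ∧ Conc L p t).card : ℤ) := by
  have h : ∀ p : Fin n → P,
      6 * ((Finset.univ.filter fun x : P => IsArc L (Fin.cons x p : Fin (n + 1) → P)).card : ℤ) =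
      (if IsArc L p then 1 else 0) * extConst n (order P L) -
        ∑ t ∈ matchings n, if IsArc L p ∧ Conc L p t then 1 else 0 := by
    intro p
    by_cases hp : IsArc L p
    · simp only [hp, if_true, one_mul, true_and, hp.card_ext hn]
    · simp [hp, isArc_cons]
  rw [numArcs, card_filter_cons]
  push_cast
  rw [Finset.mul_sum, Finset.sum_congr rfl fun p _ => h p, Finset.sum_sub_distrib, ← Finset.sum_mul,
    Finset.sum_comm, Finset.sum_boole]
  simp only [Finset.sum_boole]
  rfl

lemma card_conc_eq {t : (Fin 6 × Fin 6) × (Fin 6 × Fin 6) × (Fin 6 × Fin 6)}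
    (ht : t ∈ matchings 6) :
    (Finset.univ.filter fun p : Fin 6 → P => IsArc L p ∧ Conc L p t).card = numConc P L := by
  let σ : Equiv.Perm (Fin 6) :=
    Equiv.ofBijective (verts t) (Finite.injective_iff_bijective.1 (verts_injective ht))
  refine Finset.card_equiv (Equiv.arrowCongr σ.symm (Equiv.refl P)) fun p => ?_
  have e : Equiv.arrowCongr σ.symm (Equiv.refl P) p = p ∘ σ := rfl
  simp only [Finset.mem_filter, Finset.mem_univ, true_and, e]
  refine and_congr ⟨fun h => h.comp σ.injective, fun h => ?_⟩ Iff.rfl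
  have := h.comp σ.symm.injective
  rwa [Function.comp_assoc, Equiv.self_comp_symm, Function.comp_id] at this

lemma six_mul_numArcs_seven : 6 * (numArcs P L 7 : ℤ) =
    numArcs P L 6 * extConst 6 (order P L) - (matchings 6).card * numConc P L := by
  rw [six_mul_numArcs_succ P L (by norm_num : 6 ≤ 7),
    Finset.sum_congr rfl fun t ht => by rw [card_conc_eq P L ht], Finset.sum_const, nsmul_eq_mul]

variable {P L} {P' L' : Type*} [Membership P' L'] [ProjectivePlane P' L'] [Fintype P'] [Fintype L']

lemma numArcs_eq (h : order P L = order P' L') {n : ℕ} (hn : n ≤ 6) :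
    numArcs P L n = numArcs P' L' n := by
  induction n with
  | zero => rw [numArcs_zero, numArcs_zero]
  | succ n ih =>
    have h1 := six_mul_numArcs_succ P L (n := n) (by omega)
    have h2 := six_mul_numArcs_succ P' L' (n := n) (by omega)
    rw [matchings_eq_empty (by omega), Finset.sum_empty] at h1 h2
    rw [ih (by omega), h, ← h2] at h1
    omega

lemma numArcs_seven_lt (h : order P L = order P' L') (hc : numConc P' L' < numConc P L) :
    numArcs P L 7 < numArcs P' L' 7 := by
  have h1 := six_mul_numArcs_seven P L
  have h2 := six_mul_numArcs_seven P' L'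
  rw [numArcs_eq h le_rfl, h] at h1
  have h3 : 0 < (matchings 6).card := matchings_six_nonempty.card_pos
  have h4 : ((matchings 6).card : ℤ) * numConc P' L' < (matchings 6).card * numConc P L := by
    gcongr
  omega

end Count

/-! ## Quadrangles -/

section Quad

variable {P : Type*} (L : Type*) [Membership P L] [ProjectivePlane P L]

/-- Four points, no three collinear. -/
def Quad (a b c d : P) : Prop :=
  ¬ Coll L a b c ∧ ¬ Coll L a b d ∧ ¬ Coll L a c d ∧ ¬ Coll L b c d

/-- A diagonal point of a quadrangle. -/
noncomputable def diag (a b c d : P) : P := mt (jn L a b) (jn L c d)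

/-- A point on none of the six sides of a quadrangle. -/
def Free (a b c d x : P) : Prop :=
  (x ∉ jn L a b ∧ x ∉ jn L c d) ∧ (x ∉ jn L a c ∧ x ∉ jn L b d) ∧ (x ∉ jn L a d ∧ x ∉ jn L b c)

variable {L} {a b c d x : P} {n : L}

lemma Quad.swap (h : Quad L a b c d) : Quad L b a c d :=
  ⟨fun k => h.1 k.swap, fun k => h.2.1 k.swap, h.2.2.2, h.2.2.1⟩

lemma Quad.mid (h : Quad L a b c d) : Quad L a c b d :=
  ⟨fun k => h.1 k.swap', h.2.2.1, h.2.1, fun k => h.2.2.2 k.swap⟩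

lemma Quad.swap' (h : Quad L a b c d) : Quad L a b d c :=
  ⟨h.2.1, h.1, fun k => h.2.2.1 k.swap', fun k => h.2.2.2 k.swap'⟩

lemma Quad.opp (h : Quad L a b c d) : Quad L c d a b := h.mid.swap.swap'.mid

lemma Quad.ne (h : Quad L a b c d) : a ≠ b := by
  rintro rfl
  exact h.1 (coll_left a c)

lemma Quad.notMem (h : Quad L a b c d) : c ∉ jn L a b := fun k => h.1 ((coll_iff h.ne).2 k)

lemma Quad.jn_ne_jn (h : Quad L a b c d) : jn L a b ≠ jn L a c := fun e =>
  h.notMem ((congrArg (c ∈ ·) e).mpr (right_mem_jn L a c))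

lemma Quad.jn_ne_jn_opp (h : Quad L a b c d) : jn L a b ≠ jn L c d := fun e =>
  h.notMem ((congrArg (c ∈ ·) e).mpr (left_mem_jn L c d))

lemma Quad.notMem_of_diag (h : Quad L a b c d) (h1 : x ∈ jn L a b) (h2 : x ∈ jn L c d) :
    x ∉ jn L a c := fun h3 => by
  have e := pt_ext h.jn_ne_jn h1 h3 (left_mem_jn L a b) (left_mem_jn L a c)
  rw [e] at h2
  exact h.opp.notMem h2

/-! ### Lines through a diagonal point -/

lemma Quad.vertex_notMem (h : Quad L a b c d) (hx : diag L a b c d ∈ n) (hn : n ≠ jn L a b) :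
    a ∉ n := fun ha => by
  by_cases e : diag L a b c d = a
  · have : a ∈ jn L c d := by
      rw [← e]
      exact mt_mem_right _ _
    exact h.opp.notMem this
  · exact hn (line_ext e hx ha (mt_mem_left _ _) (left_mem_jn L a b))

lemma diag_swap (a b c d : P) : diag L b a c d = diag L a b c d := by
  rw [diag, jn_comm b a, diag]

lemma diag_swap' (a b c d : P) : diag L a b d c = diag L a b c d := by
  rw [diag, jn_comm d c, diag]

lemma Quad.diag_opp (h : Quad L a b c d) : diag L c d a b = diag L a b c d :=
  eq_mt h.jn_ne_jn_opp (mt_mem_right _ _) (mt_mem_left _ _)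

lemma Quad.diag_notMem (h : Quad L a b c d) : diag L a b c d ∉ jn L a c :=
  h.notMem_of_diag (mt_mem_left _ _) (mt_mem_right _ _)

lemma Quad.diag_ne (h : Quad L a b c d) : diag L a b c d ≠ diag L a c b d := fun e =>
  h.diag_notMem (e ▸ mt_mem_left _ _)

lemma Quad.mt_eq_mt_iff (h : Quad L a b c d) (hx : diag L a b c d ∈ n) :
    mt n (jn L a c) = mt n (jn L b d) ↔ diag L a c b d ∈ n := by
  have h1 : n ≠ jn L a c := by
    rintro rfl
    exact h.diag_notMem hx
  have h2 : n ≠ jn L b d := by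
    rintro rfl
    rw [← diag_swap, ← diag_swap'] at hx
    exact h.swap.swap'.diag_notMem hx
  constructor
  · intro e
    have : mt n (jn L a c) = diag L a c b d :=
      eq_mt h.mid.jn_ne_jn_opp (mt_mem_right _ _) (e ▸ mt_mem_right _ _)
    exact this ▸ mt_mem_left _ _
  · intro hq
    exact (eq_mt h1 hq (mt_mem_left _ _)).symm.trans (eq_mt h2 hq (mt_mem_right _ _))

lemma Quad.mt_ne_mt (h : Quad L a b c d) (ha : a ∉ n) : mt n (jn L a b) ≠ mt n (jn L a c) := by
  intro e
  have := pt_ext h.jn_ne_jn (mt_mem_right n _) (e ▸ mt_mem_right _ _) (left_mem_jn L a b)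
    (left_mem_jn L a c)
  exact ha (this ▸ mt_mem_left _ _)

variable [Fintype P] [Fintype L]

lemma Quad.card_free_on (h : Quad L a b c d) (hx : diag L a b c d ∈ n) (h1 : n ≠ jn L a b)
    (h2 : n ≠ jn L c d) :
    ((Finset.univ.filter fun y : P => Free L a b c d y ∧ y ∈ n).card : ℤ) =
      order P L - 4 + (if diag L a c b d ∈ n then 1 else 0) +
        (if diag L a d b c ∈ n then 1 else 0) := by
  have ha := h.vertex_notMem hx h1
  have hb := h.swap.vertex_notMem (by rwa [diag_swap]) (by rwa [jn_comm])
  have hc := h.opp.vertex_notMem (by rwa [h.diag_opp]) h2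
  have hd := h.opp.swap.vertex_notMem (by rwa [diag_swap, h.diag_opp]) (by rwa [jn_comm])
  set X := diag L a b c d with hX
  have hA : X ∉ jn L a c := h.diag_notMem
  have hB : X ∉ jn L b d := by
    rw [hX, ← diag_swap, ← diag_swap']; exact h.swap.swap'.diag_notMem
  have hC : X ∉ jn L a d := by
    rw [hX, ← diag_swap']; exact h.swap'.diag_notMem
  have hD : X ∉ jn L b c := by
    rw [hX, ← diag_swap]; exact h.swap.diag_notMem
  have key : ∀ {l : L}, X ∉ l → ∀ {y}, y ∈ n → (y ∉ l ↔ y ≠ mt n l) := by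
    intro l hl y hy
    have hnl : n ≠ l := by
      rintro rfl
      exact hl hx
    constructor
    · rintro h3 rfl
      exact h3 (mt_mem_right _ _)
    · exact fun h3 h4 => h3 (eq_mt hnl hy h4)
  have key2 : ∀ {l : L}, n ≠ l → X ∈ l → ∀ {y}, y ∈ n → (y ∉ l ↔ y ≠ X) := by
    intro l hl hl' y hy
    constructor
    · rintro h3 rfl
      exact h3 hl'
    · exact fun h3 h4 => h3 (pt_ext hl hy h4 hx hl')
  set A := mt n (jn L a c) with hAd
  set B := mt n (jn L b d) with hBd
  set C := mt n (jn L a d) with hCd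
  set D := mt n (jn L b c) with hDd
  have hset : (Finset.univ.filter fun y : P => Free L a b c d y ∧ y ∈ n) =
      (Finset.univ.filter fun y : P => y ∈ n) \ {X, A, B, C, D} := by
    ext y
    simp only [Finset.mem_filter, Finset.mem_univ, true_and, Finset.mem_sdiff, Finset.mem_insert,
      Finset.mem_singleton, not_or]
    rw [and_comm]
    refine and_congr_right fun hy => ?_
    unfold Free
    rw [key2 h1 (mt_mem_left _ _) hy, key2 h2 (mt_mem_right _ _) hy, key hA hy, key hB hy,
      key hC hy, key hD hy]
    tauto
  have hXA : X ≠ A := fun e => hA (e ▸ mt_mem_right _ _)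
  have hXB : X ≠ B := fun e => hB (e ▸ mt_mem_right _ _)
  have hXC : X ≠ C := fun e => hC (e ▸ mt_mem_right _ _)
  have hXD : X ≠ D := fun e => hD (e ▸ mt_mem_right _ _)
  have hAC : A ≠ C := h.mid.swap'.mt_ne_mt ha
  have hBD : B ≠ D := h.swap.mid.swap'.mid.mt_ne_mt hb
  have hAD : A ≠ D := by
    rw [hAd, hDd, jn_comm a c, jn_comm b c]
    exact h.mid.swap.mt_ne_mt hc
  have hBC : B ≠ C := by
    rw [hBd, hCd, jn_comm a d, jn_comm b d]
    exact h.opp.swap.mid.swap'.mid.mt_ne_mt hd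
  have hAB : A = B ↔ diag L a c b d ∈ n := h.mt_eq_mt_iff hx
  have hCD : C = D ↔ diag L a d b c ∈ n := h.swap'.mt_eq_mt_iff (by rwa [diag_swap'])
  have hcard : (({X, A, B, C, D} : Finset P).card : ℤ) =
      5 - (if diag L a c b d ∈ n then 1 else 0) - (if diag L a d b c ∈ n then 1 else 0) := by
    rw [← hAB, ← hCD]
    by_cases e1 : A = B <;> by_cases e2 : C = D
    · simp [← e1, ← e2, hXA, hXC, hAC]
    · simp [← e1, e2, hXA, hXC, hXD, hAC, hAD]
    · simp [e1, ← e2, hXA, hXB, hXC, hAC, hBC]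
    · simp [e1, e2, hXA, hXB, hXC, hXD, hAC, hBC, hAD, hBD]
  have hsub : ({X, A, B, C, D} : Finset P) ⊆ Finset.univ.filter fun y : P => y ∈ n := by
    intro y hy
    simp only [Finset.mem_insert, Finset.mem_singleton] at hy
    rw [Finset.mem_filter]
    refine ⟨Finset.mem_univ _, ?_⟩
    rcases hy with rfl | rfl | rfl | rfl | rfl
    · exact hx
    all_goals exact mt_mem_left _ _
  rw [hset, Finset.cast_card_sdiff hsub, card_line, hcard]
  push_cast
  ring

end Quad

/-! ## Pairs of free points on a line through a diagonal point -/

section Pairs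

variable {P : Type*} {L : Type*} [Membership P L] [ProjectivePlane P L] {a b c d x : P}

lemma Quad.diag_notMem_mid (h : Quad L a b c d) : diag L a c b d ∉ jn L a b := h.mid.diag_notMem

lemma Quad.diag_notMem_mid' (h : Quad L a b c d) : diag L a c b d ∉ jn L c d := by
  rw [← diag_swap, ← diag_swap']
  exact h.mid.swap.swap'.diag_notMem

lemma Quad.fanoQuad_iff (h : Quad L a b c d) :
    FanoQuad L a b c d ↔ diag L a d b c ∈ jn L (diag L a b c d) (diag L a c b d) := by
  rw [← coll_iff h.diag_ne]
  constructor
  · rintro ⟨x, y, z, h1, h2, h3, h4, h5, h6, h7⟩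
    have key : ∀ {a b c d x : P}, Quad L a b c d → Coll L x a b → Coll L x c d →
        x = diag L a b c d := fun h h1 h2 =>
      eq_mt h.jn_ne_jn_opp ((coll_iff h.ne).1 h1.rot) ((coll_iff h.opp.ne).1 h2.rot)
    rwa [← key h h1 h2, ← key h.mid h3 h4, ← key h.swap'.mid h5 h6]
  · intro k
    have key : ∀ {a b c d : P}, Coll L (diag L a b c d) a b ∧ Coll L (diag L a b c d) c d :=
      fun {a b c d} => ⟨⟨_, mt_mem_left _ _, left_mem_jn L a b, right_mem_jn L a b⟩,
        ⟨_, mt_mem_right _ _, left_mem_jn L c d, right_mem_jn L c d⟩⟩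
    exact ⟨_, _, _, key.1, key.2, key.1, key.2, key.1, key.2, k⟩

variable [Fintype P] [Fintype L]

lemma Quad.sum_sq_sub_pencil (h : Quad L a b c d) :
    ∑ n ∈ Finset.univ.filter (fun n : L => diag L a b c d ∈ n),
      (((Finset.univ.filter fun y : P => Free L a b c d y ∧ y ∈ n).card : ℤ) ^ 2 -
        (Finset.univ.filter fun y : P => Free L a b c d y ∧ y ∈ n).card) =
      ((order P L : ℤ) - 1) * ((order P L - 4) * (order P L - 5)) + 4 * (order P L - 4) +
        2 * if FanoQuad L a b c d then 1 else 0 := by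
  set X := diag L a b c d with hX
  set Q := diag L a c b d with hQ
  set R := diag L a d b c with hR
  set T := (Finset.univ.filter fun n : L => X ∈ n) \ {jn L a b, jn L c d} with hT
  have hmem : ∀ n, n ∈ T ↔ X ∈ n ∧ n ≠ jn L a b ∧ n ≠ jn L c d := by
    intro n
    simp [hT]
  have hsub : ({jn L a b, jn L c d} : Finset L) ⊆ Finset.univ.filter fun n : L => X ∈ n := by
    intro n hn
    simp only [Finset.mem_insert, Finset.mem_singleton] at hn
    rw [Finset.mem_filter]
    refine ⟨Finset.mem_univ _, ?_⟩
    rcases hn with rfl | rfl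
    · exact mt_mem_left _ _
    · exact mt_mem_right _ _
  have hTc : (T.card : ℤ) = order P L - 1 := by
    rw [hT, Finset.cast_card_sdiff hsub, card_pencil, Finset.card_pair h.jn_ne_jn_opp]
    push_cast
    ring
  have single : ∀ {Y : P}, X ≠ Y → Y ∉ jn L a b → Y ∉ jn L c d → ∀ n ∈ T,
      (Y ∈ n ↔ n = jn L X Y) := by
    intro Y hY _ _ n hn
    refine ⟨fun hYn => eq_jn hY ((hmem n).1 hn).1 hYn, fun e => ?_⟩
    rw [e]
    exact right_mem_jn L X Y
  have hjT : ∀ {Y : P}, Y ∉ jn L a b → Y ∉ jn L c d → jn L X Y ∈ T := by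
    intro Y h1 h2
    exact (hmem _).2 ⟨left_mem_jn L X Y, fun e => h1 ((congrArg (Y ∈ ·) e).mp (right_mem_jn L X Y)),
      fun e => h2 ((congrArg (Y ∈ ·) e).mp (right_mem_jn L X Y))⟩
  have hQ1 : Q ∉ jn L a b := h.diag_notMem_mid
  have hQ2 : Q ∉ jn L c d := h.diag_notMem_mid'
  have hR1 : R ∉ jn L a b := h.swap'.diag_notMem_mid
  have hR2 : R ∉ jn L c d := by
    rw [jn_comm]
    exact h.swap'.diag_notMem_mid'
  have hXQ : X ≠ Q := h.diag_ne
  have hXR : X ≠ R := by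
    rw [hX, ← diag_swap']
    exact h.swap'.diag_ne
  have sum1 : ∀ {Y : P}, X ≠ Y → Y ∉ jn L a b → Y ∉ jn L c d →
      ∑ n ∈ T, (if Y ∈ n then (1 : ℤ) else 0) = 1 := by
    intro Y h1 h2 h3
    rw [Finset.sum_congr rfl fun n hn => by rw [single h1 h2 h3 n hn], Finset.sum_ite_eq',
      if_pos (hjT h2 h3)]
  have sum2 : ∑ n ∈ T, (if Q ∈ n then (1 : ℤ) else 0) * (if R ∈ n then 1 else 0) =
      if FanoQuad L a b c d then 1 else 0 := by
    rw [h.fanoQuad_iff]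
    simp only [ite_mul, one_mul, zero_mul]
    rw [Finset.sum_congr rfl fun n hn => by rw [single hXQ hQ1 hQ2 n hn], Finset.sum_ite_eq',
      if_pos (hjT hQ1 hQ2)]
  have hz : ∀ n ∈ ({jn L a b, jn L c d} : Finset L),
      (((Finset.univ.filter fun y : P => Free L a b c d y ∧ y ∈ n).card : ℤ) ^ 2 -
        (Finset.univ.filter fun y : P => Free L a b c d y ∧ y ∈ n).card) = 0 := by
    intro n hn
    rw [Finset.filter_false_of_mem]
    · simp
    · rintro y - ⟨⟨⟨h1, h2⟩, -⟩, h3⟩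
      simp only [Finset.mem_insert, Finset.mem_singleton] at hn
      rcases hn with rfl | rfl
      · exact h1 h3
      · exact h2 h3
  have ht : ∀ n ∈ T, (((Finset.univ.filter fun y : P => Free L a b c d y ∧ y ∈ n).card : ℤ) ^ 2 -
        (Finset.univ.filter fun y : P => Free L a b c d y ∧ y ∈ n).card) =
      ((order P L : ℤ) - 4) * (order P L - 5) +
        2 * (order P L - 4) * (if Q ∈ n then 1 else 0) +
        2 * (order P L - 4) * (if R ∈ n then 1 else 0) +
        2 * ((if Q ∈ n then 1 else 0) * (if R ∈ n then 1 else 0)) := by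
    intro n hn
    obtain ⟨h1, h2, h3⟩ := (hmem n).1 hn
    rw [h.card_free_on h1 h2 h3]
    split_ifs <;> ring
  rw [← Finset.sum_sdiff hsub, Finset.sum_eq_zero hz, add_zero, Finset.sum_congr rfl ht,
    Finset.sum_add_distrib, Finset.sum_add_distrib, Finset.sum_add_distrib, Finset.sum_const,
    nsmul_eq_mul, ← Finset.mul_sum, ← Finset.mul_sum, ← Finset.mul_sum, sum1 hXQ hQ1 hQ2,
    sum1 hXR hR1 hR2, sum2, hTc]
  ring

/-- The number of ordered pairs of free points on a line through a diagonal point. -/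
lemma Quad.card_pairs (h : Quad L a b c d) :
    ((Finset.univ.filter fun v : P × P => Free L a b c d v.1 ∧ Free L a b c d v.2 ∧ v.1 ≠ v.2 ∧
      Coll L v.1 v.2 (diag L a b c d)).card : ℤ) =
      ((order P L : ℤ) - 1) * ((order P L - 4) * (order P L - 5)) + 4 * (order P L - 4) +
        2 * if FanoQuad L a b c d then 1 else 0 := by
  rw [← h.sum_sq_sub_pencil]
  have hset : (Finset.univ.filter fun v : P × P => Free L a b c d v.1 ∧ Free L a b c d v.2 ∧
      v.1 ≠ v.2 ∧ Coll L v.1 v.2 (diag L a b c d)) =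
      (Finset.univ.filter fun n : L => diag L a b c d ∈ n).biUnion fun n =>
        (Finset.univ.filter fun y : P => Free L a b c d y ∧ y ∈ n).offDiag := by
    ext ⟨y, z⟩
    simp only [Finset.mem_filter, Finset.mem_univ, true_and, Finset.mem_biUnion,
      Finset.mem_offDiag]
    constructor
    · rintro ⟨h1, h2, h3, l, h4, h5, h6⟩
      exact ⟨l, h6, ⟨h1, h4⟩, ⟨h2, h5⟩, h3⟩
    · rintro ⟨l, h6, ⟨h1, h4⟩, ⟨h2, h5⟩, h3⟩
      exact ⟨h1, h2, h3, l, h4, h5, h6⟩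
  rw [hset, Finset.card_biUnion]
  · push_cast
    refine Finset.sum_congr rfl fun n _ => ?_
    rw [Finset.offDiag_card, Nat.cast_sub (Nat.le_mul_self _)]
    push_cast
    ring
  · intro l hl m hm hlm
    refine Finset.disjoint_left.2 ?_
    rintro ⟨y, z⟩ h1 h2
    simp only [Finset.mem_filter, Finset.mem_univ, true_and, Finset.mem_offDiag] at h1 h2
    have := pt_ext hlm h1.1.2 h2.1.2 (Finset.mem_filter.1 (Finset.mem_coe.1 hl)).2
      (Finset.mem_filter.1 (Finset.mem_coe.1 hm)).2
    rw [this] at h1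
    exact h1.1.1.1.1 (mt_mem_left _ _)

end Pairs

/-! ## Concurrent secants of 6-arcs -/

section FourArcs

variable {P : Type*} {L : Type*} [Membership P L] [ProjectivePlane P L]

lemma isArc_four_iff {p : Fin 4 → P} : IsArc L p ↔ Quad L (p 0) (p 1) (p 2) (p 3) := by
  constructor
  · intro h
    exact ⟨h.2 _ _ _ (by decide) (by decide) (by decide),
      h.2 _ _ _ (by decide) (by decide) (by decide), h.2 _ _ _ (by decide) (by decide) (by decide),
      h.2 _ _ _ (by decide) (by decide) (by decide)⟩
  · rintro ⟨h1, h2, h3, h4⟩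
    have key : ∀ i j k : Fin 4, i < j → j < k → ¬ Coll L (p i) (p j) (p k) := by
      intro i j k
      fin_cases i <;> fin_cases j <;> fin_cases k <;> first
        | exact fun h => absurd h (by decide)
        | exact fun _ h => absurd h (by decide)
        | exact fun _ _ => h1
        | exact fun _ _ => h2
        | exact fun _ _ => h3
        | exact fun _ _ => h4
    have key' : ∀ i j k : Fin 4, i ≠ j → i ≠ k → j ≠ k → ¬ Coll L (p i) (p j) (p k) := by
      intro i j k hij hik hjk h
      rcases hij.lt_or_gt with h1 | h1 <;> rcases hjk.lt_or_gt with h2 | h2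
      · exact key _ _ _ h1 h2 h
      · rcases hik.lt_or_gt with h3 | h3
        · exact key _ _ _ h3 h2 h.swap'
        · exact key _ _ _ h3 h1 h.rot.rot
      · rcases hik.lt_or_gt with h3 | h3
        · exact key _ _ _ h1 h3 h.swap
        · exact key _ _ _ h2 h3 h.rot
      · exact key _ _ _ h2 h1 h.rot.swap
    refine ⟨fun i j e => ?_, key'⟩
    by_contra hij
    obtain ⟨k, hik, hjk⟩ := (by decide : ∀ i j : Fin 4, ∃ k, i ≠ k ∧ j ≠ k) i j
    exact key' i j k hij hik hjk (e ▸ coll_left _ _)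

lemma IsArc.quad {p : Fin 4 → P} (h : IsArc L p) : Quad L (p 0) (p 1) (p 2) (p 3) :=
  isArc_four_iff.1 h

lemma IsArc.cons_iff_free {p : Fin 4 → P} (h : IsArc L p) {y : P} :
    IsArc L (Fin.cons y p : Fin 5 → P) ↔ Free L (p 0) (p 1) (p 2) (p 3) y := by
  rw [isArc_cons]
  constructor
  · rintro ⟨-, -, h2⟩
    exact ⟨⟨h2 _ _ (by decide), h2 _ _ (by decide)⟩, ⟨h2 _ _ (by decide), h2 _ _ (by decide)⟩,
      ⟨h2 _ _ (by decide), h2 _ _ (by decide)⟩⟩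
  · rintro ⟨⟨h1, h2⟩, ⟨h3, h4⟩, ⟨h5, h6⟩⟩
    refine ⟨h, fun i => ?_, fun i j hij => ?_⟩
    · fin_cases i <;> rintro rfl
      · exact h1 (left_mem_jn L _ _)
      · exact h1 (right_mem_jn L _ _)
      · exact h2 (left_mem_jn L _ _)
      · exact h2 (right_mem_jn L _ _)
    · have key : ∀ i j : Fin 4, i < j → y ∉ jn L (p i) (p j) := by
        intro i j
        fin_cases i <;> fin_cases j <;> first
          | exact fun h => absurd h (by decide)
          | exact fun _ => h1
          | exact fun _ => h2
          | exact fun _ => h3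
          | exact fun _ => h4
          | exact fun _ => h5
          | exact fun _ => h6
      rcases hij.lt_or_gt with h' | h'
      · exact key i j h'
      · rw [jn_comm]
        exact key j i h'

lemma IsArc.cons_cons_iff {p : Fin 4 → P} (h : IsArc L p) {y z : P} :
    (IsArc L (Fin.cons y (Fin.cons z p : Fin 5 → P) : Fin 6 → P) ∧
      Conc L (Fin.cons y (Fin.cons z p : Fin 5 → P) : Fin 6 → P) ((0, 1), (2, 3), (4, 5))) ↔
    Free L (p 0) (p 1) (p 2) (p 3) y ∧ Free L (p 0) (p 1) (p 2) (p 3) z ∧ y ≠ z ∧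
      Coll L y z (diag L (p 0) (p 1) (p 2) (p 3)) := by
  have hq := h.quad
  have hconc : Conc L (Fin.cons y (Fin.cons z p : Fin 5 → P) : Fin 6 → P)
      ((0, 1), (2, 3), (4, 5)) ↔ diag L (p 0) (p 1) (p 2) (p 3) ∈ jn L y z := by
    constructor
    · rintro ⟨x, h1, h2, h3⟩
      have : x = diag L (p 0) (p 1) (p 2) (p 3) := eq_mt hq.jn_ne_jn_opp h2 h3
      exact this ▸ h1
    · exact fun h => ⟨_, h, mt_mem_left _ _, mt_mem_right _ _⟩
  rw [hconc]
  constructor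
  · rintro ⟨h1, h2⟩
    have hyz : y ≠ z := (isArc_cons.1 h1).2.1 0
    refine ⟨h.cons_iff_free.1 ?_, h.cons_iff_free.1 (isArc_cons.1 h1).1, hyz, (coll_iff hyz).2 h2⟩
    have h3 := h1.comp (σ := Fin.cons 0 fun i => i.succ.succ) (by decide)
    convert h3 using 1
    ext i
    cases i using Fin.cases <;> rfl
  · rintro ⟨h1, h2, hyz, h3⟩
    rw [coll_iff hyz] at h3
    refine ⟨isArc_cons.2 ⟨h.cons_iff_free.2 h2, ?_, ?_⟩, h3⟩
    · have hy := (isArc_cons.1 (h.cons_iff_free.2 h1)).2.1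
      exact Fin.cases hyz hy
    · have hy := (isArc_cons.1 (h.cons_iff_free.2 h1)).2.2
      have key : ∀ i, y ∉ jn L z (p i) := by
        intro i hi
        have hzi : z ≠ p i := (isArc_cons.1 (h.cons_iff_free.2 h2)).2.1 i
        have e := line_ext hyz (left_mem_jn L y z) (right_mem_jn L y z) hi (left_mem_jn L z (p i))
        have hi' : p i ∈ jn L y z := (congrArg (p i ∈ ·) e).mpr (right_mem_jn L z (p i))
        have hn1 : jn L y z ≠ jn L (p 0) (p 1) := fun e =>
          h1.1.1 ((congrArg (y ∈ ·) e).mp (left_mem_jn L y z))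
        have hn2 : jn L y z ≠ jn L (p 2) (p 3) := fun e =>
          h1.1.2 ((congrArg (y ∈ ·) e).mp (left_mem_jn L y z))
        fin_cases i
        · exact hq.vertex_notMem h3 hn1 hi'
        · exact hq.swap.vertex_notMem (by rwa [diag_swap]) (by rwa [jn_comm (p 1)]) hi'
        · exact hq.opp.vertex_notMem (by rwa [hq.diag_opp]) hn2 hi'
        · exact hq.opp.swap.vertex_notMem (by rwa [diag_swap, hq.diag_opp])
            (by rwa [jn_comm (p 3)]) hi'
      refine Fin.cases (Fin.cases (fun h => (h rfl).elim) fun j _ => key j) fun i =>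
        Fin.cases (fun _ => ?_) fun j hij => hy i j fun e => hij (congrArg _ e)
      rw [jn_comm]
      exact key i

variable [Fintype P] [Fintype L]

lemma numConc_eq : (numConc P L : ℤ) =
    numArcs P L 4 *
      (((order P L : ℤ) - 1) * ((order P L - 4) * (order P L - 5)) + 4 * (order P L - 4)) +
    2 * (Finset.univ.filter fun p : Fin 4 → P =>
      IsArc L p ∧ FanoQuad L (p 0) (p 1) (p 2) (p 3)).card := by
  have h : ∀ p : Fin 4 → P, ((∑ z : P, (Finset.univ.filter fun y : P =>
      IsArc L (Fin.cons y (Fin.cons z p : Fin 5 → P) : Fin 6 → P) ∧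
      Conc L (Fin.cons y (Fin.cons z p : Fin 5 → P) : Fin 6 → P) ((0, 1), (2, 3), (4, 5))).card :
        ℕ) : ℤ) =
      (if IsArc L p then 1 else 0) *
        (((order P L : ℤ) - 1) * ((order P L - 4) * (order P L - 5)) + 4 * (order P L - 4)) +
      2 * if IsArc L p ∧ FanoQuad L (p 0) (p 1) (p 2) (p 3) then 1 else 0 := by
    intro p
    by_cases hp : IsArc L p
    · simp only [hp, if_true, one_mul, true_and, hp.cons_cons_iff]
      rw [← hp.quad.card_pairs]
      simp only [Finset.card_filter]
      rw [Fintype.sum_prod_type_right]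
    · simp [hp, isArc_cons]
  rw [numConc, card_filter_cons, ← Fintype.sum_equiv (Fin.consEquiv fun _ => P)
    (fun v => (Finset.univ.filter fun y : P =>
      IsArc L (Fin.cons y (Fin.cons v.1 v.2 : Fin 5 → P) : Fin 6 → P) ∧
      Conc L (Fin.cons y (Fin.cons v.1 v.2 : Fin 5 → P) : Fin 6 → P)
        ((0, 1), (2, 3), (4, 5))).card) _ fun v => rfl, Fintype.sum_prod_type_right, Nat.cast_sum,
    Finset.sum_congr rfl fun p _ => h p, Finset.sum_add_distrib, ← Finset.sum_mul, Finset.sum_boole,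
    ← Finset.mul_sum, Finset.sum_boole]
  rfl

end FourArcs

section Main

variable {P L P' L' : Type*} [Membership P L] [ProjectivePlane P L] [Membership P' L']
  [ProjectivePlane P' L'] [Fintype P] [Fintype L] [Fintype P'] [Fintype L']

theorem numArcs_seven_lt_of_fanoPlane (h : order P L = order P' L') (hF : FanoPlane (P := P) L)
    (hF' : ¬ FanoPlane (P := P') L') : numArcs P L 7 < numArcs P' L' 7 := by
  refine numArcs_seven_lt h ?_
  have h1 := numConc_eq (P := P) (L := L)
  have h2 := numConc_eq (P := P') (L := L')
  rw [numArcs_eq h (by norm_num : 4 ≤ 6), h] at h1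
  have h3 : (Finset.univ.filter fun p : Fin 4 → P =>
      IsArc L p ∧ FanoQuad L (p 0) (p 1) (p 2) (p 3)).card = numArcs P L 4 := by
    rw [numArcs]
    congr 1
    ext p
    simp only [Finset.mem_filter, Finset.mem_univ, true_and, and_iff_left_iff_imp]
    exact fun hp => hF _ _ _ _ hp.quad.1 hp.quad.2.1 hp.quad.2.2.1 hp.quad.2.2.2
  rw [h3, numArcs_eq h (by norm_num : 4 ≤ 6)] at h1
  have h4 : (Finset.univ.filter fun p : Fin 4 → P' =>
      IsArc L' p ∧ FanoQuad L' (p 0) (p 1) (p 2) (p 3)).card < numArcs P' L' 4 := by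
    refine Finset.card_lt_card ⟨fun p hp => ?_, fun hs => ?_⟩
    · rw [Finset.mem_filter] at hp ⊢
      exact ⟨hp.1, hp.2.1⟩
    · refine hF' fun a b c d h1 h2 h3 h4 => ?_
      have := @hs ![a, b, c, d] (Finset.mem_filter.2
        ⟨Finset.mem_univ _, isArc_four_iff.2 ⟨h1, h2, h3, h4⟩⟩)
      exact (Finset.mem_filter.1 this).2.2
  omega

end Main

/-! ## The frozen counts as arc counts -/

open scoped LinearAlgebra.Projectivization

lemma coll_iff_exists_subset {P L : Type*} [Membership P L] [ProjectivePlane P L] {a b c : P} :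
    Coll L a b c ↔ ∃ l : L, ({a, b, c} : Set P) ⊆ {x | x ∈ l} := by
  simp [Coll, Set.insert_subset_iff]

lemma collinear_iff {q : ℕ} (Pl : ProjPlane q) (a b c : Pl.Point) :
    Pl.Collinear {a, b, c} ↔ Coll (Line Pl) a b c := by
  rw [coll_iff_exists_subset]
  exact ⟨fun ⟨l, hl, h⟩ => ⟨⟨l, hl⟩, h⟩, fun ⟨l, h⟩ => ⟨l.1, l.2, h⟩⟩

lemma nArcs_eq_numArcs {q : ℕ} (Pl : ProjPlane q) (n : ℕ) :
    Pl.nArcs n = numArcs Pl.Point (Line Pl) n := by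
  refine Nat.subtype_card _ fun p => ?_
  simp only [Finset.mem_filter, Finset.mem_univ, true_and, IsArc, collinear_iff]

variable {F : Type} [Field F]

lemma exists_P2Lines_iff (a b c : ℙ F (Fin 3 → F)) :
    (∃ ℓ ∈ P2Lines F, ({a, b, c} : Set (ℙ F (Fin 3 → F))) ⊆ ℓ) ↔
      Coll (ℙ F (Fin 3 → F)) a b c := by
  rw [coll_iff_exists_subset]
  constructor
  · rintro ⟨l, hl, h⟩
    obtain ⟨w, rfl⟩ := (mem_P2Lines l).1 hl
    exact ⟨w, h⟩
  · rintro ⟨w, h⟩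
    exact ⟨_, (mem_P2Lines _).2 ⟨w, rfl⟩, h⟩

lemma P2nArcs_eq_numArcs [Fintype (ℙ F (Fin 3 → F))] (n : ℕ) :
    P2nArcs F n = numArcs (ℙ F (Fin 3 → F)) (ℙ F (Fin 3 → F)) n := by
  refine Nat.subtype_card _ fun p => ?_
  simp only [Finset.mem_filter, Finset.mem_univ, true_and, IsArc, exists_P2Lines_iff]

end PlaneArcs

/-- For `q = 2^r`, any projective plane of order `q` that is not isomorphic to
the Desarguesian plane `ℙ²(F_q)` has strictly more ordered 7-arcs than
`ℙ²(F_q)`; i.e. the Desarguesian plane of order `2^r` has strictly the fewest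
7-arcs. -/
theorem desarguesian_fewest_seven_arcs (r : ℕ) (hr : 1 ≤ r) (q : ℕ) (hq : q = 2 ^ r)
    (F : Type) [Field F] [Fintype F] (hF : Fintype.card F = q)
    (Pl : ProjPlane q)
    (hniso : ¬ ∃ e : Pl.Point ≃ Projectivization F (Fin 3 → F),
      ∀ ℓ : Set Pl.Point, ℓ ∈ Pl.L ↔ e '' ℓ ∈ P2Lines F) :
    P2nArcs F 7 < Pl.nArcs 7 := by
  have : Fintype (Projectivization F (Fin 3 → F)) := Fintype.ofFinite _
  have h2 : (2 : F) = 0 := by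
    have h := Nat.cast_card_eq_zero F
    rw [hF, hq] at h
    push_cast at h
    exact pow_eq_zero_iff (by omega) |>.1 h
  rw [PlaneArcs.nArcs_eq_numArcs, PlaneArcs.P2nArcs_eq_numArcs]
  refine PlaneArcs.numArcs_seven_lt_of_fanoPlane ?_ (PlaneArcs.fanoPlane_proj h2) fun hFano => hniso ?_
  · rw [PlaneArcs.order_proj, PlaneArcs.order_projPlane, hF]
  · obtain ⟨e, he⟩ := PlaneArcs.exists_equiv_proj hFano ((PlaneArcs.order_projPlane Pl).trans hq) F
      (hF.trans (PlaneArcs.order_projPlane Pl).symm)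
    refine ⟨e, fun S => ?_⟩
    rw [PlaneArcs.mem_P2Lines, ← he]
    exact ⟨fun h => ⟨⟨S, h⟩, rfl⟩, fun ⟨l, h⟩ => h ▸ l.2⟩
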